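/- For ρ and ρ̄/ρ small enough (depending on v₂, v₃ and M) there exist a constant e^gen_cell ∈ ℝ and an increasing, convex, piecewise affine function e_range : M → ℝ, both depending only on v₂, v₃, ρ and ρ̄, such that |e^gen_cell + ρ̄ e_range(μ) − E^{n,μ}_min| ≤ c (ρ̄² + 1/n) for all μ ∈ M and all n ≥ 3, where c = c(v₂,v₃,ρ) > 0. -/

import Mathlib

open Real

attribute [local instance] Classical.propDecidable

noncomputable section

/-- Counterclockwise angle from `a` to `b`, in `[0, 2π)`. -/
def ccwAngle (a b : ℂ) : ℝ :=
  if Complex.arg (b * (starRingEnd ℂ) a) < 0 then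
    Complex.arg (b * (starRingEnd ℂ) a) + 2 * π
  else Complex.arg (b * (starRingEnd ℂ) a)

/-- Bond length `b_i`. -/
def bnd (y : ℕ → ℂ) (i : ℕ) : ℝ := ‖y (i + 1) - y i‖

/-- Bond angle `φ_i = ∡(y_{i-1} − y_i, y_{i+1} − y_i)`. -/
def ang (y : ℕ → ℂ) (i : ℕ) : ℝ := ccwAngle (y (i - 1) - y i) (y (i + 1) - y i)

/-- Admissible configurations `𝒜_n` (atoms indexed `1,…,n`). -/
def Admissible (n : ℕ) (y : ℕ → ℂ) : Prop :=
  (∀ i j : ℕ, 1 ≤ i → i ≤ n → 1 ≤ j → j ≤ n → (i + 2 ≤ j ∨ j + 2 ≤ i) →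
      (1.5 : ℝ) < ‖y i - y j‖) ∧
  (∀ i : ℕ, 1 ≤ i → i + 1 ≤ n → ‖y (i + 1) - y i‖ ≤ (1.5 : ℝ))

/-- Assumptions on the two-body potential `v₂` and the three-body potential `v₃`. -/
structure PotentialPair (v₂ v₃ : ℝ → ℝ) : Prop where
  v₂_smooth : ContDiffOn ℝ (⊤ : ℕ∞) v₂ (Set.Ioi 0)
  v₂_lb : ∀ x ∈ Set.Ioi (0 : ℝ), (-1 : ℝ) ≤ v₂ x
  v₂_min : v₂ 1 = -1
  v₂_min_unique : ∀ x ∈ Set.Ioi (0 : ℝ), x ≠ 1 → v₂ 1 < v₂ x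
  v₂_conv : 0 < iteratedDeriv 2 v₂ 1
  v₂_mono : StrictMonoOn v₂ (Set.Ici 1)
  v₃_smooth : ContDiffOn ℝ (⊤ : ℕ∞) v₃ (Set.Icc 0 (2 * π))
  v₃_nonneg : ∀ x ∈ Set.Icc (0 : ℝ) (2 * π), 0 ≤ v₃ x
  v₃_symm : ∀ φ : ℝ, v₃ (π - φ) = v₃ (π + φ)
  v₃_min : v₃ π = 0
  v₃_min_unique : ∀ x ∈ Set.Icc (0 : ℝ) (2 * π), x ≠ π → 0 < v₃ x
  v₃_d1 : deriv v₃ π = 0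
  v₃_d2 : iteratedDeriv 2 v₃ π = 0
  v₃_d3 : iteratedDeriv 3 v₃ π = 0
  v₃_d4 : 0 < iteratedDeriv 4 v₃ π

/-- The cell energy in terms of bond lengths and angle. -/
def EcellT (v₂ v₃ : ℝ → ℝ) (ρ b₁ b₂ φ : ℝ) : ℝ :=
  v₂ b₁ + v₂ b₂ + ρ * v₂ (Real.sqrt (b₁ ^ 2 + b₂ ^ 2 - 2 * b₁ * b₂ * Real.cos φ)) + v₃ φ

/-- The cell energy. -/
def Ecell (v₂ v₃ : ℝ → ℝ) (ρ : ℝ) (p q r : ℂ) : ℝ :=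
  v₂ ‖q - p‖ + v₂ ‖r - q‖ + v₃ (ccwAngle (r - q) (p - q)) + ρ * v₂ ‖r - p‖

/-- The reduced energy `E^red_n`. -/
def Ered (v₂ v₃ : ℝ → ℝ) (ρ : ℝ) (n : ℕ) (y : ℕ → ℂ) : ℝ :=
  ∑ i ∈ Finset.Icc 2 (n - 1), Ecell v₂ v₃ ρ (y (i - 1)) (y i) (y (i + 1))

/-- `(b0, b0, π ± ψ)` are the only minimizers of the cell energy. -/
def IsCellMinimizer (v₂ v₃ : ℝ → ℝ) (ρ b0 ψ : ℝ) : Prop :=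
  0 < b0 ∧ b0 < 1 ∧ 0 < ψ ∧ ψ < π / 8 ∧
  (∀ b₁ ∈ Set.Ioi (0 : ℝ), ∀ b₂ ∈ Set.Ioi (0 : ℝ), ∀ φ ∈ Set.Icc (0 : ℝ) (2 * π),
      EcellT v₂ v₃ ρ b0 b0 (π + ψ) ≤ EcellT v₂ v₃ ρ b₁ b₂ φ) ∧
  (∀ b₁ ∈ Set.Ioi (0 : ℝ), ∀ b₂ ∈ Set.Ioi (0 : ℝ), ∀ φ ∈ Set.Icc (0 : ℝ) (2 * π),
      EcellT v₂ v₃ ρ b₁ b₂ φ = EcellT v₂ v₃ ρ b0 b0 (π + ψ) →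
        b₁ = b0 ∧ b₂ = b0 ∧ (φ = π + ψ ∨ φ = π - ψ))

/-- The minimal cell energy `e_cell`. -/
def eCell (v₂ v₃ : ℝ → ℝ) (ρ b0 ψ : ℝ) : ℝ := EcellT v₂ v₃ ρ b0 b0 (π + ψ)

/-- `y` is a minimizer of `E^red_n` over `𝒜_n`. -/
def MinimizesEred (v₂ v₃ : ℝ → ℝ) (ρ : ℝ) (n : ℕ) (y : ℕ → ℂ) : Prop :=
  Admissible n y ∧ ∀ y' : ℕ → ℂ, Admissible n y' → Ered v₂ v₃ ρ n y ≤ Ered v₂ v₃ ρ n y'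

/-- Single-period configurations `𝒰^l`, with transition index `i₀`. -/
def memU (b0 ψ : ℝ) (l i₀ : ℕ) (y : ℕ → ℂ) : Prop :=
  2 ≤ i₀ ∧ i₀ + 1 ≤ l ∧
  (∀ i : ℕ, 1 ≤ i → i ≤ l → bnd y i = b0) ∧
  (∀ i : ℕ, 2 ≤ i → i ≤ i₀ → ang y i = π - ψ) ∧
  (∀ i : ℕ, i₀ + 1 ≤ i → i ≤ l → ang y i = π + ψ)

/-- `⌈2π/ψ̄⌉`. -/
def nceil (ψ : ℝ) : ℕ := ⌈2 * π / ψ⌉₊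

/-- The maximal atomic period `l_max = 2⌈2π/ψ̄⌉ − 4`. -/
def lmaxN (ψ : ℝ) : ℕ := 2 * nceil ψ - 4

/-- `l_mid = ⌊6/ψ̄⌋`. -/
def lmidN (ψ : ℝ) : ℕ := ⌊(6 : ℝ) / ψ⌋₊

/-- The end-to-end length `λ^l(i₀)` of a single-period configuration. -/
def lambdaFn (b0 ψ : ℝ) (l i₀ : ℕ) : ℝ :=
  ‖∑ k ∈ Finset.Icc 1 l, (b0 : ℂ) * Complex.exp (Complex.I *
      (((if k ≤ i₀ then -(((k : ℝ) - 1) * ψ) else ((k : ℝ) - 2 * (i₀ : ℝ) + 1) * ψ) : ℝ) : ℂ))‖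

/-- The domain of the function `λ^l`. -/
def lambdaDom (ψ : ℝ) (l : ℕ) : Finset ℕ :=
  (Finset.Icc 2 (l - 1)).filter fun i₀ => l + 3 ≤ i₀ + nceil ψ ∧ i₀ + 2 ≤ nceil ψ

/-- `λ^l_max`, the maximum of `λ^l` over its domain. -/
def lambdaMax (b0 ψ : ℝ) (l : ℕ) : ℝ :=
  sSup (lambdaFn b0 ψ l '' ↑(lambdaDom ψ l))

/-- `f` is affine on `s`. -/
def AffOn (f : ℝ → ℝ) (s : Set ℝ) : Prop := ∃ a b : ℝ, ∀ x ∈ s, f x = a * x + b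

/-- `Lam` is the normalized wavelength `Λ`. -/
def IsNormWavelength (b0 ψ : ℝ) (Lam : ℝ → ℝ) : Prop :=
  (∀ l : ℕ, 2 ≤ l → l ≤ lmidN ψ → Even l → Lam (l : ℝ) = lambdaMax b0 ψ l / (l : ℝ)) ∧
  (∀ l : ℕ, 4 ≤ l → l ≤ lmidN ψ → Even l → AffOn Lam (Set.Icc ((l : ℝ) - 2) (l : ℝ))) ∧
  AffOn Lam (Set.Icc ((lmidN ψ : ℝ) - 2) (lmaxN ψ : ℝ))

/-- `y ∈ 𝒰^l_δ`, with associated configuration `ybar ∈ 𝒰^l`. -/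
def AssocPerturb (b0 ψ δ : ℝ) (l : ℕ) (y ybar : ℕ → ℂ) : Prop :=
  Admissible (l + 1) y ∧ (∃ i₀ : ℕ, memU b0 ψ l i₀ ybar) ∧
  (∀ i : ℕ, 1 ≤ i → i ≤ l → |bnd y i - b0| ≤ δ) ∧
  (∀ i : ℕ, 2 ≤ i → i ≤ l → |ang y i - ang ybar i| ≤ δ)

/-- `𝒜^δ_n`. -/
def AdmissiblePerturbed (b0 ψ δ : ℝ) (n : ℕ) (y : ℕ → ℂ) : Prop :=
  Admissible n y ∧ (∀ i : ℕ, 1 ≤ i → i + 1 ≤ n → |bnd y i - b0| ≤ δ) ∧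
  (∀ i : ℕ, 2 ≤ i → i + 1 ≤ n → min |ang y i - (π + ψ)| |ang y i - (π - ψ)| ≤ δ)

/-- The property of the constant `c_mix` in the length estimate for odd atomic periods. -/
def MixConst (b0 ψ c : ℝ) : Prop :=
  ∀ l₁ l₂ : ℕ, Odd l₁ → Odd l₂ → 2 ≤ l₁ → l₁ ≤ lmaxN ψ → 2 ≤ l₂ → l₂ ≤ lmaxN ψ →
    ∀ y : ℕ → ℂ,
      (∃ i₀ : ℕ, memU b0 ψ (l₁ + 1) i₀ y) →
      (∃ i₀ : ℕ, memU b0 ψ (l₂ - 1) i₀ (fun i => y (i + l₁ + 1))) →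
      (∃ m : ℤ, ang y (l₁ + 2) - π = (2 * (m : ℝ) + 1) * ψ) →
      ‖y (l₁ + l₂ + 1) - y 1‖ ≤
        max (lambdaMax b0 ψ (l₁ + 1) + lambdaMax b0 ψ (l₂ - 1))
            (lambdaMax b0 ψ (l₁ - 1) + lambdaMax b0 ψ (l₂ + 1))
          - (if l₂ ≤ l₁ then c else 0)

/-- `𝓘_sgn`. -/
def Isgn (n : ℕ) (y : ℕ → ℂ) : Finset ℕ :=
  ((Finset.Icc 3 (n - 2)).filter fun i => π < ang y i ∧ ang y (i + 1) < π) ∪ {1}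

/-- `𝓘^l_sgn`. -/
def IsgnL (n : ℕ) (y : ℕ → ℂ) (l : ℕ) : Finset ℕ :=
  (Isgn n y).filter fun i =>
    (∀ k : ℕ, 1 ≤ k → k ≤ l - 1 → i + k ∉ Isgn n y) ∧ (i + l ∈ Isgn n y ∨ i + l = n)

/-- The maximal length of odd atomic periods `ℒ`. -/
def maxOddLength (ψ : ℝ) (Lam : ℝ → ℝ) (N S : ℕ) : ℝ :=
  sSup { x : ℝ | ∃ r : ℕ → ℕ,
    (∀ l : ℕ, r l ≠ 0 → Even l ∧ 2 ≤ l ∧ l ≤ lmaxN ψ) ∧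
    (∑ l ∈ Finset.Icc 2 (lmaxN ψ), r l) = N ∧
    (∑ l ∈ Finset.Icc 2 (lmaxN ψ), l * r l) = 2 * (S / 2) ∧
    x = ∑ l ∈ Finset.Icc 2 (lmaxN ψ), (r l : ℝ) * (l : ℝ) * Lam (l : ℝ) }

/-- The generalized cell energy. -/
def EgenCell (v₂ v₃ : ℝ → ℝ) (ρ ρ' : ℝ) (p q r s : ℂ) : ℝ :=
  (Ecell v₂ v₃ ρ p q r + Ecell v₂ v₃ ρ q r s) / 2 + ρ' * v₂ ‖s - p‖

/-- The configurational (general) energy `E_n`. -/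
def Egen (v₂ v₃ : ℝ → ℝ) (ρ ρ' : ℝ) (n : ℕ) (y : ℕ → ℂ) : ℝ :=
  Ered v₂ v₃ ρ n y + ρ' * ∑ i ∈ Finset.Icc 1 (n - 3), v₂ ‖y (i + 3) - y i‖

/-- The boundary condition `(y_n − y_1)·e₁ = (n−1)μ`. -/
def BC (n : ℕ) (μ : ℝ) (y : ℕ → ℂ) : Prop := (y n - y 1).re = ((n : ℝ) - 1) * μ

/-- The minimal energy `E^{n,μ}_min`. -/
def Emin (v₂ v₃ : ℝ → ℝ) (ρ ρ' μ : ℝ) (n : ℕ) : ℝ :=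
  sInf {E : ℝ | ∃ y : ℕ → ℂ, Admissible n y ∧ BC n μ y ∧ E = Egen v₂ v₃ ρ ρ' n y} /
    ((n : ℝ) - 2)

/-- `egen` is the common value `e^gen_cell`. -/
def IsEgenCellVal (v₂ v₃ : ℝ → ℝ) (ρ ρ' egen : ℝ) : Prop :=
  ∀ n : ℕ, ∀ y : ℕ → ℂ, MinimizesEred v₂ v₃ ρ n y →
    ∀ i : ℕ, 1 ≤ i → i + 3 ≤ n →
      Real.sign (ang y (i + 1) - π) = Real.sign (ang y (i + 2) - π) →
        EgenCell v₂ v₃ ρ ρ' (y i) (y (i + 1)) (y (i + 2)) (y (i + 3)) = egen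

/-- `eper` is the common value `e_per`. -/
def IsEperVal (v₂ v₃ : ℝ → ℝ) (ρ ρ' egen eper : ℝ) : Prop :=
  ∀ n : ℕ, ∀ y : ℕ → ℂ, MinimizesEred v₂ v₃ ρ n y →
    ∀ i : ℕ, 1 ≤ i → i + 3 ≤ n →
      Real.sign (ang y (i + 1) - π) ≠ Real.sign (ang y (i + 2) - π) →
        EgenCell v₂ v₃ ρ ρ' (y i) (y (i + 1)) (y (i + 2)) (y (i + 3)) = egen + ρ' * eper

/-- `f` is piecewise affine on `s`. -/
def PiecewiseAffOn (f : ℝ → ℝ) (s : Set ℝ) : Prop :=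
  ∃ P : Finset ℝ, ∀ a b : ℝ, a ∈ s → b ∈ s → a ≤ b → (∀ z ∈ P, z ∉ Set.Ioo a b) →
    AffOn f (Set.Icc a b ∩ s)

/-- The data `(e^gen_cell, e_range, c)` from the characterization of the minimal energy. -/
def EnergyChar (v₂ v₃ : ℝ → ℝ) (ρ ρ' m₁ m₂ egen : ℝ) (erange : ℝ → ℝ) (c : ℝ) : Prop :=
  0 < c ∧ StrictMonoOn erange (Set.Icc m₁ m₂) ∧ ConvexOn ℝ (Set.Icc m₁ m₂) erange ∧
  PiecewiseAffOn erange (Set.Icc m₁ m₂) ∧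
  ∀ μ ∈ Set.Icc m₁ m₂, ∀ n : ℕ, 3 ≤ n →
    |egen + ρ' * erange μ - Emin v₂ v₃ ρ ρ' μ n| ≤ c * (ρ' ^ 2 + 1 / (n : ℝ))

/-- The set of resonant lengths `M_res`. -/
def Mres (m₁ m₂ : ℝ) (erange : ℝ → ℝ) : Set ℝ :=
  {μ | μ ∈ Set.Icc m₁ m₂ ∧ ¬ DifferentiableWithinAt ℝ erange (Set.Icc m₁ m₂) μ}

/-- `𝒞(y)`, the set of atoms where the chain changes its curvature. -/
def Cset (n : ℕ) (y : ℕ → ℂ) : Finset ℕ :=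
  (Finset.Icc 2 (n - 2)).filter fun i => π < ang y i ∧ ang y (i + 1) < π

/-- `j` is the successor of `i` in `C`. -/
def SuccIn (C : Finset ℕ) (i j : ℕ) : Prop :=
  i ∈ C ∧ j ∈ C ∧ i < j ∧ ∀ k ∈ C, i < k → j ≤ k

/-- Almost minimizers of `E^{n,μ}_min`. -/
def AlmostMin (v₂ v₃ : ℝ → ℝ) (ρ ρ' μ c : ℝ) (n : ℕ) (y : ℕ → ℂ) : Prop :=
  Admissible n y ∧ BC n μ y ∧
    Egen v₂ v₃ ρ ρ' n y / ((n : ℝ) - 2) ≤ Emin v₂ v₃ ρ ρ' μ n + c * (ρ' ^ 2 + 1 / (n : ℝ))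

lemma v2_hasDeriv {v₂ v₃ : ℝ → ℝ} (h : PotentialPair v₂ v₃) :
    (∀ x, 0 < x → HasDerivAt v₂ (deriv v₂ x) x) ∧
    (∀ x, 0 < x → HasDerivAt (deriv v₂) (deriv (deriv v₂) x) x) ∧
    ContinuousOn (deriv (deriv v₂)) (Set.Ioi 0) := by
  have h1 : ContDiffOn ℝ (⊤ : ℕ∞) (deriv v₂) (Set.Ioi 0) :=
    h.v₂_smooth.deriv_of_isOpen isOpen_Ioi (by norm_num)
  have h2 : ContDiffOn ℝ (⊤ : ℕ∞) (deriv (deriv v₂)) (Set.Ioi 0) :=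
    h1.deriv_of_isOpen isOpen_Ioi (by norm_num)
  refine ⟨fun x hx => ?_, fun x hx => ?_, h2.continuousOn⟩
  · exact ((h.v₂_smooth.contDiffAt (Ioi_mem_nhds hx)).differentiableAt (by norm_num)).hasDerivAt
  · exact ((h1.contDiffAt (Ioi_mem_nhds hx)).differentiableAt (by norm_num)).hasDerivAt

lemma midpoint_of_convexOn {f : ℝ → ℝ} {s : Set ℝ} {κ : ℝ}
    (h : ConvexOn ℝ s (fun x => f x - κ * x ^ 2)) {x y : ℝ} (hx : x ∈ s) (hy : y ∈ s) :
    f ((x + y) / 2) ≤ (f x + f y) / 2 - κ / 4 * (x - y) ^ 2 := by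
  have := h.2 hx hy (show (0 : ℝ) ≤ 1 / 2 by norm_num) (show (0 : ℝ) ≤ 1 / 2 by norm_num)
    (by norm_num)
  simp only [smul_eq_mul] at this
  have e : (1 / 2 * x + 1 / 2 * y : ℝ) = (x + y) / 2 := by ring
  rw [e] at this
  nlinarith

lemma v2_midconv {v₂ v₃ : ℝ → ℝ} (h : PotentialPair v₂ v₃) :
    ∃ δ > 0, ∃ κ > 0, ∀ x ∈ Set.Icc (1 - δ) (1 + δ), ∀ y ∈ Set.Icc (1 - δ) (1 + δ),
      v₂ ((x + y) / 2) ≤ (v₂ x + v₂ y) / 2 - κ * (x - y) ^ 2 := by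
  obtain ⟨h1, h2, h3⟩ := v2_hasDeriv h
  have hc := h.v₂_conv
  rw [show (2 : ℕ) = 1 + 1 from rfl, iteratedDeriv_succ, iteratedDeriv_one] at hc
  set D := deriv (deriv v₂) 1 with hD
  have hcont : ContinuousAt (deriv (deriv v₂)) 1 :=
    h3.continuousAt (Ioi_mem_nhds (by norm_num))
  have hev : ∀ᶠ x in nhds (1 : ℝ), D / 2 < deriv (deriv v₂) x :=
    hcont.eventually (lt_mem_nhds (by linarith))
  obtain ⟨ε, hε, hb⟩ := Metric.eventually_nhds_iff.1 hev
  refine ⟨min (ε / 2) (1 / 2), by positivity, D / 4 / 4, by positivity, ?_⟩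
  set δ := min (ε / 2) (1 / 2)
  have hδ1 : δ ≤ ε / 2 := min_le_left _ _
  have hδ2 : δ ≤ 1 / 2 := min_le_right _ _
  have key : ConvexOn ℝ (Set.Icc (1 - δ) (1 + δ)) (fun x => v₂ x - D / 4 * x ^ 2) := by
    have d1 : ∀ x, 0 < x → HasDerivAt (fun x => v₂ x - D / 4 * x ^ 2)
        (deriv v₂ x - D / 2 * x) x := by
      intro x hx
      have := (h1 x hx).fun_sub (((hasDerivAt_id' x).fun_pow 2).const_mul (D / 4))
      refine this.congr_deriv ?_
      push_cast; ring
    apply MonotoneOn.convexOn_of_deriv (convex_Icc _ _)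
    · intro x hx
      exact (d1 x (by linarith [hx.1])).continuousAt.continuousWithinAt
    · intro x hx
      rw [interior_Icc] at hx
      exact (d1 x (by linarith [hx.1])).differentiableAt.differentiableWithinAt
    · rw [interior_Icc]
      have e : Set.EqOn (fun x => deriv v₂ x - D / 2 * x)
          (deriv (fun x => v₂ x - D / 4 * x ^ 2)) (Set.Ioo (1 - δ) (1 + δ)) := by
        intro x hx
        exact (d1 x (by linarith [hx.1])).deriv.symm
      refine MonotoneOn.congr ?_ e
      have d2 : ∀ x, 0 < x → HasDerivAt (fun x => deriv v₂ x - D / 2 * x)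
        (deriv (deriv v₂) x - D / 2) x := by
        intro x hx
        have := (h2 x hx).fun_sub ((hasDerivAt_id' x).const_mul (D / 2))
        refine this.congr_deriv ?_
        ring
      apply monotoneOn_of_deriv_nonneg (convex_Ioo _ _)
      · intro x hx
        exact (d2 x (by linarith [hx.1])).continuousAt.continuousWithinAt
      · intro x hx
        rw [interior_Ioo] at hx
        exact (d2 x (by linarith [hx.1])).differentiableAt.differentiableWithinAt
      · intro x hx
        rw [interior_Ioo] at hx
        rw [(d2 x (by linarith [hx.1])).deriv]
        have : D / 2 < deriv (deriv v₂) x := by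
          apply hb
          rw [Real.dist_eq, abs_lt]
          constructor <;> linarith [hx.1, hx.2]
        linarith
  intro x hx y hy
  exact midpoint_of_convexOn key hx hy

/-- The second-neighbour interaction as a function of bonds and cosine. -/
def Gfun (v₂ : ℝ → ℝ) (p : ℝ × ℝ × ℝ) : ℝ :=
  v₂ (Real.sqrt (p.1 ^ 2 + p.2.1 ^ 2 + 2 * p.1 * p.2.1 * p.2.2))

lemma G_semiconv {v₂ v₃ : ℝ → ℝ} (h : PotentialPair v₂ v₃) :
    ∃ δ > 0, ∃ K > 0, ∀ p q : ℝ × ℝ × ℝ, ‖p - (1, 1, 1)‖ < δ → ‖q - (1, 1, 1)‖ < δ →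
      Gfun v₂ ((1 / 2 : ℝ) • (p + q)) ≤ (Gfun v₂ p + Gfun v₂ q) / 2 + K * ‖p - q‖ ^ 2 := by
  have hG : ContDiffAt ℝ (⊤ : ℕ∞) (Gfun v₂) (1, 1, 1) := by
    unfold Gfun
    apply ContDiffAt.comp (1, 1, 1) (g := v₂)
    · refine h.v₂_smooth.contDiffAt (Ioi_mem_nhds ?_)
      apply Real.sqrt_pos.2; norm_num
    · apply ContDiffAt.sqrt
      · fun_prop
      · norm_num
  have hG2 : ContDiffAt ℝ 2 (Gfun v₂) (1, 1, 1) :=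
    hG.of_le (WithTop.coe_le_coe.2 (le_top : (2 : ℕ∞) ≤ ⊤))
  obtain ⟨K, t, ht, hL⟩ := ContDiffAt.exists_lipschitzOnWith
    (hG2.fderiv_right (m := 1) (by norm_num))
  have hev : ∀ᶠ p in nhds ((1, 1, 1) : ℝ × ℝ × ℝ), DifferentiableAt ℝ (Gfun v₂) p := by
    have : ContDiffAt ℝ 1 (Gfun v₂) (1, 1, 1) := hG.of_le (by norm_cast; exact le_top)
    filter_upwards [this.eventually (by norm_num)] with p hp
    exact hp.differentiableAt (by norm_num)
  obtain ⟨δ, hδ, hb⟩ := Metric.eventually_nhds_iff_ball.1 (hev.and ht)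
  refine ⟨δ, hδ, (K + 1) , by positivity, ?_⟩
  intro p q hp hq
  set c : ℝ × ℝ × ℝ := (1, 1, 1) with hc
  set m := (1 / 2 : ℝ) • (p + q) with hm
  have hpB : p ∈ Metric.ball c δ := by rwa [mem_ball_iff_norm]
  have hqB : q ∈ Metric.ball c δ := by rwa [mem_ball_iff_norm]
  have hmB : m ∈ Metric.ball c δ := by
    have := (convex_ball c δ) hpB hqB (a := 1 / 2) (b := 1 / 2) (by norm_num) (by norm_num)
      (by norm_num)
    rwa [hm, smul_add]
  have key : ∀ r ∈ Metric.ball c δ, ‖Gfun v₂ r - Gfun v₂ m - fderiv ℝ (Gfun v₂) m (r - m)‖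
      ≤ (K * ‖r - m‖) * ‖r - m‖ := by
    intro r hr
    have hseg : segment ℝ m r ⊆ Metric.ball c δ := (convex_ball c δ).segment_subset hmB hr
    refine Convex.norm_image_sub_le_of_norm_fderiv_le' (𝕜 := ℝ) (s := segment ℝ m r) ?_ ?_
      (convex_segment m r) (left_mem_segment _ _ _) (right_mem_segment _ _ _)
    · intro x hx; exact (hb x (hseg hx)).1
    · intro x hx
      have h1 := hL.norm_sub_le (hb x (hseg hx)).2 (hb m hmB).2
      refine h1.trans ?_
      gcongr
      have h2 := segment_subset_closedBall_left m r hx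
      rw [mem_closedBall_iff_norm] at h2
      rwa [norm_sub_rev r m]
  have k1 := key p hpB
  have k2 := key q hqB
  have e1 : p - m = (1 / 2 : ℝ) • (p - q) := by rw [hm]; module
  have e2 : q - m = -((1 / 2 : ℝ) • (p - q)) := by rw [hm]; module
  rw [e1] at k1
  rw [e2, map_neg, norm_neg] at k2
  rw [norm_smul] at k1 k2
  rw [Real.norm_eq_abs, abs_le] at k1 k2
  have h5 : ‖(1 / 2 : ℝ)‖ = 1 / 2 := by norm_num
  rw [h5] at k1 k2
  nlinarith [k1.1, k2.1, sq_nonneg ‖p - q‖, K.2]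

/-- The three-body potential as a function of the cosine of the turn. -/
def Wfun (v₃ : ℝ → ℝ) (z : ℝ) : ℝ := v₃ (π + Real.arccos z)

lemma v3_derivs {v₂ v₃ : ℝ → ℝ} (h : PotentialPair v₂ v₃) :
    ∃ g1 g2 g3 : ℝ → ℝ, ∃ D > 0,
      (∀ x ∈ Set.Ioo (0 : ℝ) (2 * π), HasDerivAt v₃ (g1 x) x) ∧
      (∀ x ∈ Set.Ioo (0 : ℝ) (2 * π), HasDerivAt g1 (g2 x) x) ∧
      (∀ x ∈ Set.Ioo (0 : ℝ) (2 * π), HasDerivAt g2 (g3 x) x) ∧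
      HasDerivAt g3 D π ∧ g1 π = 0 ∧ g2 π = 0 ∧ g3 π = 0 := by
  have h0 : ContDiffOn ℝ (⊤ : ℕ∞) v₃ (Set.Ioo 0 (2 * π)) :=
    h.v₃_smooth.mono Set.Ioo_subset_Icc_self
  have h1 : ContDiffOn ℝ (⊤ : ℕ∞) (deriv v₃) (Set.Ioo 0 (2 * π)) :=
    h0.deriv_of_isOpen isOpen_Ioo (by norm_num)
  have h2 : ContDiffOn ℝ (⊤ : ℕ∞) (deriv (deriv v₃)) (Set.Ioo 0 (2 * π)) :=
    h1.deriv_of_isOpen isOpen_Ioo (by norm_num)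
  have h3 : ContDiffOn ℝ (⊤ : ℕ∞) (deriv (deriv (deriv v₃))) (Set.Ioo 0 (2 * π)) :=
    h2.deriv_of_isOpen isOpen_Ioo (by norm_num)
  have aux : ∀ f : ℝ → ℝ, ContDiffOn ℝ (⊤ : ℕ∞) f (Set.Ioo 0 (2 * π)) →
      ∀ x ∈ Set.Ioo (0 : ℝ) (2 * π), HasDerivAt f (deriv f x) x := fun f hf x hx =>
    ((hf.contDiffAt (Ioo_mem_nhds hx.1 hx.2)).differentiableAt (by norm_num)).hasDerivAt
  have hpi : π ∈ Set.Ioo (0 : ℝ) (2 * π) := ⟨pi_pos, by linarith [pi_pos]⟩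
  have i1 := h.v₃_d1
  have i2 := h.v₃_d2
  have i3 := h.v₃_d3
  have i4 := h.v₃_d4
  simp only [iteratedDeriv_succ, iteratedDeriv_zero, show (2 : ℕ) = 0 + 1 + 1 from rfl,
    show (3 : ℕ) = 0 + 1 + 1 + 1 from rfl, show (4 : ℕ) = 0 + 1 + 1 + 1 + 1 from rfl] at i2 i3 i4
  exact ⟨_, _, _, _, i4, aux _ h0, aux _ h1, aux _ h2, aux _ h3 π hpi, i1, i2, i3⟩

/-- A function vanishing at `a` with derivative bounded below by that of `k` dominates. -/
lemma ge_of_deriv_ge {f f' k k' : ℝ → ℝ} {a b : ℝ}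
    (hf : ∀ x ∈ Set.Icc a b, HasDerivAt f (f' x) x) (hk : ∀ x ∈ Set.Icc a b, HasDerivAt k (k' x) x)
    (hle : ∀ x ∈ Set.Ioo a b, k' x ≤ f' x) (h0 : k a ≤ f a) : ∀ x ∈ Set.Icc a b, k x ≤ f x := by
  intro x hx
  have hmono : MonotoneOn (fun x => f x - k x) (Set.Icc a b) := by
    have d : ∀ x ∈ Set.Icc a b, HasDerivAt (fun x => f x - k x) (f' x - k' x) x :=
      fun x hx => (hf x hx).fun_sub (hk x hx)
    apply monotoneOn_of_deriv_nonneg (convex_Icc _ _)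
    · exact fun x hx => (d x hx).continuousAt.continuousWithinAt
    · exact fun x hx => (d x (interior_subset hx)).differentiableAt.differentiableWithinAt
    · intro x hx
      rw [(d x (interior_subset hx)).deriv]
      rw [interior_Icc] at hx
      linarith [hle x hx]
  have := hmono ⟨le_refl a, hx.1.trans hx.2⟩ hx hx.1
  simp only at this
  linarith

lemma P_mono {v₂ v₃ : ℝ → ℝ} (h : PotentialPair v₂ v₃) :
    ∃ g1 : ℝ → ℝ, (∀ x ∈ Set.Ioo (0 : ℝ) (2 * π), HasDerivAt v₃ (g1 x) x) ∧
    ∃ T > 0, T ≤ 1 ∧ ∃ κ > 0,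
      MonotoneOn (fun t => g1 (π + t) / sin t + 2 * κ * cos t) (Set.Ioo 0 T) := by
  obtain ⟨g1, g2, g3, D, hD, d1, d2, d3, d4, z1, z2, z3⟩ := v3_derivs h
  refine ⟨g1, d1, ?_⟩
  have hpi3 := pi_gt_three
  -- lower bound for g3
  have hev : ∀ᶠ x in nhdsWithin π (Set.Ioi π), D / 2 < slope g3 π x := by
    have := (hasDerivAt_iff_tendsto_slope.1 d4)
    have h2 := this.mono_left (nhdsWithin_mono π (s := Set.Ioi π)
      (fun x hx => ne_of_gt hx))
    exact h2.eventually (lt_mem_nhds (by linarith))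
  obtain ⟨u, hu, hsub⟩ := mem_nhdsGT_iff_exists_Ioo_subset.1 hev
  set T := min ((u - π) / 2) 1 with hT
  have hTpos : 0 < T := by
    have : π < u := hu
    apply lt_min <;> linarith
  have hT1 : T ≤ 1 := min_le_right _ _
  have hTu : T ≤ (u - π) / 2 := min_le_left _ _
  have b3 : ∀ t ∈ Set.Icc 0 T, D / 2 * t ≤ g3 (π + t) := by
    intro t ht
    rcases eq_or_lt_of_le ht.1 with h0 | h0
    · rw [← h0]; simp [z3]
    · have hu' : π < u := hu
      have : D / 2 < slope g3 π (π + t) := hsub ⟨by linarith, by linarith [ht.2]⟩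
      rw [slope_def_field, z3, sub_zero, add_sub_cancel_left, lt_div_iff₀ h0] at this
      exact this.le
  have hmem : ∀ t ∈ Set.Icc 0 T, π + t ∈ Set.Ioo 0 (2 * π) := fun t ht =>
    ⟨by linarith [ht.1], by linarith [ht.2]⟩
  have sh : ∀ f f' : ℝ → ℝ, (∀ x ∈ Set.Ioo (0 : ℝ) (2 * π), HasDerivAt f (f' x) x) →
      ∀ t ∈ Set.Icc 0 T, HasDerivAt (fun t => f (π + t)) (f' (π + t)) t := by
    intro f f' hf t ht
    exact (hf _ (hmem t ht)).comp_const_add π t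
  have b2 : ∀ t ∈ Set.Icc 0 T, 0 ≤ g2 (π + t) := by
    apply ge_of_deriv_ge (k := fun _ => 0) (k' := fun _ => 0) (sh g2 g3 d3)
      (fun x _ => hasDerivAt_const _ _)
    · intro t ht
      refine le_trans ?_ (b3 t ⟨ht.1.le, ht.2.le⟩)
      have := ht.1; positivity
    · simp [z2]
  have b1 : ∀ t ∈ Set.Icc 0 T, 0 ≤ g1 (π + t) := by
    apply ge_of_deriv_ge (k := fun _ => 0) (k' := fun _ => 0) (sh g1 g2 d2)
      (fun x _ => hasDerivAt_const _ _)
    · intro t ht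
      exact (b2 t ⟨ht.1.le, ht.2.le⟩)
    · simp [z1]
  have sinb : ∀ t ∈ Set.Icc 0 T, t / 2 ≤ sin t := by
    intro t ht
    have := Real.mul_le_sin ht.1 (by linarith [ht.2])
    refine le_trans ?_ this
    rw [div_eq_inv_mul]
    apply mul_le_mul_of_nonneg_right _ ht.1
    rw [le_div_iff₀ pi_pos]
    linarith [pi_le_four]
  have bN : ∀ t ∈ Set.Icc 0 T, D / 12 * t ^ 3 ≤ g2 (π + t) * sin t - g1 (π + t) * cos t := by
    apply ge_of_deriv_ge (k := fun t => D / 12 * t ^ 3) (k' := fun t => D / 4 * t ^ 2)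
      (f' := fun t => g3 (π + t) * sin t + g1 (π + t) * sin t)
    · intro t ht
      have := ((sh g2 g3 d3 t ht).fun_mul (hasDerivAt_sin t)).fun_sub
        ((sh g1 g2 d2 t ht).fun_mul (hasDerivAt_cos t))
      refine this.congr_deriv ?_
      ring
    · intro t ht
      have := ((hasDerivAt_id' t).fun_pow 3).const_mul (D / 12)
      refine this.congr_deriv ?_
      push_cast; ring
    · intro t ht
      have ht' : t ∈ Set.Icc 0 T := ⟨ht.1.le, ht.2.le⟩
      have s1 := sinb t ht'
      have s2 := b1 t ht'
      have s3 := b3 t ht'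
      have s4 : 0 ≤ sin t := by linarith [ht.1]
      have s5 : D / 2 * t * (t / 2) ≤ g3 (π + t) * sin t :=
        mul_le_mul s3 s1 (by linarith [ht.1]) (le_trans (by have := ht.1; positivity) s3)
      have := mul_nonneg s2 s4
      nlinarith
    · simp [z1]
  refine ⟨T, hTpos, hT1, D / 24, by positivity, ?_⟩
  have dP : ∀ t ∈ Set.Ioo 0 T, HasDerivAt (fun t => g1 (π + t) / sin t + 2 * (D / 24) * cos t)
      ((g2 (π + t) * sin t - g1 (π + t) * cos t) / sin t ^ 2 - D / 12 * sin t) t := by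
    intro t ht
    have ht' : t ∈ Set.Icc 0 T := ⟨ht.1.le, ht.2.le⟩
    have s4 : 0 < sin t := by linarith [ht.1, sinb t ht']
    have := ((sh g1 g2 d2 t ht').fun_div (hasDerivAt_sin t) s4.ne').fun_add
      ((hasDerivAt_cos t).const_mul (2 * (D / 24)))
    refine this.congr_deriv ?_
    ring
  apply monotoneOn_of_deriv_nonneg (convex_Ioo _ _)
  · exact fun x hx => (dP x hx).continuousAt.continuousWithinAt
  · exact fun x hx => (dP x (interior_subset hx)).differentiableAt.differentiableWithinAt
  · intro t ht
    rw [(dP t (interior_subset ht)).deriv]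
    rw [interior_Ioo] at ht
    have ht' : t ∈ Set.Icc 0 T := ⟨ht.1.le, ht.2.le⟩
    have s4 : 0 < sin t := by linarith [ht.1, sinb t ht']
    have s5 : sin t ≤ t := sin_le ht.1.le
    rw [sub_nonneg, le_div_iff₀ (by positivity)]
    refine le_trans ?_ (bN t ht')
    have : sin t ^ 3 ≤ t ^ 3 := by gcongr
    nlinarith

lemma W_cont {v₂ v₃ : ℝ → ℝ} (h : PotentialPair v₂ v₃) : Continuous (Wfun v₃) := by
  have : ContinuousOn v₃ (Set.Icc 0 (2 * π)) := h.v₃_smooth.continuousOn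
  unfold Wfun
  apply this.comp_continuous (by fun_prop)
  intro z
  constructor <;> linarith [arccos_nonneg z, arccos_le_pi z, pi_pos]

lemma W_midconv {v₂ v₃ : ℝ → ℝ} (h : PotentialPair v₂ v₃) :
    ∃ δ > 0, ∃ κ > 0, ∀ x ∈ Set.Icc (1 - δ) 1, ∀ y ∈ Set.Icc (1 - δ) 1,
      Wfun v₃ ((x + y) / 2) ≤ (Wfun v₃ x + Wfun v₃ y) / 2 - κ * (x - y) ^ 2 := by
  obtain ⟨g1, d1, T, hT, hT1, κ, hκ, hm⟩ := P_mono h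
  have hpi3 := pi_gt_three
  refine ⟨1 - cos T, ?_, κ / 4, by positivity, ?_⟩
  · have := Real.cos_lt_cos_of_nonneg_of_le_pi (le_refl 0) (by linarith) hT
    rw [cos_zero] at this; linarith
  rw [sub_sub_cancel]
  have hcT : 0 < cos T := cos_pos_of_mem_Ioo ⟨by linarith, by linarith⟩
  have harc : ∀ z ∈ Set.Ioo (cos T) 1, arccos z ∈ Set.Ioo 0 T := by
    intro z hz
    constructor
    · exact arccos_pos.2 hz.2
    · have := (arccos_lt_arccos (by linarith) hz.1 hz.2.le)
      rwa [arccos_cos hT.le (by linarith)] at this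
  have dW : ∀ z ∈ Set.Ioo (cos T) 1, HasDerivAt (fun z => Wfun v₃ z - κ * z ^ 2)
      (-(g1 (π + arccos z) / sin (arccos z) + 2 * κ * cos (arccos z))) z := by
    intro z hz
    have ha := harc z hz
    have e1 := (d1 (π + arccos z) ⟨by linarith [ha.1], by linarith [ha.2]⟩)
    have e2 := (hasDerivAt_arccos (x := z) (by linarith [hz.1]) hz.2.ne).const_add π
    have e3 := (e1.comp z e2).fun_sub (((hasDerivAt_id' z).fun_pow 2).const_mul κ)
    refine e3.congr_deriv ?_
    rw [sin_arccos, cos_arccos (by linarith [hz.1]) hz.2.le]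
    push_cast; ring
  have key : ConvexOn ℝ (Set.Icc (cos T) 1) (fun z => Wfun v₃ z - κ * z ^ 2) := by
    apply MonotoneOn.convexOn_of_deriv (convex_Icc _ _)
    · exact ((W_cont h).sub (by fun_prop)).continuousOn
    · rw [interior_Icc]
      exact fun z hz => (dW z hz).differentiableAt.differentiableWithinAt
    · rw [interior_Icc]
      intro z hz z' hz' hzz
      rw [(dW z hz).deriv, (dW z' hz').deriv, neg_le_neg_iff]
      exact hm (harc z' hz') (harc z hz) (antitone_arccos hzz)
  intro x hx y hy
  exact midpoint_of_convexOn key hx hy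

/-- Cell energy in terms of bond lengths and cosine of the turn. -/
def Ff (v₂ v₃ : ℝ → ℝ) (ρ b₁ b₂ z : ℝ) : ℝ :=
  v₂ b₁ + v₂ b₂ + Wfun v₃ z + ρ * Gfun v₂ (b₁, b₂, z)

lemma Ff_symm (v₂ v₃ : ℝ → ℝ) (ρ b₁ b₂ z : ℝ) : Ff v₂ v₃ ρ b₁ b₂ z = Ff v₂ v₃ ρ b₂ b₁ z := by
  unfold Ff Gfun
  simp only
  rw [show b₁ ^ 2 + b₂ ^ 2 + 2 * b₁ * b₂ * z = b₂ ^ 2 + b₁ ^ 2 + 2 * b₂ * b₁ * z by ring]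
  ring

lemma v2_contOn {v₂ v₃ : ℝ → ℝ} (h : PotentialPair v₂ v₃) : ContinuousOn v₂ (Set.Ioi 0) :=
  h.v₂_smooth.continuousOn

lemma v2_gap {v₂ v₃ : ℝ → ℝ} (h : PotentialPair v₂ v₃) {δ : ℝ} (hδ : 0 < δ) (hδ1 : δ ≤ 1 / 8) :
    ∃ g > 0, ∀ b, 1 / 4 ≤ b → b ≤ 3 / 2 → δ ≤ |b - 1| → -1 + g ≤ v₂ b := by
  have hK : IsCompact (Set.Icc (1 / 4 : ℝ) (3 / 2) ∩ {b | δ ≤ |b - 1|}) :=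
    isCompact_Icc.inter_right (isClosed_le continuous_const (by fun_prop))
  obtain ⟨b, hb, hmin⟩ := hK.exists_isMinOn (f := v₂)
    ⟨3 / 2, ⟨by norm_num, by norm_num⟩, by
      simp only [Set.mem_setOf_eq]; rw [abs_of_pos (by norm_num)]; linarith⟩
    ((v2_contOn h).mono (fun x hx => by
      simp only [Set.mem_Ioi]; linarith [hx.1.1]))
  refine ⟨v₂ b + 1, ?_, ?_⟩
  · have h1 := h.v₂_min_unique b (by simp only [Set.mem_Ioi]; linarith [hb.1.1]) (by
      rintro rfl
      have := hb.2
      simp only [Set.mem_setOf_eq, sub_self, abs_zero] at this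
      linarith)
    rw [h.v₂_min] at h1; linarith
  · intro x h1 h2 h3
    have := hmin (show x ∈ _ from ⟨⟨h1, h2⟩, h3⟩)
    simp only [Set.mem_setOf_eq] at this
    linarith

lemma W_gap {v₂ v₃ : ℝ → ℝ} (h : PotentialPair v₂ v₃) {δ : ℝ} (hδ : 0 < δ) (hδ1 : δ ≤ 1 / 8) :
    ∃ g > 0, ∀ z, -1 ≤ z → z ≤ 1 - δ → g ≤ Wfun v₃ z := by
  obtain ⟨z, hz, hmin⟩ := (isCompact_Icc (a := (-1 : ℝ)) (b := 1 - δ)).exists_isMinOn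
    (f := Wfun v₃) ⟨-1, ⟨le_refl _, by linarith⟩⟩ (W_cont h).continuousOn
  refine ⟨Wfun v₃ z, ?_, fun x h1 h2 => hmin ⟨h1, h2⟩⟩
  have : 0 < arccos z := arccos_pos.2 (by linarith [hz.2])
  exact h.v₃_min_unique _ ⟨by linarith [pi_pos], by linarith [arccos_le_pi z]⟩ (by linarith)

lemma W_nonneg {v₂ v₃ : ℝ → ℝ} (h : PotentialPair v₂ v₃) (z : ℝ) : 0 ≤ Wfun v₃ z :=
  h.v₃_nonneg _ ⟨by linarith [pi_pos, arccos_nonneg z], by linarith [arccos_le_pi z]⟩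

lemma norm_triple_sq_le (a b c : ℝ) : ‖((a, b, c) : ℝ × ℝ × ℝ)‖ ^ 2 ≤ a ^ 2 + b ^ 2 + c ^ 2 := by
  rw [Prod.norm_mk, Prod.norm_mk, Real.norm_eq_abs, Real.norm_eq_abs, Real.norm_eq_abs]
  rcases max_cases |a| (max |b| |c|) with h | h <;> rw [h.1]
  · rw [sq_abs]; nlinarith [sq_nonneg b, sq_nonneg c]
  · rcases max_cases |b| |c| with h | h <;> rw [h.1, sq_abs] <;>
      nlinarith [sq_nonneg a, sq_nonneg b, sq_nonneg c]

lemma norm_triple_lt {a b c r : ℝ} (ha : |a| < r) (hb : |b| < r) (hc : |c| < r) :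
    ‖((a, b, c) : ℝ × ℝ × ℝ)‖ < r := by
  rw [Prod.norm_mk, Prod.norm_mk, Real.norm_eq_abs, Real.norm_eq_abs, Real.norm_eq_abs]
  exact max_lt ha (max_lt hb hc)

set_option maxHeartbeats 2000000 in
lemma cell_lemma {v₂ v₃ : ℝ → ℝ} (h : PotentialPair v₂ v₃) {ε : ℝ} (hε : 0 < ε) :
    ∃ ρ₀ > 0, ∀ ρ, 0 < ρ → ρ ≤ ρ₀ → ∃ b0 c κ : ℝ, 0 < κ ∧ |b0 - 1| ≤ ε ∧ 1 - ε ≤ c ∧ c ≤ 1 ∧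
      ∀ b₁ b₂ z, 0 < b₁ → b₁ ≤ 3 / 2 → 0 < b₂ → b₂ ≤ 3 / 2 → -1 ≤ z → z ≤ 1 →
        3 / 2 < Real.sqrt (b₁ ^ 2 + b₂ ^ 2 + 2 * b₁ * b₂ * z) →
        Ff v₂ v₃ ρ b0 b0 c + κ * ((b₁ - b0) ^ 2 + (b₂ - b0) ^ 2 + (z - c) ^ 2)
          ≤ Ff v₂ v₃ ρ b₁ b₂ z := by
  obtain ⟨δ1, hδ1, κ1, hκ1, hv⟩ := v2_midconv h
  obtain ⟨δ2, hδ2, κ2, hκ2, hW⟩ := W_midconv h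
  obtain ⟨δ3, hδ3, K, hK, hG⟩ := G_semiconv h
  obtain ⟨δ, hδ, e1, e2, e3, e4, e5⟩ : ∃ δ > 0, δ ≤ δ1 ∧ δ ≤ δ2 ∧ δ < δ3 ∧ δ ≤ ε ∧ δ ≤ 1 / 8 := by
    refine ⟨min (min δ1 δ2) (min (δ3 / 2) (min ε (1 / 8))), by positivity, ?_, ?_, ?_, ?_, ?_⟩
    · exact (min_le_left _ _).trans (min_le_left _ _)
    · exact (min_le_left _ _).trans (min_le_right _ _)
    · have : min (min δ1 δ2) (min (δ3 / 2) (min ε (1 / 8))) ≤ δ3 / 2 :=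
        (min_le_right _ _).trans (min_le_left _ _)
      linarith
    · exact (min_le_right _ _).trans ((min_le_right _ _).trans (min_le_left _ _))
    · exact (min_le_right _ _).trans ((min_le_right _ _).trans (min_le_right _ _))
  obtain ⟨g1, hg1, hgv⟩ := v2_gap h hδ e5
  obtain ⟨g2, hg2, hgW⟩ := W_gap h hδ e5
  set g := min g1 g2 with hg
  have hgpos : 0 < g := lt_min hg1 hg2
  have hgg1 : g ≤ g1 := min_le_left _ _
  have hgg2 : g ≤ g2 := min_le_right _ _
  set κ0 := min κ1 κ2 with hκ0
  have hκ0pos : 0 < κ0 := lt_min hκ1 hκ2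
  have hκκ1 : κ0 ≤ κ1 := min_le_left _ _
  have hκκ2 : κ0 ≤ κ2 := min_le_right _ _
  refine ⟨min (κ0 / (2 * K)) (g / (2 * (1 + |v₂ 2|))), by positivity, ?_⟩
  intro ρ hρ hρ0
  have hρ1 : ρ * (2 * K) ≤ κ0 := by
    rw [← le_div_iff₀ (by positivity)]; exact hρ0.trans (min_le_left _ _)
  have hρ2 : ρ * (2 * (1 + |v₂ 2|)) ≤ g := by
    rw [← le_div_iff₀ (by positivity)]; exact hρ0.trans (min_le_right _ _)
  set S : Set (ℝ × ℝ × ℝ) :=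
    Set.Icc (1 - δ) (1 + δ) ×ˢ (Set.Icc (1 - δ) (1 + δ) ×ˢ Set.Icc (1 - δ) 1) with hS
  have hScomp : IsCompact S := isCompact_Icc.prod (isCompact_Icc.prod isCompact_Icc)
  have h1S : ((1, 1, 1) : ℝ × ℝ × ℝ) ∈ S := by
    refine ⟨⟨?_, ?_⟩, ⟨?_, ?_⟩, ⟨?_, ?_⟩⟩ <;> simp <;> linarith
  have hcont : ContinuousOn (fun p : ℝ × ℝ × ℝ => Ff v₂ v₃ ρ p.1 p.2.1 p.2.2) S := by
    have hv2 := v2_contOn h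
    have c1 : ContinuousOn (fun p : ℝ × ℝ × ℝ => v₂ p.1) S :=
      hv2.comp (by fun_prop) (fun p hp => by simp only [Set.mem_Ioi]; linarith [hp.1.1])
    have c2 : ContinuousOn (fun p : ℝ × ℝ × ℝ => v₂ p.2.1) S :=
      hv2.comp (by fun_prop) (fun p hp => by simp only [Set.mem_Ioi]; linarith [hp.2.1.1])
    have c3 : ContinuousOn (fun p : ℝ × ℝ × ℝ => Wfun v₃ p.2.2) S :=
      ((W_cont h).comp (by fun_prop)).continuousOn
    have c4 : ContinuousOn (fun p : ℝ × ℝ × ℝ => Gfun v₂ (p.1, p.2.1, p.2.2)) S := by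
      unfold Gfun
      refine hv2.comp (by fun_prop) (fun p hp => ?_)
      simp only [Set.mem_Ioi]
      apply Real.sqrt_pos.2
      have a1 : 0 < p.1 := by linarith [hp.1.1]
      have a2 : 0 < p.2.1 := by linarith [hp.2.1.1]
      have a3 : 0 < p.2.2 := by linarith [hp.2.2.1]
      positivity
    unfold Ff
    exact ((c1.add c2).add c3).add (c4.const_mul ρ)
  obtain ⟨p0, hp0, hmin⟩ := hScomp.exists_isMinOn ⟨_, h1S⟩ hcont
  have growth : ∀ p ∈ S, Ff v₂ v₃ ρ p0.1 p0.2.1 p0.2.2 + κ0 *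
      ((p.1 - p0.1) ^ 2 + (p.2.1 - p0.2.1) ^ 2 + (p.2.2 - p0.2.2) ^ 2)
        ≤ Ff v₂ v₃ ρ p.1 p.2.1 p.2.2 := by
    rintro ⟨x1, x2, x3⟩ hp
    obtain ⟨y1, y2, y3⟩ := p0
    obtain ⟨q1, q2, q3⟩ := hp
    obtain ⟨r1, r2, r3⟩ := hp0
    simp only at q1 q2 q3 r1 r2 r3 ⊢
    have sub1 : Set.Icc (1 - δ) (1 + δ) ⊆ Set.Icc (1 - δ1) (1 + δ1) :=
      Set.Icc_subset_Icc (by linarith) (by linarith)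
    have sub2 : Set.Icc (1 - δ) 1 ⊆ Set.Icc (1 - δ2) 1 :=
      Set.Icc_subset_Icc (by linarith) (by linarith)
    have k1 := hv x1 (sub1 q1) y1 (sub1 r1)
    have k2 := hv x2 (sub1 q2) y2 (sub1 r2)
    have k3 := hW x3 (sub2 q3) y3 (sub2 r3)
    have ab : ∀ x, x ∈ Set.Icc (1 - δ) (1 + δ) → |x - 1| < δ3 := by
      intro x hx
      rw [abs_lt]; constructor <;> linarith [hx.1, hx.2]
    have ab' : ∀ x, x ∈ Set.Icc (1 - δ) 1 → |x - 1| < δ3 := by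
      intro x hx
      rw [abs_lt]; constructor <;> linarith [hx.1, hx.2]
    have k4 := hG (x1, x2, x3) (y1, y2, y3) (norm_triple_lt (ab _ q1) (ab _ q2) (ab' _ q3))
      (norm_triple_lt (ab _ r1) (ab _ r2) (ab' _ r3))
    have em : (1 / 2 : ℝ) • (((x1, x2, x3) : ℝ × ℝ × ℝ) + (y1, y2, y3)) =
        ((x1 + y1) / 2, (x2 + y2) / 2, (x3 + y3) / 2) := by
      ext <;> simp <;> ring
    rw [em] at k4
    have en : ((x1, x2, x3) : ℝ × ℝ × ℝ) - (y1, y2, y3) = (x1 - y1, x2 - y2, x3 - y3) := rfl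
    rw [en] at k4
    have k5 := norm_triple_sq_le (x1 - y1) (x2 - y2) (x3 - y3)
    have cv := convex_Icc (𝕜 := ℝ) (1 - δ) (1 + δ)
    have mm : ((x1 + y1) / 2, (x2 + y2) / 2, (x3 + y3) / 2) ∈ S := by
      refine ⟨⟨?_, ?_⟩, ⟨?_, ?_⟩, ⟨?_, ?_⟩⟩ <;> simp only <;>
        linarith [q1.1, q1.2, q2.1, q2.2, q3.1, q3.2, r1.1, r1.2, r2.1, r2.2, r3.1, r3.2]
    have k6 := hmin mm
    simp only [Set.mem_setOf_eq] at k6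
    unfold Ff at k6 ⊢
    set Δ := (x1 - y1) ^ 2 + (x2 - y2) ^ 2 + (x3 - y3) ^ 2 with hΔ
    have hΔ0 : 0 ≤ Δ := by positivity
    have k7 : ρ * Gfun v₂ ((x1 + y1) / 2, (x2 + y2) / 2, (x3 + y3) / 2) ≤
        ρ * ((Gfun v₂ (x1, x2, x3) + Gfun v₂ (y1, y2, y3)) / 2 + K * Δ) := by
      apply mul_le_mul_of_nonneg_left _ hρ.le
      refine k4.trans ?_
      have := mul_le_mul_of_nonneg_left k5 hK.le
      linarith
    have k8 : ρ * (2 * K) * Δ ≤ κ0 * Δ := mul_le_mul_of_nonneg_right hρ1 hΔ0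
    have k9 : κ0 * (x1 - y1) ^ 2 ≤ κ1 * (x1 - y1) ^ 2 := by gcongr
    have k10 : κ0 * (x2 - y2) ^ 2 ≤ κ1 * (x2 - y2) ^ 2 := by gcongr
    have k11 : κ0 * (x3 - y3) ^ 2 ≤ κ2 * (x3 - y3) ^ 2 := by gcongr
    have k12 : κ0 * Δ = κ0 * (x1 - y1) ^ 2 + κ0 * (x2 - y2) ^ 2 + κ0 * (x3 - y3) ^ 2 := by
      rw [hΔ]; ring
    have k13 : ρ * ((Gfun v₂ (x1, x2, x3) + Gfun v₂ (y1, y2, y3)) / 2 + K * Δ) =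
        ρ * Gfun v₂ (x1, x2, x3) / 2 + ρ * Gfun v₂ (y1, y2, y3) / 2 + ρ * (2 * K) * Δ / 2 := by
      ring
    rw [k13] at k7
    clear_value Δ
    linarith
  obtain ⟨y1, y2, y3⟩ := p0
  simp only at growth
  have hsym : y1 = y2 := by
    have := growth (y2, y1, y3) ⟨hp0.2.1, hp0.1, hp0.2.2⟩
    simp only at this
    rw [Ff_symm v₂ v₃ ρ y2 y1] at this
    have h3 : κ0 * ((y2 - y1) ^ 2 + (y1 - y2) ^ 2 + (y3 - y3) ^ 2) ≤ 0 := by linarith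
    have h4 : (y1 - y2) ^ 2 = 0 := by
      have : 0 ≤ (y1 - y2) ^ 2 := sq_nonneg _
      by_contra hne
      have h5 : 0 < (y1 - y2) ^ 2 := lt_of_le_of_ne this (Ne.symm hne)
      nlinarith [sq_nonneg (y2 - y1)]
    have := pow_eq_zero_iff (two_ne_zero) |>.1 h4
    linarith
  subst hsym
  obtain ⟨r1, r2, r3⟩ := hp0
  simp only at r1 r2 r3
  have hle1 := hmin h1S
  simp only [Set.mem_setOf_eq] at hle1
  have hval : Ff v₂ v₃ ρ 1 1 1 = -2 + ρ * v₂ 2 := by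
    unfold Ff Gfun Wfun
    simp only
    rw [arccos_one, add_zero, h.v₃_min, h.v₂_min,
      show ((1 : ℝ) ^ 2 + 1 ^ 2 + 2 * 1 * 1 * 1) = 2 ^ 2 by norm_num,
      Real.sqrt_sq (by norm_num)]
    ring
  rw [hval] at hle1
  refine ⟨y1, y3, min κ0 (g / 24), by positivity, ?_, by linarith [r3.1], r3.2, ?_⟩
  · rw [abs_le]; constructor <;> linarith [r1.1, r1.2]
  intro b1 b2 z hb1 hb1' hb2 hb2' hz hz' hr
  set Δ := (b1 - y1) ^ 2 + (b2 - y1) ^ 2 + (z - y3) ^ 2 with hΔ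
  have hΔ0 : 0 ≤ Δ := by positivity
  by_cases hin : (b1, b2, z) ∈ S
  · have := growth _ hin
    simp only at this
    have h2 : min κ0 (g / 24) * Δ ≤ κ0 * Δ := by gcongr; exact min_le_left _ _
    linarith
  · have hΔ1 : Δ ≤ 12 := by
      have : ∀ a b : ℝ, |a - b| ≤ 2 → (a - b) ^ 2 ≤ 4 := by
        intro a b hab
        rw [← sq_abs]; nlinarith [abs_nonneg (a - b)]
      have t1 := this b1 y1 (by rw [abs_le]; constructor <;> linarith [r1.1, r1.2])
      have t2 := this b2 y1 (by rw [abs_le]; constructor <;> linarith [r1.1, r1.2])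
      have t3 := this z y3 (by rw [abs_le]; constructor <;> linarith [r3.1, r3.2])
      linarith
    have h2 : min κ0 (g / 24) * Δ ≤ g / 24 * 12 := by
      have : min κ0 (g / 24) ≤ g / 24 := min_le_right _ _
      gcongr
    have hr' : -1 ≤ Gfun v₂ (b1, b2, z) := by
      apply h.v₂_lb
      simp only [Set.mem_Ioi]; linarith
    have hrlt : 3 / 2 < b1 + b2 := by
      refine lt_of_lt_of_le hr ?_
      rw [Real.sqrt_le_left (by linarith)]
      nlinarith [mul_pos hb1 hb2]
    have w0 := W_nonneg h z
    have v1 := h.v₂_lb b1 hb1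
    have v2 := h.v₂_lb b2 hb2
    have main : -2 + g ≤ v₂ b1 + v₂ b2 + Wfun v₃ z := by
      by_cases c1 : b1 < 1 / 4
      · have := hgv b2 (by linarith) hb2' (by rw [abs_of_pos (by linarith)]; linarith)
        linarith
      by_cases c2 : b2 < 1 / 4
      · have := hgv b1 (by linarith) hb1' (by rw [abs_of_pos (by linarith)]; linarith)
        linarith
      by_cases c3 : δ ≤ |b1 - 1|
      · have := hgv b1 (by linarith) hb1' c3
        linarith
      by_cases c4 : δ ≤ |b2 - 1|
      · have := hgv b2 (by linarith) hb2' c4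
        linarith
      by_cases c5 : z ≤ 1 - δ
      · have := hgW z hz c5
        linarith
      exfalso
      apply hin
      rw [not_le, abs_lt] at c3 c4
      rw [not_le] at c5
      refine ⟨⟨?_, ?_⟩, ⟨?_, ?_⟩, ⟨?_, ?_⟩⟩ <;> simp only <;>
        linarith [c3.1, c3.2, c4.1, c4.2]
    have a1 : v₂ 2 ≤ |v₂ 2| := le_abs_self _
    have a2 : ρ * v₂ 2 ≤ ρ * |v₂ 2| := by gcongr
    have a3 : ρ * (-1) ≤ ρ * Gfun v₂ (b1, b2, z) := by gcongr
    unfold Ff at hle1 ⊢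
    linarith

/-- Cosine of the turn between two bond vectors. -/
def cosT (u w : ℂ) : ℝ := (w * (starRingEnd ℂ) u).re / (‖u‖ * ‖w‖)

lemma abs_arg_eq {x : ℂ} (hx : x ≠ 0) : |Complex.arg x| = arccos (x.re / ‖x‖) := by
  rw [← Complex.cos_arg hx, ← Real.cos_abs, Real.arccos_cos (abs_nonneg _) (Complex.abs_arg_le_pi x)]

lemma v3_ccw {v₂ v₃ : ℝ → ℝ} (h : PotentialPair v₂ v₃) (a b : ℂ) :
    v₃ (ccwAngle a b) = v₃ |Complex.arg (b * (starRingEnd ℂ) a)| := by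
  unfold ccwAngle
  split_ifs with hneg
  · rw [abs_of_neg hneg]
    have := h.v₃_symm (π + Complex.arg (b * (starRingEnd ℂ) a))
    rw [show π - (π + Complex.arg (b * (starRingEnd ℂ) a)) = -Complex.arg (b * (starRingEnd ℂ) a) by ring] at this
    rw [this]; congr 1; ring
  · rw [abs_of_nonneg (not_lt.1 hneg)]

lemma cosT_le (u w : ℂ) : |cosT u w| ≤ 1 := by
  unfold cosT
  rw [abs_div, abs_of_nonneg (by positivity : 0 ≤ ‖u‖ * ‖w‖)]
  apply div_le_one_of_le₀ _ (by positivity)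
  refine (Complex.abs_re_le_norm _).trans ?_
  rw [norm_mul, Complex.norm_conj, mul_comm]

lemma norm_add_eq (u w : ℂ) (hu : u ≠ 0) (hw : w ≠ 0) :
    ‖u + w‖ = Real.sqrt (‖u‖ ^ 2 + ‖w‖ ^ 2 + 2 * ‖u‖ * ‖w‖ * cosT u w) := by
  have key : ‖u‖ ^ 2 + ‖w‖ ^ 2 + 2 * ‖u‖ * ‖w‖ * cosT u w = ‖u + w‖ ^ 2 := by
    unfold cosT
    have h1 : ‖u‖ ≠ 0 := by simpa using hu
    have h2 : ‖w‖ ≠ 0 := by simpa using hw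
    have : 2 * ‖u‖ * ‖w‖ * ((w * (starRingEnd ℂ) u).re / (‖u‖ * ‖w‖)) =
        2 * (w * (starRingEnd ℂ) u).re := by
      field_simp
    rw [this, Complex.sq_norm, Complex.sq_norm, Complex.sq_norm]
    simp [Complex.normSq_apply]; ring
  rw [key, Real.sqrt_sq (norm_nonneg _)]

lemma Ecell_eq {v₂ v₃ : ℝ → ℝ} (h : PotentialPair v₂ v₃) (ρ : ℝ) (p q r : ℂ)
    (hu : q - p ≠ 0) (hw : r - q ≠ 0) :
    Ecell v₂ v₃ ρ p q r = Ff v₂ v₃ ρ ‖q - p‖ ‖r - q‖ (cosT (q - p) (r - q)) := by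
  unfold Ecell Ff Gfun Wfun
  simp only
  rw [← norm_add_eq _ _ hu hw, show q - p + (r - q) = r - p by ring, v3_ccw h]
  congr 2
  have hne : (p - q) * (starRingEnd ℂ) (r - q) ≠ 0 := by
    apply mul_ne_zero
    · intro h0; apply hu; rw [← neg_sub, h0, neg_zero]
    · rw [map_ne_zero]; exact hw
  rw [abs_arg_eq hne]
  have : ((p - q) * (starRingEnd ℂ) (r - q)).re / ‖(p - q) * (starRingEnd ℂ) (r - q)‖ =
      - cosT (q - p) (r - q) := by
    unfold cosT
    rw [norm_mul, Complex.norm_conj, norm_sub_rev p q, ← neg_div]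
    congr 1
    simp; ring
  rw [this, Real.arccos_neg, h.v₃_symm]

/-- Energy of a chain in terms of its bond vectors. -/
def ECh (v₂ v₃ : ℝ → ℝ) (ρ ρ' : ℝ) (N : ℕ) (u : ℕ → ℂ) : ℝ :=
  ∑ k ∈ Finset.range (N + 1), Ff v₂ v₃ ρ ‖u k‖ ‖u (k + 1)‖ (cosT (u k) (u (k + 1))) +
    ρ' * ∑ k ∈ Finset.range N, v₂ ‖u k + u (k + 1) + u (k + 2)‖

/-- Local admissibility of bond vectors. -/
def AdmU (N : ℕ) (u : ℕ → ℂ) : Prop :=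
  (∀ k < N + 2, 0 < ‖u k‖ ∧ ‖u k‖ ≤ 3 / 2) ∧ (∀ k < N + 1, 3 / 2 < ‖u k + u (k + 1)‖) ∧
  (∀ k < N, 3 / 2 < ‖u k + u (k + 1) + u (k + 2)‖)

/-- Bond vectors. -/
def Uc (y : ℕ → ℂ) (k : ℕ) : ℂ := y (k + 2) - y (k + 1)

lemma Egen_eq {v₂ v₃ : ℝ → ℝ} (h : PotentialPair v₂ v₃) (ρ ρ' : ℝ) (N : ℕ) (y : ℕ → ℂ)
    (hu : ∀ k < N + 2, 0 < ‖Uc y k‖) :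
    Egen v₂ v₃ ρ ρ' (N + 3) y = ECh v₂ v₃ ρ ρ' N (Uc y) := by
  unfold Egen ECh Ered
  congr 1
  · rw [show N + 3 - 1 = N + 2 by omega, Finset.range_eq_Ico, ← Finset.Ico_add_one_right_eq_Icc,
      show (2 : ℕ) = 0 + 2 by rfl, show N + (0 + 2) + 1 = (N + 1) + 2 by ring,
      ← Finset.sum_Ico_add' ]
    apply Finset.sum_congr rfl
    intro k hk
    rw [Finset.mem_Ico] at hk
    rw [show k + 2 - 1 = k + 1 by omega]
    have h1 := norm_pos_iff.1 (hu k (by omega))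
    have h2 := norm_pos_iff.1 (hu (k + 1) (by omega))
    exact Ecell_eq h ρ _ _ _ h1 h2
  · congr 1
    rw [show N + 3 - 3 = N by omega, Finset.range_eq_Ico, ← Finset.Ico_add_one_right_eq_Icc,
      show (1 : ℕ) = 0 + 1 by rfl, show N + (0 + 1) = N + 1 by ring,
      ← Finset.sum_Ico_add' ]
    apply Finset.sum_congr rfl
    intro k hk
    congr 2
    unfold Uc
    simp only [add_assoc]
    norm_num

lemma AdmU_of_adm {N : ℕ} {y : ℕ → ℂ} (hy : Admissible (N + 3) y) : AdmU N (Uc y) := by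
  obtain ⟨h1, h2⟩ := hy
  have k2 : ∀ k < N + 1, 3 / 2 < ‖Uc y k + Uc y (k + 1)‖ := by
    intro k hk
    have := h1 (k + 3) (k + 1) (by omega) (by omega) (by omega) (by omega) (Or.inr (by omega))
    unfold Uc
    rw [show y (k + 2) - y (k + 1) + (y (k + 1 + 2) - y (k + 1 + 1)) = y (k + 3) - y (k + 1) by ring_nf]
    norm_num at this ⊢; exact this
  have k1 : ∀ k < N + 2, ‖Uc y k‖ ≤ 3 / 2 := by
    intro k hk
    have := h2 (k + 1) (by omega) (by omega)
    unfold Uc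
    norm_num at this ⊢; exact this
  refine ⟨fun k hk => ⟨?_, k1 k hk⟩, k2, ?_⟩
  · by_contra hc
    have h0 : ‖Uc y k‖ = 0 := le_antisymm (not_lt.1 hc) (norm_nonneg _)
    by_cases hk1 : k < N + 1
    · have a := k2 k hk1
      have b := norm_add_le (Uc y k) (Uc y (k + 1))
      have c := k1 (k + 1) (by omega)
      linarith
    · have hk2 : k = N + 1 := by omega
      subst hk2
      have a := k2 N (by omega)
      have b := norm_add_le (Uc y N) (Uc y (N + 1))
      have c := k1 N (by omega)
      linarith
  · intro k hk
    have := h1 (k + 4) (k + 1) (by omega) (by omega) (by omega) (by omega) (Or.inr (by omega))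
    unfold Uc
    rw [show y (k + 2) - y (k + 1) + (y (k + 1 + 2) - y (k + 1 + 1)) + (y (k + 2 + 2) - y (k + 2 + 1)) = y (k + 4) - y (k + 1) by ring_nf]
    norm_num at this ⊢; exact this

lemma sum_Uc (y : ℕ → ℂ) (N : ℕ) : ∑ k ∈ Finset.range N, Uc y k = y (N + 1) - y 1 := by
  unfold Uc
  induction N with
  | zero => simp
  | succ k ih => rw [Finset.sum_range_succ, ih]; ring

lemma v2_lip {v₂ v₃ : ℝ → ℝ} (h : PotentialPair v₂ v₃) :
    ∃ L > 0, ∀ x ∈ Set.Icc (3 / 2 : ℝ) (9 / 2), ∀ y ∈ Set.Icc (3 / 2 : ℝ) (9 / 2),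
      |v₂ x - v₂ y| ≤ L * |x - y| := by
  have hc : ContinuousOn (deriv v₂) (Set.Icc (3 / 2 : ℝ) (9 / 2)) :=
    (h.v₂_smooth.continuousOn_deriv_of_isOpen isOpen_Ioi (by simp)).mono
      (fun x hx => by simp only [Set.mem_Ioi]; linarith [hx.1])
  obtain ⟨L, hL⟩ := isCompact_Icc.exists_bound_of_continuousOn hc
  refine ⟨max L 1, by positivity, fun x hx y hy => ?_⟩
  have := Convex.norm_image_sub_le_of_norm_deriv_le (𝕜 := ℝ) (f := v₂) (C := max L 1)
    (s := Set.Icc (3 / 2 : ℝ) (9 / 2)) (x := y) (y := x) (fun z hz => ?_) (fun z hz => (hL z hz).trans (le_max_left _ _))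
    (convex_Icc _ _) hy hx
  · simpa using this
  · exact (h.v₂_smooth.contDiffAt (Ioi_mem_nhds (by linarith [hz.1]))).differentiableAt (by simp)

/-- The unit complex number of angle ψ. -/
def Ep (ψ : ℝ) : ℂ := ⟨cos ψ, sin ψ⟩

lemma norm_Ep (ψ : ℝ) : ‖Ep ψ‖ = 1 := by
  have : ‖Ep ψ‖ ^ 2 = 1 := by
    rw [Complex.sq_norm, Complex.normSq_apply]; simp only [Ep]
    nlinarith [sin_sq_add_cos_sq ψ]
  nlinarith [norm_nonneg (Ep ψ)]

lemma conj_Ep_mul (ψ : ℝ) : (starRingEnd ℂ) (Ep ψ) * Ep ψ = 1 := by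
  rw [mul_comm, Complex.mul_conj, Complex.normSq_eq_norm_sq, norm_Ep]; simp

lemma turn_pos {ψ : ℝ} (h0 : 0 < ψ) (h1 : ψ ≤ 1) {w w' : ℂ} (hw : ‖w‖ = 1) (hw' : ‖w'‖ = 1)
    (hi : 0 ≤ (w' * (starRingEnd ℂ) w).im) :
    ‖w' - w * Ep ψ‖ ≤ (1 + 2 / sin ψ) * |(w' * (starRingEnd ℂ) w).re - cos ψ| := by
  have hs : 0 < sin ψ := sin_pos_of_pos_of_lt_pi h0 (by linarith [pi_gt_three])
  set ζ := w' * (starRingEnd ℂ) w with hζ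
  have hζn : ‖ζ‖ = 1 := by rw [hζ, norm_mul, Complex.norm_conj, hw, hw', mul_one]
  have e1 : w' - w * Ep ψ = (ζ - Ep ψ) * w := by
    have : (starRingEnd ℂ) w * w = 1 := by
      rw [mul_comm, Complex.mul_conj, Complex.normSq_eq_norm_sq, hw]; simp
    rw [hζ]
    linear_combination (-w') * this
  rw [e1, norm_mul, hw, mul_one]
  have hsq : ζ.re ^ 2 + ζ.im ^ 2 = 1 := by
    have := Complex.sq_norm ζ
    rw [hζn, Complex.normSq_apply] at this; linarith
  have hre : |ζ.re| ≤ 1 := by rw [← hζn]; exact Complex.abs_re_le_norm ζ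
  refine (Complex.norm_le_abs_re_add_abs_im _).trans ?_
  simp only [Complex.sub_re, Complex.sub_im, Ep]
  have k : |ζ.im - sin ψ| * sin ψ ≤ 2 * |ζ.re - cos ψ| := by
    have a1 : |ζ.im - sin ψ| * sin ψ ≤ |ζ.im - sin ψ| * |ζ.im + sin ψ| := by
      gcongr
      rw [abs_of_nonneg (by linarith)]; linarith
    refine a1.trans ?_
    rw [← abs_mul]
    have : (ζ.im - sin ψ) * (ζ.im + sin ψ) = - (ζ.re + cos ψ) * (ζ.re - cos ψ) := by
      nlinarith [sin_sq_add_cos_sq ψ]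
    rw [this, abs_mul, abs_neg]
    gcongr
    refine (abs_add_le _ _).trans ?_
    linarith [abs_cos_le_one ψ]
  have k2 : |ζ.im - sin ψ| ≤ 2 / sin ψ * |ζ.re - cos ψ| := by
    rw [div_mul_eq_mul_div, le_div_iff₀ hs]; exact k
  linarith

/-- Sign of the turn. -/
def Pos (w w' : ℂ) : Prop := 0 ≤ (w' * (starRingEnd ℂ) w).im

/-- The model rotation of a turn. -/
def Tn (ψ : ℝ) (w w' : ℂ) : ℂ := if Pos w w' then Ep ψ else (starRingEnd ℂ) (Ep ψ)

lemma turn_any {ψ : ℝ} (h0 : 0 < ψ) (h1 : ψ ≤ 1) {w w' : ℂ} (hw : ‖w‖ = 1) (hw' : ‖w'‖ = 1) :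
    ‖w' - w * Tn ψ w w'‖ ≤ (1 + 2 / sin ψ) * |(w' * (starRingEnd ℂ) w).re - cos ψ| := by
  unfold Tn
  split_ifs with hp
  · exact turn_pos h0 h1 hw hw' hp
  · have := turn_pos (w := (starRingEnd ℂ) w) (w' := (starRingEnd ℂ) w') h0 h1
      (by rw [Complex.norm_conj, hw]) (by rw [Complex.norm_conj, hw']) (by
        unfold Pos at hp
        rw [← map_mul, Complex.conj_im]; linarith [not_le.1 hp])
    rw [← map_mul, Complex.conj_re] at this
    rw [← Complex.norm_conj]
    simpa using this

lemma norm_Tn (ψ : ℝ) (w w' : ℂ) : ‖Tn ψ w w'‖ = 1 := by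
  unfold Tn; split_ifs
  · exact norm_Ep ψ
  · rw [Complex.norm_conj, norm_Ep]

lemma third_norm_same {ψ : ℝ} (hψ : 0 < cos ψ) {w1 w2 w3 : ℂ} (hs : Pos w1 w2 ↔ Pos w2 w3) :
    ‖(starRingEnd ℂ) (Tn ψ w1 w2) + 1 + Tn ψ w2 w3‖ = 1 + 2 * cos ψ := by
  have : (starRingEnd ℂ) (Tn ψ w1 w2) + 1 + Tn ψ w2 w3 = ((1 + 2 * cos ψ : ℝ) : ℂ) := by
    unfold Tn
    by_cases hp : Pos w1 w2
    · rw [if_pos hp, if_pos (hs.1 hp)]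
      apply Complex.ext
      · rw [Complex.ofReal_re]; simp [Ep]; ring
      · rw [Complex.ofReal_im]; simp [Ep]
    · rw [if_neg hp, if_neg (fun h => hp (hs.2 h))]
      apply Complex.ext
      · rw [Complex.ofReal_re]; simp [Ep]; ring
      · rw [Complex.ofReal_im]; simp [Ep]
  rw [this, Complex.norm_real, Real.norm_eq_abs, abs_of_pos (by linarith)]

lemma third_norm_diff {ψ : ℝ} {w1 w2 w3 : ℂ} (hs : ¬ (Pos w1 w2 ↔ Pos w2 w3)) :
    ‖(starRingEnd ℂ) (Tn ψ w1 w2) + 1 + Tn ψ w2 w3‖ = Real.sqrt (5 + 4 * cos ψ) := by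
  rw [Complex.norm_def]
  congr 1
  rw [Complex.normSq_apply]
  unfold Tn
  by_cases hp : Pos w1 w2
  · rw [if_pos hp, if_neg (fun h => hs ⟨fun _ => h, fun _ => hp⟩)]
    simp [Ep]; nlinarith [sin_sq_add_cos_sq ψ]
  · rw [if_neg hp, if_pos (by by_contra h; exact hs ⟨fun a => absurd a hp, fun a => absurd a h⟩)]
    simp [Ep]; nlinarith [sin_sq_add_cos_sq ψ]

lemma third_approx {ψ b0 : ℝ} (h0 : 0 < ψ) (h1 : ψ ≤ 1) (hb : 0 ≤ b0) {w1 w2 w3 : ℂ}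
    (hw1 : ‖w1‖ = 1) (hw2 : ‖w2‖ = 1) (hw3 : ‖w3‖ = 1) (b1 b2 b3 : ℝ) :
    |‖(b1 : ℂ) * w1 + b2 * w2 + b3 * w3‖ - b0 * ‖(starRingEnd ℂ) (Tn ψ w1 w2) + 1 + Tn ψ w2 w3‖| ≤
      |b1 - b0| + |b2 - b0| + |b3 - b0| +
      b0 * ((1 + 2 / sin ψ) * |(w2 * (starRingEnd ℂ) w1).re - cos ψ|) +
      b0 * ((1 + 2 / sin ψ) * |(w3 * (starRingEnd ℂ) w2).re - cos ψ|) := by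
  have t1 := turn_any h0 h1 hw1 hw2
  have t2 := turn_any h0 h1 hw2 hw3
  set T1 := Tn ψ w1 w2
  set T2 := Tn ψ w2 w3
  have n1 : ‖T1‖ = 1 := norm_Tn _ _ _
  have n1' : (starRingEnd ℂ) T1 * T1 = 1 := by
    rw [mul_comm, Complex.mul_conj, Complex.normSq_eq_norm_sq, n1]; simp
  have e0 : b0 * ‖(starRingEnd ℂ) T1 + 1 + T2‖ =
      ‖(b0 : ℂ) * (w2 * ((starRingEnd ℂ) T1 + 1 + T2))‖ := by
    rw [norm_mul, norm_mul, hw2, one_mul, Complex.norm_real, Real.norm_eq_abs, abs_of_nonneg hb]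
  rw [e0]
  refine (abs_norm_sub_norm_le _ _).trans ?_
  have e1 : (b1 : ℂ) * w1 + b2 * w2 + b3 * w3 - (b0 : ℂ) * (w2 * ((starRingEnd ℂ) T1 + 1 + T2)) =
      ((b1 - b0 : ℝ) : ℂ) * w1 + ((b2 - b0 : ℝ) : ℂ) * w2 + ((b3 - b0 : ℝ) : ℂ) * w3 -
      ((b0 : ℂ) * ((w2 - w1 * T1) * (starRingEnd ℂ) T1)) + (b0 : ℂ) * (w3 - w2 * T2) := by
    push_cast
    linear_combination (-(b0 : ℂ) * w1) * n1'
  rw [e1]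
  refine (norm_add_le _ _).trans ?_
  refine (add_le_add_left (norm_sub_le _ _) _).trans ?_
  refine (add_le_add_left (add_le_add_left (norm_add_le _ _) _) _).trans ?_
  refine (add_le_add_left (add_le_add_left (add_le_add_left (norm_add_le _ _) _) _) _).trans ?_
  simp only [norm_mul, Complex.norm_conj, Complex.norm_real, Real.norm_eq_abs, hw1, hw2, hw3, n1,
    mul_one, abs_of_nonneg hb]
  gcongr

/-- Terms of the verification function. -/
def Phg (Q A ψ : ℝ) (w : ℂ) (j : ℕ) : ℝ := Q * (w * Ep ψ ^ j - w).im - A * j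

/-- The verification function. -/
def Phi (Q A ψ : ℝ) (w : ℂ) : ℝ := ⨆ j : ℕ, Phg Q A ψ w j

lemma Phg_le {Q A ψ p : ℝ} (hQ : 0 ≤ Q) (hseg : ∀ j : ℕ, Q * ‖Ep ψ ^ j - 1‖ ≤ A * j + p)
    {w : ℂ} (hw : ‖w‖ = 1) (j : ℕ) : Phg Q A ψ w j ≤ p := by
  unfold Phg
  have h1 : (w * Ep ψ ^ j - w).im ≤ ‖Ep ψ ^ j - 1‖ := by
    refine ((le_abs_self _).trans (Complex.abs_im_le_norm _)).trans ?_
    rw [show w * Ep ψ ^ j - w = w * (Ep ψ ^ j - 1) by ring, norm_mul, hw, one_mul]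
  have := mul_le_mul_of_nonneg_left h1 hQ
  linarith [hseg j]

lemma Phi_bdd {Q A ψ p : ℝ} (hQ : 0 ≤ Q) (hseg : ∀ j : ℕ, Q * ‖Ep ψ ^ j - 1‖ ≤ A * j + p)
    {w : ℂ} (hw : ‖w‖ = 1) : BddAbove (Set.range (Phg Q A ψ w)) := by
  refine ⟨p, ?_⟩
  rintro _ ⟨j, rfl⟩
  exact Phg_le hQ hseg hw j

lemma Phi_le {Q A ψ p : ℝ} (hQ : 0 ≤ Q) (hseg : ∀ j : ℕ, Q * ‖Ep ψ ^ j - 1‖ ≤ A * j + p)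
    {w : ℂ} (hw : ‖w‖ = 1) : Phi Q A ψ w ≤ p := ciSup_le (Phg_le hQ hseg hw)

lemma Phi_nonneg {Q A ψ p : ℝ} (hQ : 0 ≤ Q) (hseg : ∀ j : ℕ, Q * ‖Ep ψ ^ j - 1‖ ≤ A * j + p)
    {w : ℂ} (hw : ‖w‖ = 1) : 0 ≤ Phi Q A ψ w := by
  refine le_trans ?_ (le_ciSup (Phi_bdd hQ hseg hw) 0)
  simp [Phg]

lemma Phi_lip {Q A ψ p : ℝ} (hQ : 0 ≤ Q) (hseg : ∀ j : ℕ, Q * ‖Ep ψ ^ j - 1‖ ≤ A * j + p)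
    {w w' : ℂ} (hw' : ‖w'‖ = 1) : Phi Q A ψ w ≤ Phi Q A ψ w' + 2 * Q * ‖w - w'‖ := by
  apply ciSup_le
  intro j
  have h1 := le_ciSup (Phi_bdd hQ hseg hw') j
  have h2 : Phg Q A ψ w j ≤ Phg Q A ψ w' j + 2 * Q * ‖w - w'‖ := by
    unfold Phg
    have e : (w * Ep ψ ^ j - w).im - (w' * Ep ψ ^ j - w').im = ((w - w') * (Ep ψ ^ j - 1)).im := by
      rw [← Complex.sub_im]; congr 1; ring
    have a1 : ((w - w') * (Ep ψ ^ j - 1)).im ≤ ‖w - w'‖ * 2 := by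
      refine ((le_abs_self _).trans (Complex.abs_im_le_norm _)).trans ?_
      rw [norm_mul]
      gcongr
      refine (norm_sub_le _ _).trans ?_
      rw [norm_pow, norm_Ep, one_pow, norm_one]; norm_num
    have := mul_le_mul_of_nonneg_left a1 hQ
    rw [← e] at this
    linarith
  exact h2.trans (by unfold Phi; linarith)

lemma Phi_step {Q A ψ p : ℝ} (hQ : 0 ≤ Q) (hseg : ∀ j : ℕ, Q * ‖Ep ψ ^ j - 1‖ ≤ A * j + p)
    {w : ℂ} (hw : ‖w‖ = 1) :
    Q * (w * Ep ψ - w).im - A + Phi Q A ψ (w * Ep ψ) ≤ Phi Q A ψ w := by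
  rw [add_comm, ← le_sub_iff_add_le]
  apply ciSup_le
  intro j
  have h1 := le_ciSup (Phi_bdd hQ hseg hw) (j + 1)
  have h2 : Phg Q A ψ w (j + 1) = Phg Q A ψ (w * Ep ψ) j + (Q * (w * Ep ψ - w).im - A) := by
    unfold Phg
    rw [show w * Ep ψ ^ (j + 1) - w = (w * Ep ψ * Ep ψ ^ j - w * Ep ψ) + (w * Ep ψ - w) by ring,
      Complex.add_im]
    push_cast; ring
  unfold Phi at *
  linarith

lemma Ep_half {ψ : ℝ} (h0 : 0 < ψ) (h1 : ψ ≤ 1) (w : ℂ) :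
    (w * Ep ψ - w).im = tan (ψ / 2) * (w.re + (w * Ep ψ).re) := by
  have hc : 0 < cos (ψ / 2) := cos_pos_of_mem_Ioo ⟨by linarith [pi_gt_three], by linarith [pi_gt_three]⟩
  have e1 : cos ψ = 2 * cos (ψ / 2) ^ 2 - 1 := by rw [← cos_two_mul]; congr 1; ring
  have e2 : sin ψ = 2 * sin (ψ / 2) * cos (ψ / 2) := by rw [← sin_two_mul]; congr 1; ring
  rw [tan_eq_sin_div_cos]
  simp only [Complex.sub_im, Complex.mul_im, Complex.mul_re, Ep]
  rw [e1, e2]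
  field_simp
  have := sin_sq_add_cos_sq (ψ / 2)
  linear_combination (2 * w.im * cos (ψ/2)) * this

/-- Main one-step estimate. -/
lemma step_est {q b0 A ψ p : ℝ} (h0 : 0 < ψ) (h1 : ψ ≤ 1) (hq : 0 ≤ q) (hb : 0 ≤ b0)
    (hseg : ∀ j : ℕ, q * b0 / (2 * tan (ψ / 2)) * ‖Ep ψ ^ j - 1‖ ≤ A * j + p)
    {w w' : ℂ} (hw : ‖w‖ = 1) (hw' : ‖w'‖ = 1) (hp : Pos w w') :
    q * b0 * (w.re + w'.re) / 2 ≤ A + Phi (q * b0 / (2 * tan (ψ / 2))) A ψ w -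
      Phi (q * b0 / (2 * tan (ψ / 2))) A ψ w' +
      (2 * (q * b0 / (2 * tan (ψ / 2))) + q * b0) * (1 + 2 / sin ψ) *
        |(w' * (starRingEnd ℂ) w).re - cos ψ| := by
  have ht : 0 < tan (ψ / 2) := tan_pos_of_pos_of_lt_pi_div_two (by linarith) (by linarith [pi_gt_three])
  set Q := q * b0 / (2 * tan (ψ / 2)) with hQdef
  have hQ : 0 ≤ Q := by positivity
  have t := turn_pos h0 h1 hw hw' hp
  have s := Phi_step hQ hseg hw
  rw [Ep_half h0 h1] at s
  have hwE : ‖w * Ep ψ‖ = 1 := by rw [norm_mul, hw, norm_Ep, one_mul]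
  have l := Phi_lip (w := w') hQ hseg hwE
  have e : Q * (tan (ψ / 2) * (w.re + (w * Ep ψ).re)) = q * b0 * (w.re + (w * Ep ψ).re) / 2 := by
    rw [hQdef]; field_simp
  rw [e] at s
  have r : w'.re ≤ (w * Ep ψ).re + ‖w' - w * Ep ψ‖ := by
    have := (le_abs_self _).trans (Complex.abs_re_le_norm (w' - w * Ep ψ))
    rw [Complex.sub_re] at this; linarith
  set D := ‖w' - w * Ep ψ‖ with hD
  set X := (1 + 2 / sin ψ) * |(w' * (starRingEnd ℂ) w).re - cos ψ| with hX
  have hqb : 0 ≤ q * b0 := by positivity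
  have r2 : q * b0 * w'.re ≤ q * b0 * ((w * Ep ψ).re + D) := by gcongr
  have r3 : 2 * Q * D ≤ 2 * Q * X := by gcongr
  have r4 : q * b0 * D ≤ q * b0 * X := by gcongr
  have r5 : 0 ≤ q * b0 * X := le_trans (by positivity) r4
  rw [mul_assoc _ (1 + 2 / sin ψ), ← hX]
  nlinarith

/-- Verification function with orientation. -/
def Psi (Q A ψ : ℝ) (s : Prop) (w : ℂ) : ℝ :=
  if s then Phi Q A ψ w else Phi Q A ψ ((starRingEnd ℂ) w)

lemma Psi_nonneg {Q A ψ p : ℝ} (hQ : 0 ≤ Q) (hseg : ∀ j : ℕ, Q * ‖Ep ψ ^ j - 1‖ ≤ A * j + p)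
    (s : Prop) {w : ℂ} (hw : ‖w‖ = 1) : 0 ≤ Psi Q A ψ s w := by
  unfold Psi; split_ifs
  · exact Phi_nonneg hQ hseg hw
  · exact Phi_nonneg hQ hseg (by rw [Complex.norm_conj, hw])

lemma Psi_le {Q A ψ p : ℝ} (hQ : 0 ≤ Q) (hseg : ∀ j : ℕ, Q * ‖Ep ψ ^ j - 1‖ ≤ A * j + p)
    (s : Prop) {w : ℂ} (hw : ‖w‖ = 1) : Psi Q A ψ s w ≤ p := by
  unfold Psi; split_ifs
  · exact Phi_le hQ hseg hw
  · exact Phi_le hQ hseg (by rw [Complex.norm_conj, hw])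

lemma step_any {q b0 A ψ p : ℝ} (h0 : 0 < ψ) (h1 : ψ ≤ 1) (hq : 0 ≤ q) (hb : 0 ≤ b0)
    (hseg : ∀ j : ℕ, q * b0 / (2 * tan (ψ / 2)) * ‖Ep ψ ^ j - 1‖ ≤ A * j + p)
    {w w' : ℂ} (hw : ‖w‖ = 1) (hw' : ‖w'‖ = 1) :
    q * b0 * (w.re + w'.re) / 2 ≤ A + Psi (q * b0 / (2 * tan (ψ / 2))) A ψ (Pos w w') w -
      Psi (q * b0 / (2 * tan (ψ / 2))) A ψ (Pos w w') w' +
      (2 * (q * b0 / (2 * tan (ψ / 2))) + q * b0) * (1 + 2 / sin ψ) *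
        |(w' * (starRingEnd ℂ) w).re - cos ψ| := by
  by_cases hp : Pos w w'
  · simp only [Psi, if_pos hp]
    exact step_est h0 h1 hq hb hseg hw hw' hp
  · simp only [Psi, if_neg hp]
    have := step_est (w := (starRingEnd ℂ) w) (w' := (starRingEnd ℂ) w') h0 h1 hq hb hseg
      (by rw [Complex.norm_conj, hw]) (by rw [Complex.norm_conj, hw']) (by
        unfold Pos at hp ⊢
        rw [← map_mul, Complex.conj_im]; linarith [not_le.1 hp])
    rw [← map_mul, Complex.conj_re, Complex.conj_re, Complex.conj_re] at this
    exact this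

/-- Unit bond directions. -/
def Wd (u : ℕ → ℂ) (k : ℕ) : ℂ := u k / (‖u k‖ : ℂ)

/-- Deviation of a cell from the optimal one. -/
def dev (b0 c : ℝ) (u : ℕ → ℂ) (k : ℕ) : ℝ :=
  |‖u k‖ - b0| + |‖u (k + 1)‖ - b0| + |cosT (u k) (u (k + 1)) - c|

/-- Indicator of a curvature change. -/
def swi (u : ℕ → ℂ) (k : ℕ) : ℝ :=
  if (Pos (Wd u k) (Wd u (k + 1)) ↔ Pos (Wd u (k + 1)) (Wd u (k + 2))) then 0 else 1

lemma norm_Wd {u : ℕ → ℂ} {k : ℕ} (h : 0 < ‖u k‖) : ‖Wd u k‖ = 1 := by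
  unfold Wd; rw [norm_div, Complex.norm_real, norm_norm, div_self h.ne']

lemma eq_Wd {u : ℕ → ℂ} {k : ℕ} (h : 0 < ‖u k‖) : u k = (‖u k‖ : ℂ) * Wd u k := by
  unfold Wd
  have : (‖u k‖ : ℂ) ≠ 0 := by exact_mod_cast h.ne'
  field_simp

lemma re_Wd {u : ℕ → ℂ} {k : ℕ} (h : 0 < ‖u k‖) : (u k).re = ‖u k‖ * (Wd u k).re := by
  conv_lhs => rw [eq_Wd h]
  rw [Complex.re_ofReal_mul]

lemma cosT_Wd {u : ℕ → ℂ} {k : ℕ} :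
    cosT (u k) (u (k + 1)) = (Wd u (k + 1) * (starRingEnd ℂ) (Wd u k)).re := by
  unfold cosT Wd
  rw [map_div₀, Complex.conj_ofReal, div_mul_div_comm, ← Complex.ofReal_mul, Complex.div_ofReal_re,
    mul_comm ‖u k‖]

lemma dev_nonneg (b0 c : ℝ) (u : ℕ → ℂ) (k : ℕ) : 0 ≤ dev b0 c u k := by unfold dev; positivity

lemma swi_nonneg (u : ℕ → ℂ) (k : ℕ) : 0 ≤ swi u k := by unfold swi; split_ifs <;> norm_num

lemma chain_sum {q b0 A ψ p : ℝ} (h0 : 0 < ψ) (h1 : ψ ≤ 1) (hq : 0 ≤ q) (hb : 0 ≤ b0) (hp : 0 ≤ p)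
    (hseg : ∀ j : ℕ, q * b0 / (2 * tan (ψ / 2)) * ‖Ep ψ ^ j - 1‖ ≤ A * j + p) :
    ∃ C ≥ 0, ∀ (u : ℕ → ℂ) (N : ℕ), (∀ k < N + 2, 0 < ‖u k‖) →
      q * ∑ k ∈ Finset.range (N + 1), ((u k).re + (u (k + 1)).re) / 2 ≤
        A * (N + 1) + p - Psi (q * b0 / (2 * tan (ψ / 2))) A ψ (Pos (Wd u N) (Wd u (N + 1))) (Wd u (N + 1))
        + p * ∑ k ∈ Finset.range N, swi u k + C * ∑ k ∈ Finset.range (N + 1), dev b0 (cos ψ) u k := by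
  have hs : 0 < sin ψ := sin_pos_of_pos_of_lt_pi h0 (by linarith [pi_gt_three])
  have ht : 0 < tan (ψ / 2) := tan_pos_of_pos_of_lt_pi_div_two (by linarith) (by linarith [pi_gt_three])
  set Q := q * b0 / (2 * tan (ψ / 2)) with hQdef
  have hQ : 0 ≤ Q := by positivity
  set C1 := (2 * Q + q * b0) * (1 + 2 / sin ψ) with hC1
  have hC1n : 0 ≤ C1 := by positivity
  refine ⟨q + C1, by positivity, fun u => ?_⟩
  have step : ∀ k, 0 < ‖u k‖ → 0 < ‖u (k + 1)‖ → q * (((u k).re + (u (k + 1)).re) / 2) ≤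
      A + Psi Q A ψ (Pos (Wd u k) (Wd u (k + 1))) (Wd u k) -
      Psi Q A ψ (Pos (Wd u k) (Wd u (k + 1))) (Wd u (k + 1)) + (q + C1) * dev b0 (cos ψ) u k := by
    intro k hk hk1
    have n1 := norm_Wd hk
    have n2 := norm_Wd hk1
    have s := step_any h0 h1 hq hb hseg n1 n2
    rw [← hQdef, ← hC1, ← cosT_Wd] at s
    have key : ∀ j, 0 < ‖u j‖ → (u j).re ≤ b0 * (Wd u j).re + |‖u j‖ - b0| := by
      intro j hj
      rw [re_Wd hj]
      have : (‖u j‖ - b0) * (Wd u j).re ≤ |‖u j‖ - b0| := by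
        refine (le_abs_self _).trans ?_
        rw [abs_mul]
        have : |(Wd u j).re| ≤ 1 := by rw [← norm_Wd hj]; exact Complex.abs_re_le_norm _
        exact mul_le_of_le_one_right (abs_nonneg _) this
      linarith
    have a1 := key k hk
    have a2 := key (k + 1) hk1
    set X1 := |‖u k‖ - b0|
    set X2 := |‖u (k + 1)‖ - b0|
    set X3 := |cosT (u k) (u (k + 1)) - cos ψ|
    have p1 : 0 ≤ X1 := abs_nonneg _
    have p2 : 0 ≤ X2 := abs_nonneg _
    have p3 : 0 ≤ X3 := abs_nonneg _
    have ed : dev b0 (cos ψ) u k = X1 + X2 + X3 := rfl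
    rw [ed]
    have a3 : q * (((u k).re + (u (k + 1)).re) / 2) ≤
        q * ((b0 * (Wd u k).re + X1 + (b0 * (Wd u (k + 1)).re + X2)) / 2) := by gcongr
    have b1 := mul_nonneg hC1n p1
    have b2 := mul_nonneg hC1n p2
    have b3 := mul_nonneg hq p3
    have b4 := mul_nonneg hq p1
    have b5 := mul_nonneg hq p2
    nlinarith
  intro N
  induction N with
  | zero =>
    intro hu
    have s := step 0 (hu 0 (by omega)) (hu 1 (by omega))
    have l := Psi_le hQ hseg (Pos (Wd u 0) (Wd u 1)) (norm_Wd (hu 0 (by omega)))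
    simp only [zero_add, Finset.sum_range_one, Finset.sum_range_zero, Nat.cast_zero] at s ⊢
    linarith
  | succ N ih =>
    intro hu
    have s := step (N + 1) (hu (N + 1) (by omega)) (hu (N + 2) (by omega))
    have i := ih (fun k hk => hu k (by omega))
    have n1 := norm_Wd (hu (N + 1) (by omega))
    have sw : Psi Q A ψ (Pos (Wd u (N + 1)) (Wd u (N + 2))) (Wd u (N + 1)) ≤
        Psi Q A ψ (Pos (Wd u N) (Wd u (N + 1))) (Wd u (N + 1)) + p * swi u N := by
      unfold swi
      split_ifs with hh
      · rw [propext hh]; linarith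
      · have l1 := Psi_le hQ hseg (Pos (Wd u (N + 1)) (Wd u (N + 2))) n1
        have l2 := Psi_nonneg hQ hseg (Pos (Wd u N) (Wd u (N + 1))) n1
        linarith
    rw [Finset.sum_range_succ _ (N + 1), Finset.sum_range_succ (swi u) N,
      Finset.sum_range_succ (dev b0 (cos ψ) u) (N + 1)]
    push_cast
    rw [mul_add q, mul_add p, mul_add (q + C1)]
    rw [show N + 1 + 1 = N + 2 by ring] at *
    linarith

lemma third_lower {v₂ v₃ : ℝ → ℝ} (h : PotentialPair v₂ v₃) {b0 ψ : ℝ} (h0 : 0 < ψ) (h1 : ψ ≤ 1)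
    (hc : 9 / 10 ≤ cos ψ) (hb : 9 / 10 ≤ b0) (hb' : b0 ≤ 11 / 10) :
    ∃ C ≥ 0, ∀ (u : ℕ → ℂ) (N : ℕ), AdmU N u → ∀ k < N,
      v₂ (b0 * (1 + 2 * cos ψ)) + (v₂ (b0 * Real.sqrt (5 + 4 * cos ψ)) - v₂ (b0 * (1 + 2 * cos ψ))) *
        swi u k - C * (dev b0 (cos ψ) u k + dev b0 (cos ψ) u (k + 1))
        ≤ v₂ ‖u k + u (k + 1) + u (k + 2)‖ := by
  obtain ⟨L, hL, hlip⟩ := v2_lip h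
  have hs : 0 < sin ψ := sin_pos_of_pos_of_lt_pi h0 (by linarith [pi_gt_three])
  have hc1 := cos_le_one ψ
  set Ct := 1 + b0 * (1 + 2 / sin ψ) with hCt
  have hX : 0 ≤ b0 * (1 + 2 / sin ψ) := by positivity
  refine ⟨L * Ct, by positivity, fun u N hu k hk => ?_⟩
  obtain ⟨hu1, hu2, hu3⟩ := hu
  obtain ⟨p1, q1⟩ := hu1 k (by omega)
  obtain ⟨p2, q2⟩ := hu1 (k + 1) (by omega)
  obtain ⟨p3, q3⟩ := hu1 (k + 2) (by omega)
  have t := third_approx h0 h1 (by linarith : 0 ≤ b0) (norm_Wd p1) (norm_Wd p2) (norm_Wd p3)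
    ‖u k‖ ‖u (k + 1)‖ ‖u (k + 2)‖
  rw [← eq_Wd p1, ← eq_Wd p2, ← eq_Wd p3, ← cosT_Wd, ← cosT_Wd (k := k + 1)] at t
  have mem : ‖u k + u (k + 1) + u (k + 2)‖ ∈ Set.Icc (3 / 2 : ℝ) (9 / 2) := by
    refine ⟨(hu3 k hk).le, ?_⟩
    refine (norm_add_le _ _).trans ?_
    have := norm_add_le (u k) (u (k + 1))
    linarith
  set X := ‖(starRingEnd ℂ) (Tn ψ (Wd u k) (Wd u (k + 1))) + 1 + Tn ψ (Wd u (k + 1)) (Wd u (k + 2))‖ with hXd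
  have hX12 : 2 ≤ X ∧ X ≤ 3 ∧ v₂ (b0 * (1 + 2 * cos ψ)) + (v₂ (b0 * Real.sqrt (5 + 4 * cos ψ)) - v₂ (b0 * (1 + 2 * cos ψ))) *
        swi u k = v₂ (b0 * X) := by
    unfold swi
    split_ifs with hh
    · rw [hXd, third_norm_same (by linarith) hh]
      refine ⟨by linarith, by linarith, by ring⟩
    · rw [hXd, third_norm_diff hh]
      refine ⟨?_, ?_, by ring⟩
      · apply Real.le_sqrt_of_sq_le; linarith
      · rw [Real.sqrt_le_left (by norm_num)]; linarith
  obtain ⟨x1, x2, x3⟩ := hX12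
  rw [x3]
  have mem2 : b0 * X ∈ Set.Icc (3 / 2 : ℝ) (9 / 2) := by
    constructor <;> nlinarith
  have l := hlip _ mem2 _ mem
  rw [abs_sub_comm (b0 * X)] at l
  have l2 : |‖u k + u (k + 1) + u (k + 2)‖ - b0 * X| ≤
      Ct * (dev b0 (cos ψ) u k + dev b0 (cos ψ) u (k + 1)) := by
    refine t.trans ?_
    unfold dev
    rw [hCt]
    set Y := b0 * (1 + 2 / sin ψ) with hY
    rw [← mul_assoc, ← mul_assoc, ← hY]
    have g1 := abs_nonneg (‖u k‖ - b0)
    have g2 := abs_nonneg (‖u (k + 1)‖ - b0)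
    have g3 := abs_nonneg (‖u (k + 2)‖ - b0)
    have g4 := abs_nonneg (cosT (u k) (u (k + 1)) - cos ψ)
    have g5 := abs_nonneg (cosT (u (k + 1)) (u (k + 2)) - cos ψ)
    rw [show k + 1 + 1 = k + 2 by ring]
    have f1 := mul_nonneg hX g1
    have f2 := mul_nonneg hX g2
    have f3 := mul_nonneg hX g3
    nlinarith
  have l3 := mul_le_mul_of_nonneg_left l2 hL.le
  have := (le_abs_self _).trans l
  linarith

/-- Quadratic growth of the cell energy around its minimizer. -/
def CellMin (v₂ v₃ : ℝ → ℝ) (ρ b0 c κ : ℝ) : Prop :=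
  0 < κ ∧ ∀ b₁ b₂ z, 0 < b₁ → b₁ ≤ 3 / 2 → 0 < b₂ → b₂ ≤ 3 / 2 → -1 ≤ z → z ≤ 1 →
        3 / 2 < Real.sqrt (b₁ ^ 2 + b₂ ^ 2 + 2 * b₁ * b₂ * z) →
        Ff v₂ v₃ ρ b0 b0 c + κ * ((b₁ - b0) ^ 2 + (b₂ - b0) ^ 2 + (z - c) ^ 2)
          ≤ Ff v₂ v₃ ρ b₁ b₂ z

lemma cell_dev {v₂ v₃ : ℝ → ℝ} {ρ b0 c κ : ℝ} (hcm : CellMin v₂ v₃ ρ b0 c κ) {N : ℕ} {u : ℕ → ℂ}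
    (hu : AdmU N u) {k : ℕ} (hk : k < N + 1) :
    Ff v₂ v₃ ρ b0 b0 c + κ / 3 * dev b0 c u k ^ 2 ≤
      Ff v₂ v₃ ρ ‖u k‖ ‖u (k + 1)‖ (cosT (u k) (u (k + 1))) := by
  obtain ⟨hκ, hc⟩ := hcm
  obtain ⟨hu1, hu2, hu3⟩ := hu
  obtain ⟨p1, q1⟩ := hu1 k (by omega)
  obtain ⟨p2, q2⟩ := hu1 (k + 1) (by omega)
  have hz := abs_le.1 (cosT_le (u k) (u (k + 1)))
  have := hc ‖u k‖ ‖u (k + 1)‖ (cosT (u k) (u (k + 1))) p1 q1 p2 q2 hz.1 hz.2 (by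
    rw [← norm_add_eq _ _ (norm_pos_iff.1 p1) (norm_pos_iff.1 p2)]; exact hu2 k hk)
  refine le_trans ?_ this
  have : dev b0 c u k ^ 2 ≤ 3 * ((‖u k‖ - b0) ^ 2 + (‖u (k + 1)‖ - b0) ^ 2 +
      (cosT (u k) (u (k + 1)) - c) ^ 2) := by
    unfold dev
    rw [← sq_abs (‖u k‖ - b0), ← sq_abs (‖u (k + 1)‖ - b0), ← sq_abs (cosT (u k) (u (k + 1)) - c)]
    set x := |‖u k‖ - b0|
    set y := |‖u (k + 1)‖ - b0|
    set z := |cosT (u k) (u (k + 1)) - c|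
    nlinarith [sq_nonneg (x - y), sq_nonneg (y - z), sq_nonneg (x - z)]
  have := mul_le_mul_of_nonneg_left this (by positivity : 0 ≤ κ / 3)
  linarith

lemma lower_abstract {v₂ v₃ : ℝ → ℝ} {ρ b0 c κ : ℝ} (hcm : CellMin v₂ v₃ ρ b0 c κ) {N : ℕ}
    {u : ℕ → ℂ} (hu : AdmU N u) {h0 C1 C2 B ρ' : ℝ} (hC1 : 0 ≤ C1) (hρ' : 0 ≤ ρ') (s : ℕ → ℝ)
    (ht : ∀ k < N, h0 + s k - C1 * (dev b0 c u k + dev b0 c u (k + 1)) ≤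
      v₂ ‖u k + u (k + 1) + u (k + 2)‖)
    (hs : B - C2 * ∑ k ∈ Finset.range (N + 1), dev b0 c u k ≤ ∑ k ∈ Finset.range N, s k) :
    (N + 1) * Ff v₂ v₃ ρ b0 b0 c + ρ' * (N * h0 + B) -
      3 * (2 * C1 + C2) ^ 2 / (4 * κ) * ρ' ^ 2 * (N + 1) ≤ ECh v₂ v₃ ρ ρ' N u := by
  have hκ := hcm.1
  unfold ECh
  set d := dev b0 c u with hd
  set e := Ff v₂ v₃ ρ b0 b0 c with he
  have i1 : ∑ k ∈ Finset.range (N + 1), (e + κ / 3 * d k ^ 2) ≤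
      ∑ k ∈ Finset.range (N + 1), Ff v₂ v₃ ρ ‖u k‖ ‖u (k + 1)‖ (cosT (u k) (u (k + 1))) :=
    Finset.sum_le_sum (fun k hk => cell_dev hcm hu (Finset.mem_range.1 hk))
  have i2 : ∑ k ∈ Finset.range N, (h0 + s k - C1 * (d k + d (k + 1))) ≤
      ∑ k ∈ Finset.range N, v₂ ‖u k + u (k + 1) + u (k + 2)‖ :=
    Finset.sum_le_sum (fun k hk => ht k (Finset.mem_range.1 hk))
  have hdn : ∀ k, 0 ≤ d k := dev_nonneg b0 c u
  have i3 : ∑ k ∈ Finset.range N, d k ≤ ∑ k ∈ Finset.range (N + 1), d k := by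
    rw [Finset.sum_range_succ]; linarith [hdn N]
  have i4 : ∑ k ∈ Finset.range N, d (k + 1) ≤ ∑ k ∈ Finset.range (N + 1), d k := by
    rw [Finset.sum_range_succ']; linarith [hdn 0]
  set D := ∑ k ∈ Finset.range (N + 1), d k with hD
  rw [Finset.sum_sub_distrib, Finset.sum_add_distrib, ← Finset.mul_sum, Finset.sum_add_distrib,
    Finset.sum_const, Finset.card_range, nsmul_eq_mul] at i2
  have i5 : C1 * (∑ k ∈ Finset.range N, d k + ∑ k ∈ Finset.range N, d (k + 1)) ≤ C1 * (D + D) := by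
    gcongr
  have i6 : N * h0 + B - (2 * C1 + C2) * D ≤
      ∑ k ∈ Finset.range N, v₂ ‖u k + u (k + 1) + u (k + 2)‖ := by linarith
  have i7 := mul_le_mul_of_nonneg_left i6 hρ'
  have i8 : ∑ k ∈ Finset.range (N + 1),
      (e + ρ' * (2 * C1 + C2) * d k - 3 * (2 * C1 + C2) ^ 2 / (4 * κ) * ρ' ^ 2) ≤
      ∑ k ∈ Finset.range (N + 1), (e + κ / 3 * d k ^ 2) := by
    apply Finset.sum_le_sum
    intro k _
    have : 0 ≤ κ / 3 * (d k - 3 * (2 * C1 + C2) * ρ' / (2 * κ)) ^ 2 := by positivity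
    have e2 : κ / 3 * (d k - 3 * (2 * C1 + C2) * ρ' / (2 * κ)) ^ 2 =
      κ / 3 * d k ^ 2 - ρ' * (2 * C1 + C2) * d k + 3 * (2 * C1 + C2) ^ 2 / (4 * κ) * ρ' ^ 2 := by
      field_simp; ring
    linarith
  rw [Finset.sum_sub_distrib, Finset.sum_add_distrib, ← Finset.mul_sum,
    Finset.sum_const, Finset.sum_const, Finset.card_range, nsmul_eq_mul, nsmul_eq_mul, ← hD] at i8
  push_cast at i8
  linarith

lemma sum_avg (f : ℕ → ℝ) (N : ℕ) : ∑ k ∈ Finset.range (N + 2), f k =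
    ∑ k ∈ Finset.range (N + 1), (f k + f (k + 1)) / 2 + (f 0 + f (N + 1)) / 2 := by
  rw [← Finset.sum_div, Finset.sum_add_distrib]
  have h1 := Finset.sum_range_succ f (N + 1)
  have h2 := Finset.sum_range_succ' f (N + 1)
  rw [show N + 1 + 1 = N + 2 by ring] at *
  linarith

lemma lower_line {v₂ v₃ : ℝ → ℝ} (h : PotentialPair v₂ v₃) {ρ b0 ψ κ : ℝ} (h0 : 0 < ψ) (h1 : ψ ≤ 1)
    (hc : 9 / 10 ≤ cos ψ) (hb : 9 / 10 ≤ b0) (hb' : b0 ≤ 11 / 10)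
    (hcm : CellMin v₂ v₃ ρ b0 (cos ψ) κ) {q A p : ℝ} (hq : 0 ≤ q) (hp : 0 ≤ p)
    (hpe : p = v₂ (b0 * Real.sqrt (5 + 4 * cos ψ)) - v₂ (b0 * (1 + 2 * cos ψ)))
    (hseg : ∀ j : ℕ, q * b0 / (2 * tan (ψ / 2)) * ‖Ep ψ ^ j - 1‖ ≤ A * j + p) :
    ∃ C ≥ 0, ∀ ρ', 0 < ρ' → ρ' ≤ 1 → ∀ (N : ℕ) (u : ℕ → ℂ) (μ : ℝ), 0 ≤ μ → AdmU N u →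
      (∑ k ∈ Finset.range (N + 2), u k).re = (N + 2) * μ →
      (N + 1) * (Ff v₂ v₃ ρ b0 b0 (cos ψ) + ρ' * (v₂ (b0 * (1 + 2 * cos ψ)) + (q * μ - A)))
        - C - C * ρ' ^ 2 * (N + 1) ≤ ECh v₂ v₃ ρ ρ' N u := by
  obtain ⟨C1, hC1, ht⟩ := third_lower h h0 h1 hc hb hb'
  obtain ⟨C2, hC2, hs⟩ := chain_sum h0 h1 hq (by linarith : 0 ≤ b0) hp hseg
  have hκ := hcm.1
  set h0' := v₂ (b0 * (1 + 2 * cos ψ)) with hh0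
  set C3 := 3 * (2 * C1 + C2) ^ 2 / (4 * κ) with hC3
  have hC3n : 0 ≤ C3 := by positivity
  have ht' : 0 < tan (ψ / 2) := tan_pos_of_pos_of_lt_pi_div_two (by linarith) (by linarith [pi_gt_three])
  refine ⟨|h0'| + 3 / 2 * q + p + C3, by positivity, ?_⟩
  intro ρ' hρ hρ1 N u μ hμ hu hL
  have hpos : ∀ k < N + 2, 0 < ‖u k‖ := fun k hk => (hu.1 k hk).1
  have cs := hs u N hpos
  have psn := Psi_nonneg (by positivity) hseg (Pos (Wd u N) (Wd u (N + 1))) (norm_Wd (hpos (N + 1) (by omega)))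
  rw [Complex.re_sum, sum_avg] at hL
  have e1 : (u 0).re ≤ 3 / 2 := (Complex.re_le_norm _).trans (hu.1 0 (by omega)).2
  have e2 : (u (N + 1)).re ≤ 3 / 2 := (Complex.re_le_norm _).trans (hu.1 (N + 1) (by omega)).2
  have e3 : q * ((N + 2) * μ) - q * (3 / 2) ≤ q * ∑ k ∈ Finset.range (N + 1), ((u k).re + (u (k + 1)).re) / 2 := by
    rw [← mul_sub]; gcongr; linarith
  have := lower_abstract hcm hu (h0 := h0') (C1 := C1) (C2 := C2)
    (B := q * ((N + 2) * μ) - q * (3 / 2) - A * (N + 1) - p) hC1 hρ.le (fun k => p * swi u k)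
    (fun k hk => by
      have := ht u N hu k hk
      rw [← hpe] at this
      exact this) (by
      rw [← Finset.mul_sum]; linarith)
  refine le_trans ?_ this
  rw [← hC3]
  have f1 : -|h0'| ≤ -h0' := neg_le_neg (le_abs_self _)
  have f2 : ρ' * (|h0'| + 3 / 2 * q + p) ≤ 1 * (|h0'| + 3 / 2 * q + p) := by gcongr
  have f3 : ρ' * (h0' ) ≤ ρ' * |h0'| := by gcongr; exact le_abs_self _
  have f4 : 0 ≤ ρ' * (q * μ) := by positivity
  have f5 : 0 ≤ (|h0'| + 3 / 2 * q + p) * ρ' ^ 2 * (N + 1) := by positivity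
  linarith

lemma lower_flat {v₂ v₃ : ℝ → ℝ} (h : PotentialPair v₂ v₃) {ρ b0 κ : ℝ}
    (hb : 9 / 10 ≤ b0) (hb' : b0 ≤ 11 / 10) (hcm : CellMin v₂ v₃ ρ b0 1 κ) :
    ∃ C ≥ 0, ∀ ρ', 0 < ρ' → ρ' ≤ 1 → ∀ (N : ℕ) (u : ℕ → ℂ), AdmU N u →
      (N + 1) * (Ff v₂ v₃ ρ b0 b0 1 + ρ' * v₂ (3 * b0))
        - C - C * ρ' ^ 2 * (N + 1) ≤ ECh v₂ v₃ ρ ρ' N u := by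
  obtain ⟨L, hL, hlip⟩ := v2_lip h
  have hκ := hcm.1
  set C3 := 3 * (2 * (3 / 2 * L) + 0) ^ 2 / (4 * κ) with hC3
  have hC3n : 0 ≤ C3 := by positivity
  refine ⟨|v₂ (3 * b0)| + C3, by positivity, ?_⟩
  intro ρ' hρ hρ1 N u hu
  have hpos : ∀ k < N + 2, 0 < ‖u k‖ := fun k hk => (hu.1 k hk).1
  have := lower_abstract hcm hu (h0 := v₂ (3 * b0)) (C1 := 3 / 2 * L) (C2 := 0)
    (B := 0) (by positivity) hρ.le (fun k => 0)
    (fun k hk => by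
      obtain ⟨p1, q1⟩ := hu.1 k (by omega)
      obtain ⟨p2, q2⟩ := hu.1 (k + 1) (by omega)
      obtain ⟨p3, q3⟩ := hu.1 (k + 2) (by omega)
      set X := ‖u k + u (k + 1) + u (k + 2)‖ with hX
      have d0 := dev_nonneg b0 1 u k
      have d1 := dev_nonneg b0 1 u (k + 1)
      have lb : 3 * b0 - 3 / 2 * (dev b0 1 u k + dev b0 1 u (k + 1)) ≤ X := by
        have n2 := norm_Wd p2
        have e : ‖(u k + u (k + 1) + u (k + 2)) * (starRingEnd ℂ) (Wd u (k + 1))‖ = X := by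
          rw [norm_mul, Complex.norm_conj, n2, mul_one]
        rw [← e]
        refine le_trans ?_ (Complex.re_le_norm _)
        have a2 : (u (k + 1) * (starRingEnd ℂ) (Wd u (k + 1))).re = ‖u (k + 1)‖ := by
          conv_lhs => rw [eq_Wd p2]
          rw [mul_assoc, Complex.mul_conj, Complex.normSq_eq_norm_sq, n2]; simp
        have a1 : (u k * (starRingEnd ℂ) (Wd u (k + 1))).re = ‖u k‖ * cosT (u k) (u (k + 1)) := by
          conv_lhs => rw [eq_Wd p1]
          rw [mul_assoc, Complex.re_ofReal_mul, cosT_Wd]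
          congr 1
          simp; ring
        have a3 : (u (k + 2) * (starRingEnd ℂ) (Wd u (k + 1))).re =
            ‖u (k + 2)‖ * cosT (u (k + 1)) (u (k + 2)) := by
          conv_lhs => rw [eq_Wd p3]
          rw [mul_assoc, Complex.re_ofReal_mul, cosT_Wd (k := k + 1)]
        rw [add_mul, add_mul, Complex.add_re, Complex.add_re, a1, a2, a3]
        unfold dev
        rw [show k + 1 + 1 = k + 2 by ring]
        have g1 := neg_abs_le (‖u k‖ - b0)
        have g2 := neg_abs_le (‖u (k + 1)‖ - b0)
        have g3 := neg_abs_le (‖u (k + 2)‖ - b0)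
        have g4 := neg_abs_le (cosT (u k) (u (k + 1)) - 1)
        have g5 := neg_abs_le (cosT (u (k + 1)) (u (k + 2)) - 1)
        have w1 := mul_le_mul_of_nonneg_left g4 p1.le
        have w2 := mul_le_mul_of_nonneg_left g5 p3.le
        have w3 : ‖u k‖ * |cosT (u k) (u (k + 1)) - 1| ≤ 3 / 2 * |cosT (u k) (u (k + 1)) - 1| := by gcongr
        have w4 : ‖u (k + 2)‖ * |cosT (u (k + 1)) (u (k + 2)) - 1| ≤
          3 / 2 * |cosT (u (k + 1)) (u (k + 2)) - 1| := by gcongr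
        have g1 := abs_nonneg (‖u k‖ - b0)
        have g2 := abs_nonneg (‖u (k + 1)‖ - b0)
        have g3 := abs_nonneg (‖u (k + 2)‖ - b0)
        linarith
      have mem2 : 3 * b0 ∈ Set.Icc (3 / 2 : ℝ) (9 / 2) := by constructor <;> linarith
      by_cases hle : 3 * b0 ≤ X
      · have := h.v₂_mono.monotoneOn (a := 3 * b0) (b := X) (by simp only [Set.mem_Ici]; linarith)
          (by simp only [Set.mem_Ici]; linarith) hle
        have : 0 ≤ 3 / 2 * L * (dev b0 1 u k + dev b0 1 u (k + 1)) := by positivity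
        linarith
      · have := hlip (3 * b0) mem2 X ⟨(hu.2.2 k hk).le, by linarith⟩
        rw [abs_of_pos (by linarith : 0 < 3 * b0 - X)] at this
        have g := mul_le_mul_of_nonneg_left (by linarith : 3 * b0 - X ≤ 3 / 2 * (dev b0 1 u k + dev b0 1 u (k + 1))) hL.le
        have := (le_abs_self _).trans this
        linarith) (by simp)
  refine le_trans ?_ this
  rw [← hC3]
  have f3 : ρ' * v₂ (3 * b0) ≤ 1 * |v₂ (3 * b0)| := by
    have := le_abs_self (v₂ (3 * b0))
    calc ρ' * v₂ (3 * b0) ≤ ρ' * |v₂ (3 * b0)| := by gcongr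
      _ ≤ _ := by gcongr
  have f5 : 0 ≤ |v₂ (3 * b0)| * ρ' ^ 2 * (N + 1) := by positivity
  linarith

lemma norm_Ep_pow_sub_one (ψ : ℝ) (j : ℕ) : ‖Ep ψ ^ j - 1‖ = 2 * |sin (j * (ψ / 2))| := by
  have e : Ep ψ ^ j = ⟨cos (j * ψ), sin (j * ψ)⟩ := by
    induction j with
    | zero => apply Complex.ext <;> simp
    | succ j ih =>
      rw [pow_succ, ih]
      apply Complex.ext
      · simp only [Complex.mul_re, Ep]; push_cast; rw [add_mul, one_mul, cos_add]
      · simp only [Complex.mul_im, Ep]; push_cast; rw [add_mul, one_mul, sin_add]; ring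
  have h1 : ‖Ep ψ ^ j - 1‖ ^ 2 = (2 * |sin (j * (ψ / 2))|) ^ 2 := by
    rw [e, Complex.sq_norm, Complex.normSq_apply, mul_pow, sq_abs]
    simp only [Complex.sub_re, Complex.sub_im, Complex.one_re, Complex.one_im]
    rw [show (j : ℝ) * ψ = 2 * (j * (ψ / 2)) by ring, cos_two_mul, sin_two_mul]
    have := sin_sq_add_cos_sq (j * (ψ / 2))
    set s := sin (j * (ψ / 2))
    set c := cos (j * (ψ / 2))
    have hc : c ^ 2 = 1 - s ^ 2 := by linarith
    ring_nf
    rw [show c ^ 4 = (c ^ 2) ^ 2 by ring, hc]; ring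
  exact (pow_left_inj₀ (norm_nonneg _) (by positivity) two_ne_zero).1 h1

lemma sin_below_chord {a b x : ℝ} (ha : 0 ≤ a) (hab : a < b) (hb : b ≤ π) (hx : 0 ≤ x) (hx' : x ≤ π)
    (hout : x ≤ a ∨ b ≤ x) :
    (sin x - sin a) * (b - a) ≤ (sin b - sin a) * (x - a) := by
  have hc := strictConcaveOn_sin_Icc.concaveOn
  rcases hout with h | h
  · rcases h.eq_or_lt with rfl | h
    · simp
    · have := hc.slope_anti_adjacent ⟨hx, hx'⟩ ⟨by linarith, hb⟩ h hab
      rw [div_le_div_iff₀ (by linarith) (by linarith)] at this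
      linarith
  · rcases h.eq_or_lt with rfl | h
    · linarith
    · have := hc.slope_anti_adjacent ⟨ha, by linarith⟩ ⟨hx, hx'⟩ hab h
      rw [div_le_div_iff₀ (by linarith) (by linarith)] at this
      linarith

lemma chord_pos {h : ℝ} (hh : 0 < h) {m : ℕ} (hm : 1 ≤ m) (hmh : (m + 1) * h ≤ π) :
    0 < (m + 1) * sin (m * h) - m * sin ((m + 1) * h) := by
  have hm' : (1 : ℝ) ≤ m := by exact_mod_cast hm
  have := strictConcaveOn_sin_Icc.slope_anti_adjacent (x := 0) (y := m * h) (z := (m + 1) * h)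
    ⟨le_refl _, pi_pos.le⟩ ⟨by positivity, hmh⟩ (by positivity) (by linarith)
  rw [sin_zero, sub_zero, sub_zero, div_lt_div_iff₀ (by linarith) (by positivity)] at this
  have : 0 < h * ((m + 1) * sin (m * h) - m * sin ((m + 1) * h)) := by linarith
  exact (mul_pos_iff_of_pos_left hh).1 this

lemma sin_chord_all {h : ℝ} (hh : 0 < h) {m : ℕ} (hmh : (m + 1) * h ≤ π / 2) (j : ℕ) :
    |sin (j * h)| ≤ sin (m * h) + (sin ((m + 1) * h) - sin (m * h)) * (j - m) := by
  have hpi := pi_pos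
  have inc : 0 ≤ sin ((m + 1) * h) - sin (m * h) := by
    rw [sub_nonneg]
    apply sin_le_sin_of_le_of_le_pi_div_two
    · have : 0 ≤ (m : ℝ) * h := by positivity
      linarith
    · exact hmh
    · linarith
  by_cases hj : j * h ≤ π / 2
  · have hj0 : 0 ≤ (j : ℝ) * h := by positivity
    rw [abs_of_nonneg (sin_nonneg_of_nonneg_of_le_pi hj0 (by linarith))]
    have out : (j : ℝ) * h ≤ m * h ∨ (m + 1) * h ≤ j * h := by
      rcases Nat.lt_or_ge m j with hlt | hle
      · right; gcongr; exact_mod_cast hlt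
      · left; gcongr
    have := sin_below_chord (a := m * h) (b := (m + 1) * h) (by positivity) (by linarith)
      (by linarith) hj0 (by linarith) out
    have e1 : ((m : ℝ) + 1) * h - m * h = h := by ring
    rw [e1, show (j : ℝ) * h - m * h = (j - m) * h by ring, ← mul_assoc] at this
    have := le_of_mul_le_mul_right this hh
    linarith
  · push Not at hj
    have := sin_below_chord (a := m * h) (b := (m + 1) * h) (x := π / 2) (by positivity) (by linarith)
      (by linarith) (by linarith) (by linarith) (Or.inr hmh)
    have e1 : ((m : ℝ) + 1) * h - m * h = h := by ring
    rw [e1, sin_pi_div_two] at this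
    have h2 : (sin ((m + 1) * h) - sin (m * h)) * (π / 2 - m * h) ≤
        (sin ((m + 1) * h) - sin (m * h)) * ((j - m) * h) := by
      gcongr; linarith
    have h3 : (1 - sin (m * h)) * h ≤ (sin ((m + 1) * h) - sin (m * h)) * (j - m) * h := by linarith
    have := le_of_mul_le_mul_right h3 hh
    linarith [abs_sin_le_one (j * h)]

/-- Mean length per bond of the pattern with arcs of `m` bonds. -/
def ell (b0 ψ : ℝ) (m : ℕ) : ℝ := b0 * sin (m * (ψ / 2)) / (m * tan (ψ / 2))

/-- Slope of the `m`-th line. -/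
def qm (b0 ψ p : ℝ) (m : ℕ) : ℝ :=
  p * tan (ψ / 2) / (b0 * ((m + 1) * sin (m * (ψ / 2)) - m * sin ((m + 1) * (ψ / 2))))

/-- Offset of the `m`-th line. -/
def Am (b0 ψ p : ℝ) (m : ℕ) : ℝ :=
  p * (sin ((m + 1) * (ψ / 2)) - sin (m * (ψ / 2))) /
    ((m + 1) * sin (m * (ψ / 2)) - m * sin ((m + 1) * (ψ / 2)))

lemma line_props {b0 ψ p : ℝ} (hb : 0 < b0) (h0 : 0 < ψ) (hp : 0 < p) {m : ℕ} (hm : 1 ≤ m)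
    (hmψ : (m + 1) * ψ ≤ 3.1) :
    0 < qm b0 ψ p m ∧
    (∀ j : ℕ, qm b0 ψ p m * b0 / (2 * tan (ψ / 2)) * ‖Ep ψ ^ j - 1‖ ≤ Am b0 ψ p m * j + p) ∧
    qm b0 ψ p m * ell b0 ψ m - Am b0 ψ p m = p / m ∧
    qm b0 ψ p m * ell b0 ψ (m + 1) - Am b0 ψ p m = p / (m + 1) := by
  have hpi := pi_gt_d2
  have hm' : (1 : ℝ) ≤ m := by exact_mod_cast hm
  have hψ1 : 2 * ψ ≤ 3.1 := by
    refine le_trans ?_ hmψ; gcongr; linarith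
  have ht : 0 < tan (ψ / 2) := tan_pos_of_pos_of_lt_pi_div_two (by linarith) (by linarith)
  have hD := chord_pos (h := ψ / 2) (by linarith) hm (by linarith)
  have hch := sin_chord_all (h := ψ / 2) (by linarith) (m := m) (by linarith)
  unfold qm Am ell
  push_cast
  set t := tan (ψ / 2)
  set S1 := sin (m * (ψ / 2))
  set S2 := sin ((m + 1) * (ψ / 2))
  have hD' : ((m : ℝ) + 1) * S1 - m * S2 ≠ 0 := hD.ne'
  refine ⟨by positivity, ?_, ?_, ?_⟩
  · intro j
    rw [norm_Ep_pow_sub_one]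
    have e : p * t / (b0 * ((m + 1) * S1 - m * S2)) * b0 / (2 * t) * (2 * |sin (j * (ψ / 2))|) =
      p / ((m + 1) * S1 - m * S2) * |sin (j * (ψ / 2))| := by field_simp
    have e2 : p * (S2 - S1) / ((m + 1) * S1 - m * S2) * j + p =
      p / ((m + 1) * S1 - m * S2) * (S1 + (S2 - S1) * (j - m)) := by
      have gen : ∀ D : ℝ, D ≠ 0 → p * (S2 - S1) / D * j + p = p / D * ((S2 - S1) * j + D) := by
        intro D hD; field_simp
      rw [gen _ hD']
      congr 1; ring
    rw [e, e2]
    exact mul_le_mul_of_nonneg_left (hch j) (by positivity)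
  · field_simp; ring
  · have : (m : ℝ) + 1 ≠ 0 := by positivity
    field_simp; ring

lemma ell_one {b0 ψ : ℝ} (h0 : 0 < ψ) (h1 : ψ ≤ 1) : ell b0 ψ 1 = b0 * cos (ψ / 2) := by
  unfold ell
  have hs : 0 < sin (ψ / 2) := sin_pos_of_pos_of_lt_pi (by linarith) (by linarith [pi_gt_three])
  have hc : 0 < cos (ψ / 2) := cos_pos_of_mem_Ioo ⟨by linarith [pi_gt_three], by linarith [pi_gt_three]⟩
  rw [tan_eq_sin_div_cos]
  simp only [Nat.cast_one, one_mul]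
  field_simp

lemma ell_big {b0 ψ : ℝ} (hb : 0 < b0) (hb1 : b0 ≤ 1.01) (h0 : 0 < ψ) (h1 : ψ ≤ 0.01) {m : ℕ}
    (hm : 3.09 ≤ m * ψ) : ell b0 ψ m ≤ 2 / 3 := by
  unfold ell
  have hpi := pi_gt_d2
  have ht : ψ / 2 < tan (ψ / 2) := lt_tan (by linarith) (by linarith)
  have hmp : 0 < (m : ℝ) := by
    by_contra hc
    have : (m : ℝ) = 0 := le_antisymm (not_lt.1 hc) (by positivity)
    rw [this] at hm; norm_num at hm
  have htp : 0 < tan (ψ / 2) := by linarith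
  rw [div_le_iff₀ (by positivity)]
  have a1 : b0 * sin (m * (ψ / 2)) ≤ b0 * 1 := by gcongr; exact sin_le_one _
  have a2 : (m : ℝ) * (ψ / 2) ≤ m * tan (ψ / 2) := by gcongr
  norm_num at *
  linarith

lemma exists_pattern {b0 ψ ν : ℝ} (hb : 0 < b0) (hb1 : b0 ≤ 1.01) (h0 : 0 < ψ) (h1 : ψ ≤ 0.01)
    (hν1 : 2 / 3 ≤ ν) (hν2 : ν ≤ ell b0 ψ 1) :
    ∃ m : ℕ, 1 ≤ m ∧ (m + 1) * ψ ≤ 3.1 ∧ ell b0 ψ (m + 1) ≤ ν ∧ ν ≤ ell b0 ψ m := by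
  have hN : ∃ j : ℕ, ell b0 ψ (j + 2) ≤ ν := by
    set N := ⌊(3.1 : ℝ) / ψ⌋₊ with hN
    have a1 : (3.1 : ℝ) / ψ < N + 1 := Nat.lt_floor_add_one _
    have a2 : (N : ℝ) ≤ 3.1 / ψ := Nat.floor_le (by positivity)
    rw [div_lt_iff₀ h0] at a1
    have a3 : (2 : ℝ) ≤ N := by
      by_contra hc
      push Not at hc
      have : ((N : ℝ) + 1) * ψ ≤ 3 * 0.01 := by
        apply mul_le_mul _ h1 h0.le (by norm_num); linarith
      norm_num at *; linarith
    have a4 : 2 ≤ N := by exact_mod_cast a3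
    refine ⟨N - 2, ?_⟩
    rw [Nat.sub_add_cancel a4]
    refine (ell_big hb hb1 h0 h1 ?_).trans hν1
    norm_num at *; linarith
  have hspec := Nat.find_spec hN
  set j := Nat.find hN with hj
  have up : ν ≤ ell b0 ψ (j + 1) := by
    rcases Nat.eq_zero_or_pos j with h | h
    · rw [h]; exact hν2
    · have := Nat.find_min hN (m := j - 1) (by omega)
      rw [show j - 1 + 2 = j + 1 by omega] at this
      exact (not_le.1 this).le
  refine ⟨j + 1, by omega, ?_, hspec, up⟩
  by_contra hc
  push Not at hc
  push_cast at hc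
  have e : ((j + 1 + 1 : ℕ) : ℝ) * ψ = (j : ℝ) * ψ + 2 * ψ := by push_cast; ring
  rcases Nat.eq_zero_or_pos j with h | h
  · rw [h] at hc; norm_num at *; linarith
  · have := Nat.find_min hN (m := j - 1) (by omega)
    rw [show j - 1 + 2 = j + 1 by omega] at this
    apply this
    refine (ell_big hb hb1 h0 h1 ?_).trans hν1
    push_cast; norm_num at *; linarith

lemma cosT_rot {ω : ℂ} (hω : ‖ω‖ = 1) (u w : ℂ) : cosT (ω * u) (ω * w) = cosT u w := by
  unfold cosT
  rw [norm_mul, norm_mul, hω, one_mul, one_mul, map_mul]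
  congr 2
  have : ω * (starRingEnd ℂ) ω = 1 := by
    rw [Complex.mul_conj, Complex.normSq_eq_norm_sq, hω]; simp
  linear_combination (w * (starRingEnd ℂ) u) * this

lemma ECh_rot (v₂ v₃ : ℝ → ℝ) (ρ ρ' : ℝ) (N : ℕ) (u : ℕ → ℂ) {ω : ℂ} (hω : ‖ω‖ = 1) :
    ECh v₂ v₃ ρ ρ' N (fun k => ω * u k) = ECh v₂ v₃ ρ ρ' N u := by
  unfold ECh
  simp only [cosT_rot hω, ← mul_add, norm_mul, hω, one_mul]

lemma exists_rot (S : ℂ) (t : ℝ) (ht : 0 ≤ t) (hS : t ≤ ‖S‖) : ∃ ω : ℂ, ‖ω‖ = 1 ∧ (ω * S).re = t := by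
  by_cases h : S = 0
  · subst h
    rw [norm_zero] at hS
    exact ⟨1, by simp, by simp; linarith⟩
  · have hn : 0 < ‖S‖ := norm_pos_iff.2 h
    refine ⟨Ep (arccos (t / ‖S‖)) * ((starRingEnd ℂ) S / (‖S‖ : ℂ)), ?_, ?_⟩
    · rw [norm_mul, norm_Ep, norm_div, Complex.norm_conj, Complex.norm_real, norm_norm, one_mul,
        div_self hn.ne']
    · have : Ep (arccos (t / ‖S‖)) * ((starRingEnd ℂ) S / (‖S‖ : ℂ)) * S =
          (‖S‖ : ℂ) * Ep (arccos (t / ‖S‖)) := by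
        have h1 : (starRingEnd ℂ) S * S = (‖S‖ : ℂ) ^ 2 := by
          rw [mul_comm, Complex.mul_conj, Complex.normSq_eq_norm_sq]; push_cast; ring
        have h2 : (‖S‖ : ℂ) ≠ 0 := by exact_mod_cast hn.ne'
        field_simp
        linear_combination (Ep (arccos (t / ‖S‖))) * h1
      rw [this, Complex.re_ofReal_mul]
      simp only [Ep]
      rw [cos_arccos]
      · field_simp
      · exact le_trans (by norm_num) (div_nonneg ht hn.le)
      · exact div_le_one_of_le₀ hS hn.le

/-- Bond vectors of a chain with constant bond length and given directions. -/
def U0 (b : ℝ) (θ : ℕ → ℝ) (k : ℕ) : ℂ := (b : ℂ) * Ep (θ k)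

lemma norm_U0 {b : ℝ} (hb : 0 ≤ b) (θ : ℕ → ℝ) (k : ℕ) : ‖U0 b θ k‖ = b := by
  unfold U0; rw [norm_mul, norm_Ep, mul_one, Complex.norm_real, Real.norm_eq_abs, abs_of_nonneg hb]

lemma U0_re (b : ℝ) (θ : ℕ → ℝ) (k : ℕ) : (U0 b θ k).re = b * cos (θ k) := by
  unfold U0; rw [Complex.re_ofReal_mul]; rfl

lemma Ep_mul_conj_re (a b : ℝ) : (Ep a * (starRingEnd ℂ) (Ep b)).re = cos (a - b) := by
  simp only [Complex.mul_re, Complex.conj_re, Complex.conj_im, Ep]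
  rw [cos_sub]; ring

lemma cos_155 {x : ℝ} (hx : |x| ≤ 1.55) : 0.019 ≤ cos x := by
  have hpi := pi_gt_d4
  rw [← cos_abs]
  have h1 : cos 1.55 ≤ cos |x| := cos_le_cos_of_nonneg_of_le_pi (abs_nonneg _) (by norm_num at *; linarith) hx
  refine le_trans ?_ h1
  rw [← sin_pi_div_two_sub]
  have h2 : sin 0.02 ≤ sin (π / 2 - 1.55) := by
    apply sin_le_sin_of_le_of_le_pi_div_two <;> norm_num at * <;> linarith
  have h3 := sin_gt_sub_cube (x := 0.02) (by norm_num)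
  norm_num at *; linarith

lemma theta_dist {θ : ℕ → ℝ} (h : ∀ k, |θ (k + 1) - θ k| ≤ 0.002) (a i : ℕ) :
    |θ (a + i) - θ a| ≤ 0.002 * i := by
  induction i with
  | zero => simp
  | succ i ih =>
    have h1 := h (a + i)
    have : θ (a + (i + 1)) - θ a = (θ (a + i + 1) - θ (a + i)) + (θ (a + i) - θ a) := by
      rw [← add_assoc]; ring
    rw [this]
    refine (abs_add_le _ _).trans ?_
    push_cast; linarith

lemma seg_norm {b : ℝ} (hb : 0.99 ≤ b) {θ : ℕ → ℝ} (h1 : ∀ k, |θ k| ≤ 1.55)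
    (h2 : ∀ k, |θ (k + 1) - θ k| ≤ 0.002) (a l : ℕ) (hl : 2 ≤ l) :
    (1.5 : ℝ) < ‖∑ i ∈ Finset.range l, U0 b θ (a + i)‖ := by
  have hl' : (2 : ℝ) ≤ l := by exact_mod_cast hl
  have hb0 : 0 < b := lt_of_lt_of_le (by norm_num) hb
  by_cases hs : l ≤ 100
  · have hs' : (l : ℝ) ≤ 100 := by exact_mod_cast hs
    have e : ‖(∑ i ∈ Finset.range l, U0 b θ (a + i)) * (starRingEnd ℂ) (Ep (θ a))‖ =
        ‖∑ i ∈ Finset.range l, U0 b θ (a + i)‖ := by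
      rw [norm_mul, Complex.norm_conj, norm_Ep, mul_one]
    rw [← e]
    refine lt_of_lt_of_le ?_ (Complex.re_le_norm _)
    rw [Finset.sum_mul, Complex.re_sum]
    have : ∑ i ∈ Finset.range l, (0.97 : ℝ) ≤
        ∑ i ∈ Finset.range l, (U0 b θ (a + i) * (starRingEnd ℂ) (Ep (θ a))).re := by
      apply Finset.sum_le_sum
      intro i hi
      have hi' : (i : ℝ) ≤ 100 := by
        have := Finset.mem_range.1 hi
        have : i ≤ 100 := by omega
        exact_mod_cast this
      unfold U0
      rw [mul_assoc, Complex.re_ofReal_mul, Ep_mul_conj_re]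
      have d := theta_dist h2 a i
      have c := one_sub_sq_div_two_le_cos (x := θ (a + i) - θ a)
      have d2 : (θ (a + i) - θ a) ^ 2 ≤ 0.04 := by
        rw [← sq_abs]
        have : |θ (a + i) - θ a| ≤ 0.2 := d.trans (by
          calc (0.002:ℝ) * i ≤ 0.002 * 100 := by gcongr
            _ = 0.2 := by norm_num)
        calc |θ (a + i) - θ a| ^ 2 ≤ 0.2 ^ 2 := by gcongr
          _ = 0.04 := by norm_num
      have : (0.98 : ℝ) ≤ cos (θ (a + i) - θ a) := by
        have : (0.04 : ℝ) / 2 = 0.02 := by norm_num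
        have : (0.98 : ℝ) = 1 - 0.02 := by norm_num
        linarith
      calc (0.97 : ℝ) ≤ 0.99 * 0.98 := by norm_num
        _ ≤ _ := by gcongr
    rw [Finset.sum_const, Finset.card_range, nsmul_eq_mul] at this
    refine lt_of_lt_of_le ?_ this
    calc (1.5 : ℝ) < 2 * 0.97 := by norm_num
      _ ≤ _ := by gcongr
  · refine lt_of_lt_of_le ?_ (Complex.re_le_norm _)
    rw [Complex.re_sum]
    have : ∑ i ∈ Finset.range l, (0.018 : ℝ) ≤ ∑ i ∈ Finset.range l, (U0 b θ (a + i)).re := by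
      apply Finset.sum_le_sum
      intro i hi
      rw [U0_re]
      calc (0.018 : ℝ) ≤ 0.99 * 0.019 := by norm_num
        _ ≤ _ := by gcongr; exact cos_155 (h1 _)
    rw [Finset.sum_const, Finset.card_range, nsmul_eq_mul] at this
    have hs' : (101 : ℝ) ≤ l := by
      have : 101 ≤ l := by omega
      exact_mod_cast this
    refine lt_of_lt_of_le ?_ this
    calc (1.5 : ℝ) < 101 * 0.018 := by norm_num
      _ ≤ _ := by gcongr

lemma conf_of_theta {v₂ v₃ : ℝ → ℝ} (h : PotentialPair v₂ v₃) {b : ℝ} (hb : 0.99 ≤ b) (hb' : b ≤ 1.01)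
    {θ : ℕ → ℝ} (h1 : ∀ k, |θ k| ≤ 1.55) (h2 : ∀ k, |θ (k + 1) - θ k| ≤ 0.002) (N : ℕ) {μ : ℝ}
    (hμ : 0 ≤ μ) (hd : (N + 2) * μ ≤ ‖∑ k ∈ Finset.range (N + 2), U0 b θ k‖) (ρ ρ' : ℝ) :
    ∃ y : ℕ → ℂ, Admissible (N + 3) y ∧ BC (N + 3) μ y ∧
      Egen v₂ v₃ ρ ρ' (N + 3) y = ECh v₂ v₃ ρ ρ' N (U0 b θ) := by
  have hb0 : 0 < b := lt_of_lt_of_le (by norm_num) hb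
  obtain ⟨ω, hω, hre⟩ := exists_rot _ ((N + 2) * μ) (by positivity) hd
  set y : ℕ → ℂ := fun j => ∑ i ∈ Finset.range (j - 1), ω * U0 b θ i with hy
  have hU : Uc y = fun k => ω * U0 b θ k := by
    funext k
    simp only [Uc, hy]
    rw [show k + 2 - 1 = k + 1 by omega, show k + 1 - 1 = k by omega, Finset.sum_range_succ]; ring
  have hdiff : ∀ a l : ℕ, y (a + 1 + l) - y (a + 1) = ω * ∑ i ∈ Finset.range l, U0 b θ (a + i) := by
    intro a l
    simp only [hy]
    rw [show a + 1 + l - 1 = a + l by omega, show a + 1 - 1 = a by omega, Finset.sum_range_add,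
      add_sub_cancel_left, Finset.mul_sum]
  have far : ∀ i j : ℕ, 1 ≤ i → i + 2 ≤ j → (1.5 : ℝ) < ‖y j - y i‖ := by
    intro i j hi hij
    have := hdiff (i - 1) (j - i)
    rw [show i - 1 + 1 + (j - i) = j by omega, show i - 1 + 1 = i by omega] at this
    rw [this, norm_mul, hω, one_mul]
    exact seg_norm hb h1 h2 _ _ (by omega)
  refine ⟨y, ⟨?_, ?_⟩, ?_, ?_⟩
  · intro i j hi _ hj _ hij
    rcases hij with hij | hij
    · rw [norm_sub_rev]; exact far i j hi hij
    · exact far j i hj hij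
  · intro i hi _
    have := congrFun hU (i - 1)
    simp only [Uc] at this
    rw [show i - 1 + 2 = i + 1 by omega, show i - 1 + 1 = i by omega] at this
    rw [this, norm_mul, hω, one_mul, norm_U0 hb0.le]
    exact hb'.trans (by norm_num)
  · unfold BC
    have := hdiff 0 (N + 2)
    rw [show 0 + 1 + (N + 2) = N + 3 by omega, show 0 + 1 = 1 by omega] at this
    rw [this]
    simp only [zero_add]
    rw [hre]
    push_cast; ring
  · rw [Egen_eq h, hU, ECh_rot _ _ _ _ _ _ hω]
    intro k _
    rw [hU]
    simp only
    rw [norm_mul, hω, one_mul, norm_U0 hb0.le]; exact hb0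

lemma cosT_U0 {b : ℝ} (hb : 0 < b) (θ : ℕ → ℝ) (k : ℕ) :
    cosT (U0 b θ k) (U0 b θ (k + 1)) = cos (θ (k + 1) - θ k) := by
  unfold cosT
  rw [norm_U0 hb.le, norm_U0 hb.le]
  unfold U0
  have : (b : ℂ) * Ep (θ (k + 1)) * (starRingEnd ℂ) ((b : ℂ) * Ep (θ k)) =
      ((b * b : ℝ) : ℂ) * (Ep (θ (k + 1)) * (starRingEnd ℂ) (Ep (θ k))) := by
    rw [map_mul, Complex.conj_ofReal]; push_cast; ring
  rw [this, Complex.re_ofReal_mul, Ep_mul_conj_re]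
  field_simp

lemma third_U0 {b : ℝ} (hb : 0 < b) (θ : ℕ → ℝ) (k : ℕ) :
    ‖U0 b θ k + U0 b θ (k + 1) + U0 b θ (k + 2)‖ = b * Real.sqrt (3 + 2 * cos (θ (k + 1) - θ k) +
      2 * cos (θ (k + 2) - θ (k + 1)) + 2 * cos (θ (k + 2) - θ k)) := by
  unfold U0
  rw [← mul_add, ← mul_add, norm_mul, Complex.norm_real, Real.norm_eq_abs, abs_of_pos hb,
    Complex.norm_def]
  congr 2
  rw [Complex.normSq_apply]
  simp only [Complex.add_re, Complex.add_im, Ep]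
  rw [cos_sub, cos_sub, cos_sub]
  nlinarith [sin_sq_add_cos_sq (θ k), sin_sq_add_cos_sq (θ (k + 1)), sin_sq_add_cos_sq (θ (k + 2))]

lemma third_range {v₂ v₃ : ℝ → ℝ} (h : PotentialPair v₂ v₃) {b : ℝ} (hb : 0.99 ≤ b) (hb' : b ≤ 1.01)
    {θ : ℕ → ℝ} (h1 : ∀ k, |θ k| ≤ 1.55) (h2 : ∀ k, |θ (k + 1) - θ k| ≤ 0.002) (k : ℕ) :
    v₂ ‖U0 b θ k + U0 b θ (k + 1) + U0 b θ (k + 2)‖ ≤ v₂ 4 := by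
  have hb0 : 0 < b := lt_of_lt_of_le (by norm_num) hb
  have l := seg_norm hb h1 h2 k 3 (by norm_num)
  rw [Finset.sum_range_succ, Finset.sum_range_succ, Finset.sum_range_one, add_zero] at l
  have u : ‖U0 b θ k + U0 b θ (k + 1) + U0 b θ (k + 2)‖ ≤ 4 := by
    refine (norm_add₃_le).trans ?_
    rw [norm_U0 hb0.le, norm_U0 hb0.le, norm_U0 hb0.le]
    calc b + b + b ≤ 1.01 + 1.01 + 1.01 := by gcongr
      _ ≤ 4 := by norm_num
  refine h.v₂_mono.monotoneOn ?_ ?_ u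
  · simp only [Set.mem_Ici]; exact le_trans (by norm_num) l.le
  · simp only [Set.mem_Ici]; norm_num

lemma energy_theta {v₂ v₃ : ℝ → ℝ} (h : PotentialPair v₂ v₃) {b0 ψ p : ℝ} (hb : 0.99 ≤ b0) (hb' : b0 ≤ 1.01)
    (hp : 0 ≤ p) (hpe : p = v₂ (b0 * Real.sqrt (5 + 4 * cos ψ)) - v₂ (b0 * (1 + 2 * cos ψ)))
    (hψ : |ψ| ≤ 0.1)
    {θ : ℕ → ℝ} (h1 : ∀ k, |θ k| ≤ 1.55) (h2 : ∀ k, |θ (k + 1) - θ k| ≤ 0.002) (k0 : ℕ) (r : ℕ → ℝ)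
    (hr : ∀ k, 0 ≤ r k)
    (hτ : ∀ k, θ (k + 1) - θ k = ψ ∨ θ (k + 1) - θ k = -ψ ∨ (k = k0 ∧ θ (k + 1) - θ k = -(3 / 2 * ψ)))
    (hrr : ∀ k, k ≠ k0 → k + 1 ≠ k0 → θ (k + 2) - θ (k + 1) = θ (k + 1) - θ k ∨ r k = 1)
    (N : ℕ) (ρ ρ' : ℝ) (hρ' : 0 < ρ') (hρ1 : ρ' ≤ 1) :
    ECh v₂ v₃ ρ ρ' N (U0 b0 θ) ≤ (N + 1) * Ff v₂ v₃ ρ b0 b0 (cos ψ) +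
      ρ' * (N * v₂ (b0 * (1 + 2 * cos ψ)) + p * ∑ k ∈ Finset.range N, r k) +
      (|Ff v₂ v₃ ρ b0 b0 (cos (3 / 2 * ψ)) - Ff v₂ v₃ ρ b0 b0 (cos ψ)| + 2 * (|v₂ 4| + 1)) := by
  have hb0 : 0 < b0 := lt_of_lt_of_le (by norm_num) hb
  set e := Ff v₂ v₃ ρ b0 b0 (cos ψ)
  set G := |Ff v₂ v₃ ρ b0 b0 (cos (3 / 2 * ψ)) - e|
  set H := |v₂ 4| + 1
  set h0 := v₂ (b0 * (1 + 2 * cos ψ)) with hh0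
  have hcψ : 0.9 ≤ cos ψ := by
    have := one_sub_sq_div_two_le_cos (x := ψ)
    have h3 : ψ ^ 2 ≤ 0.01 := by
      rw [← sq_abs]
      calc |ψ| ^ 2 ≤ 0.1 ^ 2 := by gcongr
        _ = 0.01 := by norm_num
    norm_num at *; linarith
  have hh0' : -1 ≤ h0 := h.v₂_lb _ (by
    simp only [Set.mem_Ioi]; apply mul_pos hb0; norm_num at *; linarith)
  have hH : 0 ≤ H := by positivity
  have cell : ∀ k, Ff v₂ v₃ ρ ‖U0 b0 θ k‖ ‖U0 b0 θ (k + 1)‖ (cosT (U0 b0 θ k) (U0 b0 θ (k + 1))) ≤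
      e + (if k = k0 then G else 0) := by
    intro k
    rw [cosT_U0 hb0, norm_U0 hb0.le, norm_U0 hb0.le]
    have hG : 0 ≤ (if k = k0 then G else 0) := by split_ifs <;> positivity
    rcases hτ k with t | t | ⟨t0, t⟩
    · rw [t]; linarith
    · rw [t, cos_neg]; linarith
    · rw [t, cos_neg, if_pos t0]; linarith [le_abs_self (Ff v₂ v₃ ρ b0 b0 (cos (3 / 2 * ψ)) - e)]
  have third : ∀ k, v₂ ‖U0 b0 θ k + U0 b0 θ (k + 1) + U0 b0 θ (k + 2)‖ ≤
      h0 + p * r k + ((if k = k0 then H else 0) + (if k + 1 = k0 then H else 0)) := by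
    intro k
    have hp' : 0 ≤ p * r k := mul_nonneg hp (hr k)
    have gen : v₂ ‖U0 b0 θ k + U0 b0 θ (k + 1) + U0 b0 θ (k + 2)‖ ≤ h0 + H := by
      have := third_range h hb hb' h1 h2 k
      have := le_abs_self (v₂ 4)
      simp only [H]; linarith
    by_cases c1 : k = k0
    · rw [if_pos c1]; split_ifs <;> linarith
    by_cases c2 : k + 1 = k0
    · rw [if_neg c1, if_pos c2]; linarith
    rw [if_neg c1, if_neg c2, third_U0 hb0]
    have t1 : θ (k + 1) - θ k = ψ ∨ θ (k + 1) - θ k = -ψ := by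
      rcases hτ k with t | t | ⟨t0, t⟩
      exacts [Or.inl t, Or.inr t, absurd t0 c1]
    have t2 : θ (k + 2) - θ (k + 1) = ψ ∨ θ (k + 2) - θ (k + 1) = -ψ := by
      rcases hτ (k + 1) with t | t | ⟨t0, t⟩
      exacts [Or.inl t, Or.inr t, absurd t0 c2]
    have c1' : cos (θ (k + 1) - θ k) = cos ψ := by
      rcases t1 with t | t <;> rw [t]
      rw [cos_neg]
    have c2' : cos (θ (k + 2) - θ (k + 1)) = cos ψ := by
      rcases t2 with t | t <;> rw [t]
      rw [cos_neg]
    rw [c1', c2']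
    by_cases eqq : θ (k + 2) - θ (k + 1) = θ (k + 1) - θ k
    · have : cos (θ (k + 2) - θ k) = 2 * cos ψ ^ 2 - 1 := by
        rw [show θ (k + 2) - θ k = 2 * (θ (k + 1) - θ k) by linarith, cos_two_mul, c1']
      rw [this, show 3 + 2 * cos ψ + 2 * cos ψ + 2 * (2 * cos ψ ^ 2 - 1) = (1 + 2 * cos ψ) ^ 2 by ring,
        sqrt_sq (by norm_num at *; linarith)]
      linarith
    · have h3 : r k = 1 := (hrr k c1 c2).resolve_left eqq
      have : θ (k + 2) - θ k = 0 := by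
        rcases t1 with t | t <;> rcases t2 with t' | t'
        · exact absurd (t'.trans t.symm) eqq
        · linarith
        · linarith
        · exact absurd (t'.trans t.symm) eqq
      rw [this, cos_zero, show 3 + 2 * cos ψ + 2 * cos ψ + 2 * 1 = 5 + 4 * cos ψ by ring, h3]
      linarith
  have ind : ∀ (M : ℕ) (j : ℕ) (X : ℝ), 0 ≤ X → ∑ k ∈ Finset.range M, (if k = j then X else 0) ≤ X := by
    intro M j X hX
    rw [Finset.sum_ite_eq']; split_ifs <;> linarith
  have ind2 : ∀ (M : ℕ) (j : ℕ) (X : ℝ), 0 ≤ X → ∑ k ∈ Finset.range M, (if k + 1 = j then X else 0) ≤ X := by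
    intro M j X hX
    refine le_trans ?_ (ind M (j - 1) X hX)
    apply Finset.sum_le_sum
    intro k _
    by_cases hk : k + 1 = j
    · rw [if_pos hk, if_pos (by omega)]
    · rw [if_neg hk]; split_ifs <;> linarith
  unfold ECh
  have s1 := Finset.sum_le_sum (s := Finset.range (N + 1)) (fun k _ => cell k)
  have s2 := Finset.sum_le_sum (s := Finset.range N) (fun k _ => third k)
  rw [Finset.sum_add_distrib, Finset.sum_const, Finset.card_range, nsmul_eq_mul] at s1
  rw [Finset.sum_add_distrib, Finset.sum_add_distrib, Finset.sum_add_distrib, Finset.sum_const,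
    Finset.card_range, nsmul_eq_mul, ← Finset.mul_sum] at s2
  have i1 := ind (N + 1) k0 G (abs_nonneg _)
  have i2 := ind N k0 H hH
  have i3 := ind2 N k0 H hH
  push_cast at s1
  have s3 : ∑ k ∈ Finset.range N, v₂ ‖U0 b0 θ k + U0 b0 θ (k + 1) + U0 b0 θ (k + 2)‖ ≤
      N * h0 + p * ∑ k ∈ Finset.range N, r k + 2 * H := by linarith
  have s4 := mul_le_mul_of_nonneg_left s3 hρ'.le
  have : ρ' * (2 * H) ≤ 1 * (2 * H) := by gcongr
  linarith

/-- Directions of the periodic pattern with `m` turns of each sign. -/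
def th (ψ : ℝ) (m k : ℕ) : ℝ := (-1) ^ (k / m) * (((k % m : ℕ) : ℝ) - m / 2) * ψ

lemma th_turn (ψ : ℝ) {m : ℕ} (hm : 1 ≤ m) (k : ℕ) :
    th ψ m (k + 1) - th ψ m k = (-1) ^ (k / m) * ψ := by
  have hlt := Nat.mod_lt k hm
  have hk := Nat.div_add_mod k m
  unfold th
  by_cases hs : k % m + 1 = m
  · have e1 : k + 1 = m * (k / m + 1) := by rw [mul_add]; omega
    have e2 : (k + 1) / m = k / m + 1 := by
      rw [e1]; exact Nat.mul_div_cancel_left _ hm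
    have e3 : (k + 1) % m = 0 := by rw [e1]; exact Nat.mul_mod_right _ _
    have e4 : ((k % m : ℕ) : ℝ) = m - 1 := by
      have : ((k % m + 1 : ℕ) : ℝ) = m := by exact_mod_cast hs
      push_cast at this; linarith
    rw [e2, e3, e4, pow_succ]; push_cast; ring
  · have e1 : k + 1 = (k % m + 1) + m * (k / m) := by omega
    have hl : k % m + 1 < m := by omega
    have e2 : (k + 1) / m = k / m := by
      rw [e1, Nat.add_mul_div_left _ _ hm, Nat.div_eq_of_lt hl, zero_add]
    have e3 : (k + 1) % m = k % m + 1 := by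
      conv_lhs => rw [e1]
      rw [Nat.add_mul_mod_self_left, Nat.mod_eq_of_lt hl]
    rw [e2, e3]; push_cast; ring

lemma th_abs {ψ : ℝ} (hψ : 0 < ψ) {m : ℕ} (hm : 1 ≤ m) (k : ℕ) : |th ψ m k| ≤ m * ψ / 2 := by
  have hlt := Nat.mod_lt k hm
  have : ((k % m : ℕ) : ℝ) ≤ m := by exact_mod_cast hlt.le
  have h0 : (0 : ℝ) ≤ ((k % m : ℕ) : ℝ) := by positivity
  unfold th
  rw [abs_mul, abs_mul, abs_pow, abs_neg, abs_one, one_pow, one_mul, abs_of_pos hψ]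
  have : |((k % m : ℕ) : ℝ) - m / 2| ≤ m / 2 := by rw [abs_le]; constructor <;> linarith
  calc _ ≤ (m / 2 : ℝ) * ψ := by gcongr
    _ = _ := by ring

lemma cos_th (ψ : ℝ) (m k : ℕ) : cos (th ψ m k) = cos ((((k % m : ℕ) : ℝ) - m / 2) * ψ) := by
  unfold th
  rw [mul_assoc]
  rcases neg_one_pow_eq_or ℝ (k / m) with e | e <;> rw [e]
  · rw [one_mul]
  · rw [neg_one_mul, cos_neg]

lemma sum_cos_block {ψ : ℝ} (h0 : 0 < ψ) (h1 : ψ ≤ 1) (m : ℕ) :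
    ∑ i ∈ Finset.range m, cos (((i : ℝ) - m / 2) * ψ) = sin (m * (ψ / 2)) / tan (ψ / 2) := by
  have hpi := pi_gt_three
  have hs : 0 < sin (ψ / 2) := sin_pos_of_pos_of_lt_pi (by linarith) (by linarith)
  have hc : 0 < cos (ψ / 2) := cos_pos_of_mem_Ioo ⟨by linarith, by linarith⟩
  have key : ∀ n : ℕ, (∑ i ∈ Finset.range n, cos (((i : ℝ) - m / 2) * ψ)) * (2 * sin (ψ / 2)) =
      sin ((n - m / 2 - 1 / 2) * ψ) - sin ((- m / 2 - 1 / 2) * ψ) := by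
    intro n
    induction n with
    | zero => simp [neg_div]
    | succ n ih =>
      rw [Finset.sum_range_succ, add_mul, ih]
      push_cast
      have e1 : ((n : ℝ) + 1 - m / 2 - 1 / 2) * ψ = (n - m / 2) * ψ + ψ / 2 := by ring
      have e2 : ((n : ℝ) - m / 2 - 1 / 2) * ψ = (n - m / 2) * ψ - ψ / 2 := by ring
      rw [e1, e2, sin_add, sin_sub]; ring
  have k := key m
  have e1 : ((m : ℝ) - m / 2 - 1 / 2) * ψ = m * (ψ / 2) - ψ / 2 := by ring
  have e2 : (- (m : ℝ) / 2 - 1 / 2) * ψ = -(m * (ψ / 2) + ψ / 2) := by ring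
  rw [e1, e2, sin_neg, sin_add, sin_sub] at k
  rw [tan_eq_sin_div_cos, div_div_eq_mul_div, eq_div_iff hs.ne']
  linarith

lemma sum_block_ell {b0 ψ : ℝ} (h0 : 0 < ψ) (h1 : ψ ≤ 1) {m : ℕ} (hm : 1 ≤ m) :
    b0 * ∑ i ∈ Finset.range m, cos (((i : ℝ) - m / 2) * ψ) = m * ell b0 ψ m := by
  rw [sum_cos_block h0 h1]
  unfold ell
  have hm' : (m : ℝ) ≠ 0 := by
    have : (1 : ℝ) ≤ m := by exact_mod_cast hm
    positivity
  field_simp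

lemma sum_th_blocks (ψ : ℝ) {m : ℕ} (hm : 1 ≤ m) (q : ℕ) :
    ∑ k ∈ Finset.range (m * q), cos (th ψ m k) =
      q * ∑ i ∈ Finset.range m, cos (((i : ℝ) - m / 2) * ψ) := by
  induction q with
  | zero => simp
  | succ q ih =>
    rw [mul_add, mul_one, Finset.sum_range_add, ih]
    have : ∀ i ∈ Finset.range m, cos (th ψ m (m * q + i)) = cos (((i : ℝ) - m / 2) * ψ) := by
      intro i hi
      rw [cos_th, Nat.mul_add_mod, Nat.mod_eq_of_lt (Finset.mem_range.1 hi)]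
    rw [Finset.sum_congr rfl this]; push_cast; ring

lemma ell_bounds {b0 ψ : ℝ} (hb : 0 < b0) (h0 : 0 < ψ) (h1 : ψ ≤ 1) {m : ℕ} (hm : 1 ≤ m) (hmψ : m * ψ ≤ 3.1) :
    0 ≤ ell b0 ψ m ∧ ell b0 ψ m ≤ b0 := by
  have hm' : (1 : ℝ) ≤ m := by exact_mod_cast hm
  have e := sum_block_ell (b0 := b0) h0 h1 hm
  have l : 0 ≤ ∑ i ∈ Finset.range m, cos (((i : ℝ) - m / 2) * ψ) := by
    apply Finset.sum_nonneg
    intro i hi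
    have hi' : (i : ℝ) ≤ m := by exact_mod_cast (Finset.mem_range.1 hi).le
    have hi0 : (0 : ℝ) ≤ i := by positivity
    refine le_trans (by norm_num) (cos_155 (x := ((i : ℝ) - m / 2) * ψ) ?_)
    rw [abs_mul, abs_of_pos h0]
    have : |(i : ℝ) - m / 2| ≤ m / 2 := by rw [abs_le]; constructor <;> linarith
    calc _ ≤ (m / 2 : ℝ) * ψ := by gcongr
      _ = m * ψ / 2 := by ring
      _ ≤ 3.1 / 2 := by gcongr
      _ = _ := by norm_num
  have u : ∑ i ∈ Finset.range m, cos (((i : ℝ) - m / 2) * ψ) ≤ ∑ i ∈ Finset.range m, (1 : ℝ) :=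
    Finset.sum_le_sum (fun i _ => cos_le_one _)
  rw [Finset.sum_const, Finset.card_range, nsmul_eq_mul, mul_one] at u
  constructor
  · have : 0 ≤ (m : ℝ) * ell b0 ψ m := by rw [← e]; positivity
    by_contra hh; push Not at hh
    nlinarith
  · have : (m : ℝ) * ell b0 ψ m ≤ m * b0 := by
      rw [← e, mul_comm (m : ℝ)]; gcongr
    exact le_of_mul_le_mul_left this (by linarith)

lemma sum_th_ge {b0 ψ : ℝ} (hb : 0 < b0) (h0 : 0 < ψ) (h1 : ψ ≤ 1) {m : ℕ} (hm : 1 ≤ m) (hmψ : m * ψ ≤ 3.1) (L : ℕ) :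
    (L - m) * ell b0 ψ m ≤ b0 * ∑ k ∈ Finset.range L, cos (th ψ m k) := by
  obtain ⟨l1, l2⟩ := ell_bounds hb h0 h1 hm hmψ
  have hdm := Nat.div_add_mod L m
  have hlt := Nat.mod_lt L hm
  have : ∑ k ∈ Finset.range (m * (L / m)), cos (th ψ m k) ≤ ∑ k ∈ Finset.range L, cos (th ψ m k) := by
    apply Finset.sum_le_sum_of_subset_of_nonneg
    · intro x hx; simp only [Finset.mem_range] at *; omega
    · intro i _ _
      refine le_trans (by norm_num) (cos_155 ((th_abs h0 hm i).trans ?_))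
      calc m * ψ / 2 ≤ 3.1 / 2 := by gcongr
        _ = _ := by norm_num
  have h3 := mul_le_mul_of_nonneg_left this hb.le
  refine le_trans ?_ h3
  rw [sum_th_blocks _ hm, mul_left_comm, sum_block_ell h0 h1 hm, ← mul_assoc]
  apply mul_le_mul_of_nonneg_right _ l1
  have : (L : ℝ) ≤ m * (L / m : ℕ) + m := by
    have : L ≤ m * (L / m) + m := by omega
    exact_mod_cast this
  linarith

lemma count_dvd (m B : ℕ) : ∑ k ∈ Finset.range B, (if m ∣ k + 1 then (1 : ℝ) else 0) ≤ (B : ℝ) / m := by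
  rw [Finset.sum_boole]
  have : (Finset.filter (fun k => m ∣ k + 1) (Finset.range B)).card = B / m := by
    convert Nat.card_multiples B m
  rw [this]
  exact Nat.cast_div_le

/-- Directions of the mixed pattern. -/
def thMix (ψ : ℝ) (m K k : ℕ) : ℝ := if k < K then th ψ m k else th ψ (m + 1) (k - K)

/-- Reversal indicator of the mixed pattern. -/
def rMix (m K k : ℕ) : ℝ :=
  if k < K then (if m ∣ k + 1 then 1 else 0) else (if m + 1 ∣ k - K + 1 then 1 else 0)

lemma neg_one_pow_mul_or (ψ : ℝ) (j : ℕ) : (-1) ^ j * ψ = ψ ∨ (-1) ^ j * ψ = -ψ := by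
  rcases neg_one_pow_eq_or ℝ j with e | e <;> rw [e] <;> simp

lemma div_succ_or (m k : ℕ) : (k + 1) / m = k / m ∨ m ∣ k + 1 := by
  rw [Nat.succ_div]
  by_cases h : m ∣ k + 1
  · right; exact h
  · left; rw [if_neg h]; rfl

lemma th_even_end (ψ : ℝ) {m : ℕ} (hm : 1 ≤ m) (a k : ℕ) (hk : k + 1 = 2 * m * a) :
    th ψ m k = (1 - m / 2) * ψ := by
  have ha : 1 ≤ a := by
    rcases Nat.eq_zero_or_pos a with h | h
    · subst h; omega
    · exact h
  have t := th_turn ψ hm k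
  have e1 : (k + 1) / m = 2 * a := by
    rw [hk, mul_comm 2 m, mul_assoc]; exact Nat.mul_div_cancel_left _ hm
  have e2 : (k + 1) % m = 0 := by
    rw [hk, mul_comm 2 m, mul_assoc]; exact Nat.mul_mod_right _ _
  have e3 : k / m = 2 * (a - 1) + 1 := by
    have : k = (m - 1) + m * (2 * (a - 1) + 1) := by
      obtain ⟨c, rfl⟩ : ∃ c, a = c + 1 := ⟨a - 1, by omega⟩
      obtain ⟨d, rfl⟩ : ∃ d, m = d + 1 := ⟨m - 1, by omega⟩
      simp only [Nat.add_sub_cancel]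
      have : 2 * (d + 1) * (c + 1) = d + (d + 1) * (2 * c + 1) + 1 := by ring
      omega
    rw [this, Nat.add_mul_div_left _ _ hm, Nat.div_eq_of_lt (by omega), zero_add]
  rw [e3, pow_succ, pow_mul] at t
  have : th ψ m (k + 1) = (0 - m / 2) * ψ := by
    unfold th
    rw [e1, e2, pow_mul]; norm_num
  rw [this] at t
  norm_num at t
  linarith

lemma thMix_turn (ψ : ℝ) {m : ℕ} (hm : 1 ≤ m) (a k : ℕ) :
    (k + 1 < 2 * m * a → thMix ψ m (2 * m * a) (k + 1) - thMix ψ m (2 * m * a) k = (-1) ^ (k / m) * ψ) ∧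
    (k + 1 = 2 * m * a → thMix ψ m (2 * m * a) (k + 1) - thMix ψ m (2 * m * a) k = -(3 / 2 * ψ)) ∧
    (2 * m * a ≤ k → thMix ψ m (2 * m * a) (k + 1) - thMix ψ m (2 * m * a) k =
      (-1) ^ ((k - 2 * m * a) / (m + 1)) * ψ) := by
  refine ⟨fun h => ?_, fun h => ?_, fun h => ?_⟩
  · unfold thMix
    rw [if_pos h, if_pos (by omega), th_turn ψ hm]
  · unfold thMix
    rw [if_neg (by omega), if_pos (by omega), th_even_end ψ hm a k h, h, Nat.sub_self]
    unfold th
    simp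
    ring
  · unfold thMix
    rw [if_neg (by omega), if_neg (by omega), show k + 1 - 2 * m * a = (k - 2 * m * a) + 1 by omega,
      th_turn ψ (by omega)]

lemma mix_facts {ψ : ℝ} (h0 : 0 < ψ) (h1 : ψ ≤ 0.001) {m : ℕ} (hm : 1 ≤ m) (hmψ : (m + 1) * ψ ≤ 3.1) (a : ℕ) :
    (∀ k, |thMix ψ m (2 * m * a) k| ≤ 1.55) ∧
    (∀ k, |thMix ψ m (2 * m * a) (k + 1) - thMix ψ m (2 * m * a) k| ≤ 0.002) ∧
    (∀ k, thMix ψ m (2 * m * a) (k + 1) - thMix ψ m (2 * m * a) k = ψ ∨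
      thMix ψ m (2 * m * a) (k + 1) - thMix ψ m (2 * m * a) k = -ψ ∨
      (k = 2 * m * a - 1 ∧ thMix ψ m (2 * m * a) (k + 1) - thMix ψ m (2 * m * a) k = -(3 / 2 * ψ))) ∧
    (∀ k, k ≠ 2 * m * a - 1 → k + 1 ≠ 2 * m * a - 1 →
      thMix ψ m (2 * m * a) (k + 2) - thMix ψ m (2 * m * a) (k + 1) =
        thMix ψ m (2 * m * a) (k + 1) - thMix ψ m (2 * m * a) k ∨ rMix m (2 * m * a) k = 1) := by
  set K := 2 * m * a with hK
  have hT : ∀ k, thMix ψ m K (k + 1) - thMix ψ m K k = ψ ∨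
      thMix ψ m K (k + 1) - thMix ψ m K k = -ψ ∨
      (k = K - 1 ∧ thMix ψ m K (k + 1) - thMix ψ m K k = -(3 / 2 * ψ)) := by
    intro k
    obtain ⟨t1, t2, t3⟩ := thMix_turn ψ hm a k
    rcases lt_trichotomy (k + 1) K with h | h | h
    · rw [t1 h]
      rcases neg_one_pow_mul_or ψ (k / m) with e | e <;> rw [e] <;> simp
    · right; right; exact ⟨by omega, t2 h⟩
    · rw [t3 (by omega)]
      rcases neg_one_pow_mul_or ψ ((k - 2 * m * a) / (m + 1)) with e | e <;> rw [e] <;> simp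
  refine ⟨fun k => ?_, fun k => ?_, hT, fun k c1 c2 => ?_⟩
  · have e : (3.1 : ℝ) / 2 = 1.55 := by norm_num
    unfold thMix
    split_ifs
    · refine (th_abs h0 hm k).trans ?_
      rw [← e]
      have : (m : ℝ) * ψ ≤ (m + 1) * ψ := by gcongr; linarith
      linarith
    · refine (th_abs h0 (by omega) _).trans ?_
      rw [← e]; push_cast; linarith
  · have e : (0.002 : ℝ) = 2 * 0.001 := by norm_num
    rw [e]
    rcases hT k with t | t | ⟨_, t⟩ <;> rw [t, abs_le] <;> constructor <;> linarith
  · rcases lt_or_ge (k + 2) K with h | h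
    · rw [(thMix_turn ψ hm a k).1 (by omega), (thMix_turn ψ hm a (k + 1)).1 (by omega)]
      rcases div_succ_or m k with d | d
      · left; rw [d]
      · right; unfold rMix; rw [if_pos (by omega), if_pos d]
    · have hk : K ≤ k := by
        rcases Nat.eq_zero_or_pos K with h' | h' <;> omega
      rw [(thMix_turn ψ hm a k).2.2 hk, (thMix_turn ψ hm a (k + 1)).2.2 (by omega)]
      rw [show k + 1 - 2 * m * a = (k - 2 * m * a) + 1 by omega]
      rcases div_succ_or (m + 1) (k - 2 * m * a) with d | d
      · left; rw [d]
      · right; unfold rMix; rw [if_neg (by omega), if_pos d]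

lemma mix_length {b0 ψ : ℝ} (hb : 0 < b0) (h0 : 0 < ψ) (h1 : ψ ≤ 1) {m : ℕ} (hm : 1 ≤ m)
    (hmψ : (m + 1) * ψ ≤ 3.1) (a B : ℕ) (hB : 2 * m * a ≤ B) :
    ((2 * m * a : ℕ) : ℝ) * ell b0 ψ m + ((B : ℝ) - (2 * m * a : ℕ)) * ell b0 ψ (m + 1) -
      (m + 1) * ell b0 ψ (m + 1) ≤ ‖∑ k ∈ Finset.range B, U0 b0 (thMix ψ m (2 * m * a)) k‖ := by
  refine le_trans ?_ (Complex.re_le_norm _)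
  rw [Complex.re_sum]
  simp only [U0_re]
  rw [← Finset.mul_sum]
  set K := 2 * m * a with hK
  obtain ⟨L, rfl⟩ : ∃ L, B = K + L := ⟨B - K, by omega⟩
  rw [Finset.sum_range_add]
  have s1 : ∑ k ∈ Finset.range K, cos (thMix ψ m K k) = ∑ k ∈ Finset.range K, cos (th ψ m k) := by
    apply Finset.sum_congr rfl
    intro k hk
    unfold thMix; rw [if_pos (Finset.mem_range.1 hk)]
  have s2 : ∑ k ∈ Finset.range L, cos (thMix ψ m K (K + k)) = ∑ k ∈ Finset.range L, cos (th ψ (m + 1) k) := by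
    apply Finset.sum_congr rfl
    intro k hk
    unfold thMix; rw [if_neg (by omega), Nat.add_sub_cancel_left]
  have s3 := sum_th_blocks ψ hm (2 * a)
  rw [show m * (2 * a) = K by rw [hK]; ring] at s3
  rw [s1, s2, mul_add, s3, mul_left_comm, sum_block_ell h0 h1 hm]
  have s4 := sum_th_ge (b0 := b0) hb h0 h1 (m := m + 1) (by omega) (by push_cast; exact hmψ) L
  have s5 : ((2 * a : ℕ) : ℝ) * (m * ell b0 ψ m) = (K : ℝ) * ell b0 ψ m := by rw [hK]; push_cast; ring
  rw [s5]
  push_cast at s4 ⊢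
  linarith

lemma mix_count {m : ℕ} (K B N : ℕ) (hB : K ≤ B) (hN : N ≤ B) :
    ∑ k ∈ Finset.range N, rMix m K k ≤ (K : ℝ) / m + ((B : ℝ) - K) / (m + 1) := by
  have hr : ∀ k, 0 ≤ rMix m K k := by
    intro k; unfold rMix; split_ifs <;> norm_num
  have : ∑ k ∈ Finset.range N, rMix m K k ≤ ∑ k ∈ Finset.range B, rMix m K k := by
    apply Finset.sum_le_sum_of_subset_of_nonneg
    · intro x hx; simp only [Finset.mem_range] at *; omega
    · intro i _ _; exact hr i
  refine this.trans ?_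
  obtain ⟨L, rfl⟩ : ∃ L, B = K + L := ⟨B - K, by omega⟩
  rw [Finset.sum_range_add]
  have s1 : ∑ k ∈ Finset.range K, rMix m K k = ∑ k ∈ Finset.range K, (if m ∣ k + 1 then (1 : ℝ) else 0) := by
    apply Finset.sum_congr rfl
    intro k hk
    unfold rMix; rw [if_pos (Finset.mem_range.1 hk)]
  have s2 : ∑ k ∈ Finset.range L, rMix m K (K + k) =
      ∑ k ∈ Finset.range L, (if m + 1 ∣ k + 1 then (1 : ℝ) else 0) := by
    apply Finset.sum_congr rfl
    intro k hk
    unfold rMix; rw [if_neg (by omega), Nat.add_sub_cancel_left]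
  have c1 := count_dvd m K
  have c2 := count_dvd (m + 1) L
  rw [s1, s2]
  push_cast at c2 ⊢
  rw [add_sub_cancel_left]
  linarith

lemma supline_strictMono {s : Finset ℕ} (hs : s.Nonempty) {q A : ℕ → ℝ} (hq : ∀ m ∈ s, 0 < q m) :
    StrictMono (fun x : ℝ => s.sup' hs (fun m => q m * x - A m)) := by
  intro x y hxy
  simp only
  rw [Finset.sup'_lt_iff]
  intro m hm
  refine lt_of_lt_of_le ?_ (Finset.le_sup' (fun m => q m * y - A m) hm)
  have := mul_lt_mul_of_pos_left hxy (hq m hm)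
  linarith

lemma supline_convex {s : Finset ℕ} (hs : s.Nonempty) {q A : ℕ → ℝ} {t : Set ℝ} (ht : Convex ℝ t) :
    ConvexOn ℝ t (fun x : ℝ => s.sup' hs (fun m => q m * x - A m)) := by
  refine ⟨ht, ?_⟩
  intro x _ y _ a b ha hb hab
  simp only [smul_eq_mul]
  apply Finset.sup'_le
  intro m hm
  have h1 := mul_le_mul_of_nonneg_left (Finset.le_sup' (fun m => q m * x - A m) hm) ha
  have h2 := mul_le_mul_of_nonneg_left (Finset.le_sup' (fun m => q m * y - A m) hm) hb
  have : q m * (a * x + b * y) - A m = a * (q m * x - A m) + b * (q m * y - A m) := by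
    linear_combination A m * hab
  rw [this]; linarith

lemma supline_piecewise {s : Finset ℕ} (hs : s.Nonempty) {q A : ℕ → ℝ} (t : Set ℝ) :
    PiecewiseAffOn (fun x : ℝ => s.sup' hs (fun m => q m * x - A m)) t := by
  refine ⟨(s ×ˢ s).image (fun ij => (A ij.1 - A ij.2) / (q ij.1 - q ij.2)), ?_⟩
  intro a b _ _ hab hP
  rcases hab.eq_or_lt with rfl | hlt
  · refine ⟨0, s.sup' hs (fun m => q m * a - A m), ?_⟩
    rintro x ⟨hx, -⟩
    have : x = a := le_antisymm hx.2 hx.1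
    rw [this]; simp
  obtain ⟨m, hm, hmc⟩ := Finset.exists_mem_eq_sup' hs (fun m => q m * ((a + b) / 2) - A m)
  refine ⟨q m, - A m, ?_⟩
  rintro x ⟨hx, -⟩
  simp only
  apply le_antisymm
  · apply Finset.sup'_le
    intro j hj
    by_contra hcon
    push Not at hcon
    have hc : q j * ((a + b) / 2) - A j ≤ q m * ((a + b) / 2) - A m := by
      rw [← hmc]; exact Finset.le_sup' (fun m => q m * ((a + b) / 2) - A m) hj
    have hz := hP ((A j - A m) / (q j - q m))
      (Finset.mem_image.2 ⟨(j, m), Finset.mem_product.2 ⟨hj, hm⟩, rfl⟩)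
    apply hz
    rcases lt_trichotomy (q j) (q m) with hq | hq | hq
    · have hd : 0 < q m - q j := by linarith
      rw [← neg_div_neg_eq, neg_sub, neg_sub]
      constructor
      · rw [lt_div_iff₀ hd]
        have : a * (q m - q j) ≤ x * (q m - q j) := by gcongr; exact hx.1
        linarith
      · rw [div_lt_iff₀ hd]
        have : (a + b) / 2 * (q m - q j) < b * (q m - q j) := by gcongr; linarith
        linarith
    · rw [hq] at hc hcon; linarith
    · have hd : 0 < q j - q m := by linarith
      constructor
      · rw [lt_div_iff₀ hd]
        have : a * (q j - q m) < (a + b) / 2 * (q j - q m) := by gcongr; linarith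
        linarith
      · rw [div_lt_iff₀ hd]
        have : x * (q j - q m) ≤ b * (q j - q m) := by gcongr; exact hx.2
        linarith
  · have := Finset.le_sup' (fun m => q m * x - A m) hm
    linarith

/-- Admissible pattern periods. -/
def Ms (ψ : ℝ) : Finset ℕ :=
  (Finset.range (⌊3.1 / ψ⌋₊ + 1)).filter (fun m => 1 ≤ m ∧ ((m : ℝ) + 1) * ψ ≤ 3.1)

lemma mem_Ms {ψ : ℝ} (h0 : 0 < ψ) {m : ℕ} : m ∈ Ms ψ ↔ 1 ≤ m ∧ ((m : ℝ) + 1) * ψ ≤ 3.1 := by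
  unfold Ms
  rw [Finset.mem_filter, Finset.mem_range]
  refine ⟨fun h => h.2, fun h => ⟨?_, h⟩⟩
  apply Nat.lt_succ_of_le
  apply Nat.le_floor
  rw [le_div_iff₀ h0]
  linarith [h.2]

lemma Ms_nonempty {ψ : ℝ} (h0 : 0 < ψ) (h1 : ψ ≤ 1) : (Ms ψ).Nonempty :=
  ⟨1, (mem_Ms h0).2 ⟨le_refl _, by norm_num; linarith⟩⟩

lemma p_pos {v₂ v₃ : ℝ → ℝ} (h : PotentialPair v₂ v₃) {b0 ψ : ℝ} (hb : 0.99 ≤ b0) (h0 : 0 < ψ) (h1 : ψ ≤ 0.1) :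
    0 < v₂ (b0 * Real.sqrt (5 + 4 * cos ψ)) - v₂ (b0 * (1 + 2 * cos ψ)) := by
  have hpi := pi_gt_three
  have hb0 : 0 < b0 := lt_of_lt_of_le (by norm_num) hb
  have hc1 : cos ψ < 1 := by
    have := cos_lt_cos_of_nonneg_of_le_pi (le_refl 0) (y := ψ) (by norm_num at *; linarith) h0
    rwa [cos_zero] at this
  have hc : 0.9 ≤ cos ψ := by
    have := one_sub_sq_div_two_le_cos (x := ψ)
    have h3 : ψ ^ 2 ≤ 0.01 := by
      calc ψ ^ 2 ≤ 0.1 ^ 2 := by gcongr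
        _ = 0.01 := by norm_num
    norm_num at *; linarith
  have k1 : 1 + 2 * cos ψ < Real.sqrt (5 + 4 * cos ψ) := by
    apply lt_sqrt_of_sq_lt
    norm_num at *
    nlinarith
  have k2 : 1 ≤ b0 * (1 + 2 * cos ψ) := by
    calc (1 : ℝ) ≤ 0.99 * (1 + 2 * 0.9) := by norm_num
      _ ≤ _ := by gcongr
  have k3 : b0 * (1 + 2 * cos ψ) < b0 * Real.sqrt (5 + 4 * cos ψ) := by gcongr
  have := h.v₂_mono (by exact k2) (by simp only [Set.mem_Ici]; linarith) k3
  linarith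

lemma straight_chain {v₂ v₃ : ℝ → ℝ} (h : PotentialPair v₂ v₃) {b : ℝ} (hb : 0.99 ≤ b) (hb' : b ≤ 1.01)
    (N : ℕ) {μ : ℝ} (hμ : 0 ≤ μ) (hμb : μ ≤ b) (ρ ρ' : ℝ) :
    ∃ y : ℕ → ℂ, Admissible (N + 3) y ∧ BC (N + 3) μ y ∧
      Egen v₂ v₃ ρ ρ' (N + 3) y = (N + 1) * Ff v₂ v₃ ρ b b 1 + ρ' * (N * v₂ (3 * b)) := by
  have hb0 : 0 < b := lt_of_lt_of_le (by norm_num) hb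
  have e0 : ∀ k, U0 b (fun _ => 0) k = (b : ℂ) := by
    intro k; unfold U0
    have : Ep 0 = 1 := by apply Complex.ext <;> simp [Ep]
    rw [this, mul_one]
  obtain ⟨y, y1, y2, y3⟩ := conf_of_theta h hb hb' (θ := fun _ => 0) (fun k => by norm_num)
    (fun k => by norm_num) N hμ (by
      simp only [e0]
      rw [Finset.sum_const, Finset.card_range, nsmul_eq_mul, norm_mul, Complex.norm_real,
        Real.norm_eq_abs, abs_of_pos hb0, Complex.norm_natCast]
      push_cast
      gcongr) ρ ρ'
  refine ⟨y, y1, y2, ?_⟩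
  rw [y3]
  unfold ECh
  have c : ∀ k, cosT (U0 b (fun _ => 0) k) (U0 b (fun _ => 0) (k + 1)) = 1 := by
    intro k; rw [cosT_U0 hb0]; simp
  have t : ∀ k, ‖U0 b (fun _ => 0) k + U0 b (fun _ => 0) (k + 1) + U0 b (fun _ => 0) (k + 2)‖ = 3 * b := by
    intro k
    simp only [e0]
    rw [show (b : ℂ) + b + b = ((3 * b : ℝ) : ℂ) by push_cast; ring, Complex.norm_real,
      Real.norm_eq_abs, abs_of_pos (by positivity)]
  simp only [c, t, norm_U0 hb0.le]
  simp only [Finset.sum_const, Finset.card_range, nsmul_eq_mul]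
  push_cast; ring

/-- The range energy. -/
def er (b0 ψ p : ℝ) (hne : (Ms ψ).Nonempty) (x : ℝ) : ℝ :=
  (Ms ψ).sup' hne (fun m => qm b0 ψ p m * x - Am b0 ψ p m)

lemma mix_exists {b0 ψ p : ℝ} (hb : 0.99 ≤ b0) (hb' : b0 ≤ 1.01) (h0 : 0 < ψ) (h1 : ψ ≤ 0.001) (hp : 0 < p)
    {ν : ℝ} (hν1 : 2 / 3 ≤ ν) (hν2 : ν ≤ ell b0 ψ 1) (N : ℕ) :
    ∃ m a : ℕ, 1 ≤ m ∧ ((m : ℝ) + 1) * ψ ≤ 3.1 ∧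
      ((N : ℝ) + 2) * ν - 10 / ψ ≤ ‖∑ k ∈ Finset.range (N + 2), U0 b0 (thMix ψ m (2 * m * a)) k‖ ∧
      p * ∑ k ∈ Finset.range N, rMix m (2 * m * a) k ≤ (N + 2) * (qm b0 ψ p m * ν - Am b0 ψ p m) := by
  have hb0 : 0 < b0 := lt_of_lt_of_le (by norm_num) hb
  have h1' : ψ ≤ 1 := h1.trans (by norm_num)
  obtain ⟨m, hm, hmψ, hl, hu⟩ := exists_pattern hb0 hb' h0 (h1.trans (by norm_num)) hν1 hν2
  have hm' : (1 : ℝ) ≤ m := by exact_mod_cast hm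
  have hν : ν ∈ segment ℝ (ell b0 ψ (m + 1)) (ell b0 ψ m) := by
    rw [segment_eq_Icc (hl.trans hu)]; exact ⟨hl, hu⟩
  obtain ⟨s, t, hs, ht, hst, e⟩ := hν
  simp only [smul_eq_mul] at e
  obtain ⟨hq, -, L1, L2⟩ := line_props hb0 h0 hp hm hmψ
  have hmψ' : (m : ℝ) * ψ ≤ 3.1 := by
    refine le_trans ?_ hmψ; gcongr; linarith
  obtain ⟨x1, x2⟩ := ell_bounds hb0 h0 h1' hm hmψ'
  obtain ⟨y1, y2⟩ := ell_bounds hb0 h0 h1' (m := m + 1) (by omega) (by push_cast; exact hmψ)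
  set B : ℝ := (N : ℝ) + 2 with hB
  have hBp : 0 < B := by positivity
  set a := ⌊t * B / (2 * m)⌋₊ with ha
  have a1 : (a : ℝ) ≤ t * B / (2 * m) := Nat.floor_le (by positivity)
  have a2 : t * B / (2 * m) < a + 1 := Nat.lt_floor_add_one _
  rw [le_div_iff₀ (by positivity)] at a1
  rw [div_lt_iff₀ (by positivity)] at a2
  set K := 2 * m * a with hK
  have hKr : (K : ℝ) = 2 * m * a := by rw [hK]; push_cast; ring
  have k1 : (K : ℝ) ≤ t * B := by rw [hKr]; linarith
  have k2 : t * B - K ≤ 2 * m := by rw [hKr]; linarith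
  have k3 : K ≤ N + 2 := by
    have : (K : ℝ) ≤ ((N + 2 : ℕ) : ℝ) := by
      push_cast
      refine k1.trans ?_
      have : t * B ≤ 1 * B := by gcongr; linarith
      linarith
    exact_mod_cast this
  refine ⟨m, a, hm, hmψ, ?_, ?_⟩
  · have l := mix_length hb0 h0 h1' hm hmψ a (N + 2) k3
    refine le_trans ?_ l
    rw [← hK]
    push_cast
    rw [← hB, ← e]
    have mb : (m + 1 : ℝ) ≤ 3.1 / ψ := by rw [le_div_iff₀ h0]; exact hmψ
    have f1 : (t * B - K) * (ell b0 ψ m - ell b0 ψ (m + 1)) ≤ 2 * m * 1.01 := by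
      apply mul_le_mul k2 _ (by linarith) (by positivity)
      linarith
    have f2 : (m + 1 : ℝ) * ell b0 ψ (m + 1) ≤ (m + 1) * 1.01 := by
      gcongr; linarith
    have f3 : 2 * (m : ℝ) * 1.01 + (m + 1) * 1.01 ≤ 10 / ψ := by
      have : (10 : ℝ) / ψ = (3.1 / ψ) * (10 / 3.1) := by field_simp
      rw [this]
      calc 2 * (m : ℝ) * 1.01 + (m + 1) * 1.01 ≤ (m + 1) * (10 / 3.1) := by
            norm_num; linarith
        _ ≤ _ := by gcongr
    have hs' : s = 1 - t := by linarith
    rw [hs']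
    nlinarith
  · have c := mix_count (m := m) K (N + 2) N k3 (by omega)
    push_cast at c
    rw [← hB] at c
    have c' := mul_le_mul_of_nonneg_left c hp.le
    refine c'.trans ?_
    have d : (1 : ℝ) / (m + 1) ≤ 1 / m := by gcongr; linarith
    have e1 : qm b0 ψ p m * ν - Am b0 ψ p m = s * (p / (m + 1)) + t * (p / m) := by
      rw [← L1, ← L2, ← e]
      linear_combination Am b0 ψ p m * hst
    rw [e1]
    have : (t * B - K) * (1 / (m : ℝ) - 1 / (m + 1)) ≥ 0 := mul_nonneg (by linarith) (by linarith)
    have h3 := mul_nonneg hp.le this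
    have hs' : s = 1 - t := by linarith
    rw [hs']
    have g : B * ((1 - t) * (p / (m + 1)) + t * (p / m)) - p * (K / m + (B - K) / (m + 1)) =
        p * ((t * B - K) * (1 / (m : ℝ) - 1 / (m + 1))) := by ring
    linarith

lemma upper_psi {v₂ v₃ : ℝ → ℝ} (h : PotentialPair v₂ v₃) {b0 ψ p m₂ : ℝ} (hb : 0.99 ≤ b0) (hb' : b0 ≤ 1.01)
    (h0 : 0 < ψ) (h1 : ψ ≤ 0.001) (hp : 0 < p)
    (hpe : p = v₂ (b0 * Real.sqrt (5 + 4 * cos ψ)) - v₂ (b0 * (1 + 2 * cos ψ)))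
    (hne : (Ms ψ).Nonempty) (hm₂ : m₂ < ell b0 ψ 1) (hm₂' : m₂ ≤ 1) (ρ : ℝ) :
    ∃ C ≥ 0, ∀ ρ', 0 < ρ' → ρ' ≤ 1 → ∀ (N : ℕ) (μ : ℝ), 2 / 3 ≤ μ → μ ≤ m₂ →
      ∃ y : ℕ → ℂ, Admissible (N + 3) y ∧ BC (N + 3) μ y ∧
        Egen v₂ v₃ ρ ρ' (N + 3) y ≤ (N + 1) * (Ff v₂ v₃ ρ b0 b0 (cos ψ) +
          ρ' * (v₂ (b0 * (1 + 2 * cos ψ)) + er b0 ψ p hne μ)) + C := by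
  have hb0 : 0 < b0 := lt_of_lt_of_le (by norm_num) hb
  have hqpos : ∀ m ∈ Ms ψ, 0 < qm b0 ψ p m := by
    intro m hm
    obtain ⟨a1, a2⟩ := (mem_Ms h0).1 hm
    exact (line_props hb0 h0 hp a1 a2).1
  have hmono : StrictMono (er b0 ψ p hne) := supline_strictMono hne hqpos
  have hcψ : 0.9 ≤ cos ψ := by
    have := one_sub_sq_div_two_le_cos (x := ψ)
    have h3 : ψ ^ 2 ≤ 0.001 ^ 2 := by gcongr
    norm_num at *; linarith
  set e := Ff v₂ v₃ ρ b0 b0 (cos ψ) with he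
  set hh := v₂ (b0 * (1 + 2 * cos ψ)) with hhdef
  have hh1 : -1 ≤ hh := h.v₂_lb _ (by
    simp only [Set.mem_Ioi]; apply mul_pos hb0; norm_num at *; linarith)
  set C1 := |Ff v₂ v₃ ρ b0 b0 (cos (3 / 2 * ψ)) - Ff v₂ v₃ ρ b0 b0 (cos ψ)| + 2 * (|v₂ 4| + 1)
  have hC1 : 0 ≤ C1 := by positivity
  set D := |er b0 ψ p hne (2 / 3)| + |er b0 ψ p hne m₂| with hD
  have hD0 : 0 ≤ D := by positivity
  have hDb : ∀ μ, 2 / 3 ≤ μ → μ ≤ m₂ → |er b0 ψ p hne μ| ≤ D := by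
    intro μ u1 u2
    have a1 := hmono.monotone u1
    have a2 := hmono.monotone u2
    have := neg_abs_le (er b0 ψ p hne (2 / 3))
    have := le_abs_self (er b0 ψ p hne m₂)
    have := abs_nonneg (er b0 ψ p hne (2 / 3))
    have := abs_nonneg (er b0 ψ p hne m₂)
    rw [abs_le]; constructor <;> linarith
  set Q := ∑ m ∈ Ms ψ, qm b0 ψ p m with hQ
  have hQb : ∀ m ∈ Ms ψ, qm b0 ψ p m ≤ Q := fun m hm =>
    Finset.single_le_sum (f := fun m => qm b0 ψ p m) (fun i hi => (hqpos i hi).le) hm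
  have hQ0 : 0 ≤ Q := Finset.sum_nonneg (fun i hi => (hqpos i hi).le)
  set Cd := 10 / ψ with hCd
  have hCd0 : 0 < Cd := by positivity
  set gap := ell b0 ψ 1 - m₂ with hgap
  have hgap0 : 0 < gap := by linarith
  set n0 := Cd / gap with hn0
  have hn00 : 0 < n0 := by positivity
  set X := |Ff v₂ v₃ ρ 1 1 1| + |e| + |v₂ (3 * 1)| + |hh| + D with hX
  have hX0 : 0 ≤ X := by positivity
  refine ⟨C1 + (D + Q * Cd + 1) + n0 * X, by positivity, ?_⟩
  intro ρ' hρ hρ1 N μ hμ1 hμ2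
  have her := abs_le.1 (hDb μ hμ1 hμ2)
  by_cases hlarge : n0 ≤ (N : ℝ) + 2
  · set ν := μ + Cd / (N + 2) with hν
    have hB : (0 : ℝ) < (N : ℝ) + 2 := by positivity
    have hν1 : 2 / 3 ≤ ν := by
      have : 0 ≤ Cd / ((N : ℝ) + 2) := by positivity
      linarith
    have hν2 : ν ≤ ell b0 ψ 1 := by
      have : Cd / ((N : ℝ) + 2) ≤ gap := by
        rw [div_le_iff₀ hB]
        rw [hn0, div_le_iff₀ hgap0] at hlarge
        linarith
      linarith
    have hBν : ((N : ℝ) + 2) * ν = (N + 2) * μ + Cd := by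
      rw [hν]; field_simp
    obtain ⟨m, a, hm, hmψ, hlen, hcnt⟩ := mix_exists hb hb' h0 h1 hp hν1 hν2 N
    have hmem : m ∈ Ms ψ := (mem_Ms h0).2 ⟨hm, hmψ⟩
    obtain ⟨f1, f2, f3, f4⟩ := mix_facts h0 h1 hm hmψ a
    obtain ⟨y, y1, y2, y3⟩ := conf_of_theta h hb hb' f1 f2 N (μ := μ) (by linarith)
      (le_trans (by linarith) hlen) ρ ρ'
    refine ⟨y, y1, y2, ?_⟩
    rw [y3]
    have en := energy_theta h hb hb' hp.le hpe
      (by rw [abs_of_pos h0]; exact h1.trans (by norm_num)) f1 f2 (2 * m * a - 1) (rMix m (2 * m * a))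
      (fun k => by unfold rMix; split_ifs <;> norm_num) f3 f4 N ρ ρ' hρ hρ1
    refine en.trans ?_
    have l1 : qm b0 ψ p m * μ - Am b0 ψ p m ≤ er b0 ψ p hne μ :=
      Finset.le_sup' (fun m => qm b0 ψ p m * μ - Am b0 ψ p m) hmem
    have l2 : ((N : ℝ) + 2) * (qm b0 ψ p m * ν - Am b0 ψ p m) =
        (N + 2) * (qm b0 ψ p m * μ - Am b0 ψ p m) + qm b0 ψ p m * Cd := by
      linear_combination qm b0 ψ p m * hBν
    have l3 := mul_le_mul_of_nonneg_left l1 hB.le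
    have l4 := mul_le_mul_of_nonneg_right (hQb m hmem) hCd0.le
    have l5 : (N : ℝ) * hh + p * ∑ k ∈ Finset.range N, rMix m (2 * m * a) k ≤
        (N + 1) * (hh + er b0 ψ p hne μ) + (D + Q * Cd + 1) := by
      linarith
    have l6 := mul_le_mul_of_nonneg_left l5 hρ.le
    have l7 : ρ' * (D + Q * Cd + 1) ≤ 1 * (D + Q * Cd + 1) := by gcongr
    have l8 : 0 ≤ n0 * X := by positivity
    linarith
  · push Not at hlarge
    obtain ⟨y, y1, y2, y3⟩ := straight_chain h (b := 1) (by norm_num) (by norm_num) N (μ := μ)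
      (by linarith) (by linarith) ρ ρ'
    refine ⟨y, y1, y2, ?_⟩
    rw [y3]
    have g1 := le_abs_self (Ff v₂ v₃ ρ 1 1 1)
    have g2 := neg_abs_le e
    have g3 := le_abs_self (v₂ (3 * 1))
    have g4 := neg_abs_le hh
    have hN0 : (0 : ℝ) ≤ N := by positivity
    have i1 : ρ' * (N * v₂ (3 * 1)) ≤ (N + 1) * |v₂ (3 * 1)| := by
      calc ρ' * (N * v₂ (3 * 1)) ≤ ρ' * (N * |v₂ (3 * 1)|) := by gcongr
        _ ≤ 1 * ((N + 1) * |v₂ (3 * 1)|) := by gcongr; linarith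
        _ = _ := by ring
    have i2 : ρ' * (-(hh + er b0 ψ p hne μ)) ≤ |hh| + D := by
      calc ρ' * (-(hh + er b0 ψ p hne μ)) ≤ ρ' * (|hh| + D) := by gcongr; linarith
        _ ≤ 1 * (|hh| + D) := by gcongr
        _ = _ := by ring
    have i3 : ((N : ℝ) + 1) * X ≤ n0 * X := by gcongr; linarith
    have i4 : ((N : ℝ) + 1) * (Ff v₂ v₃ ρ 1 1 1 + |v₂ (3 * 1)| - (e + ρ' * (hh + er b0 ψ p hne μ))) ≤
        (N + 1) * X := by
      gcongr; linarith
    have : 0 ≤ Q * Cd := by positivity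
    linarith

lemma emin_bound {v₂ v₃ : ℝ → ℝ} {ρ ρ' μ E C C' : ℝ} {N : ℕ} (hC : 0 ≤ C) (hC' : 0 ≤ C')
    (hlow : ∀ y : ℕ → ℂ, Admissible (N + 3) y → BC (N + 3) μ y →
      (N + 1) * E - C - C * ρ' ^ 2 * (N + 1) ≤ Egen v₂ v₃ ρ ρ' (N + 3) y)
    (hup : ∃ y : ℕ → ℂ, Admissible (N + 3) y ∧ BC (N + 3) μ y ∧
      Egen v₂ v₃ ρ ρ' (N + 3) y ≤ (N + 1) * E + C') :
    |E - Emin v₂ v₃ ρ ρ' μ (N + 3)| ≤ 3 * (C + C') * (ρ' ^ 2 + 1 / ((N + 3 : ℕ) : ℝ)) := by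
  unfold Emin
  set S := {E : ℝ | ∃ y : ℕ → ℂ, Admissible (N + 3) y ∧ BC (N + 3) μ y ∧ E = Egen v₂ v₃ ρ ρ' (N + 3) y}
  have hb : ∀ x ∈ S, (N + 1) * E - C - C * ρ' ^ 2 * (N + 1) ≤ x := by
    rintro x ⟨y, y1, y2, rfl⟩
    exact hlow y y1 y2
  obtain ⟨y, y1, y2, y3⟩ := hup
  have hmem : Egen v₂ v₃ ρ ρ' (N + 3) y ∈ S := ⟨y, y1, y2, rfl⟩
  have l : (N + 1) * E - C - C * ρ' ^ 2 * (N + 1) ≤ sInf S := le_csInf ⟨_, hmem⟩ hb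
  have u : sInf S ≤ (N + 1) * E + C' := (csInf_le ⟨_, hb⟩ hmem).trans y3
  have hN : (0 : ℝ) ≤ N := by positivity
  push_cast
  rw [show (N : ℝ) + 3 - 2 = N + 1 by ring]
  have hn : (0 : ℝ) < (N : ℝ) + 1 := by positivity
  have e : E - sInf S / (N + 1) = ((N + 1) * E - sInf S) / (N + 1) := by field_simp
  rw [e, abs_div, abs_of_pos hn, div_le_iff₀ hn]
  have k : |(N + 1) * E - sInf S| ≤ C + C' + (C + C') * ρ' ^ 2 * (N + 1) := by
    have a1 : 0 ≤ C' * ρ' ^ 2 * (N + 1) := by positivity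
    have a2 : 0 ≤ C * ρ' ^ 2 * (N + 1) := by positivity
    rw [abs_le]; constructor <;> linarith
  refine k.trans ?_
  have f1 : (1 : ℝ) ≤ 3 * (1 / ((N : ℝ) + 3)) * (N + 1) := by
    rw [mul_one_div, div_mul_eq_mul_div, le_div_iff₀ (by positivity)]; linarith
  have f2 : (C + C') * 1 ≤ (C + C') * (3 * (1 / ((N : ℝ) + 3)) * (N + 1)) := by gcongr
  have f3 : 0 ≤ (C + C') * ρ' ^ 2 * (N + 1) := by positivity
  linarith

lemma re_sum_of_BC {N : ℕ} {μ : ℝ} {y : ℕ → ℂ} (hy : BC (N + 3) μ y) :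
    (∑ k ∈ Finset.range (N + 2), Uc y k).re = (N + 2) * μ := by
  rw [sum_Uc, hy]; push_cast; ring

lemma Egen_adm {v₂ v₃ : ℝ → ℝ} (h : PotentialPair v₂ v₃) (ρ ρ' : ℝ) {N : ℕ} {y : ℕ → ℂ}
    (hy : Admissible (N + 3) y) : Egen v₂ v₃ ρ ρ' (N + 3) y = ECh v₂ v₃ ρ ρ' N (Uc y) :=
  Egen_eq h ρ ρ' N y (fun k hk => ((AdmU_of_adm hy).1 k hk).1)

lemma char_curved {v₂ v₃ : ℝ → ℝ} (h : PotentialPair v₂ v₃) {m₁ m₂ ρ b0 ψ κ : ℝ} (hm₁ : 2 / 3 < m₁)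
    (hm₂ : m₂ ≤ 1) (hb : 0.99 ≤ b0) (hb' : b0 ≤ 1.01) (h0 : 0 < ψ) (h1 : ψ ≤ 0.001)
    (hcm : CellMin v₂ v₃ ρ b0 (cos ψ) κ) (hl : m₂ < ell b0 ψ 1) :
    ∃ c : ℝ, 0 < c ∧ ∀ ρ' : ℝ, 0 < ρ' → ρ' ≤ 1 → ∃ egen : ℝ, ∃ erange : ℝ → ℝ,
      StrictMonoOn erange (Set.Icc m₁ m₂) ∧ ConvexOn ℝ (Set.Icc m₁ m₂) erange ∧
      PiecewiseAffOn erange (Set.Icc m₁ m₂) ∧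
      ∀ μ ∈ Set.Icc m₁ m₂, ∀ n : ℕ, 3 ≤ n →
        |egen + ρ' * erange μ - Emin v₂ v₃ ρ ρ' μ n| ≤ c * (ρ' ^ 2 + 1 / (n : ℝ)) := by
  have hb0 : 0 < b0 := lt_of_lt_of_le (by norm_num) hb
  have h1' : ψ ≤ 1 := h1.trans (by norm_num)
  have hne := Ms_nonempty h0 h1'
  obtain ⟨p, hpe⟩ : ∃ p, p = v₂ (b0 * Real.sqrt (5 + 4 * cos ψ)) - v₂ (b0 * (1 + 2 * cos ψ)) := ⟨_, rfl⟩
  have hp : 0 < p := by rw [hpe]; exact p_pos h hb h0 (h1.trans (by norm_num))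
  have hcψ : 9 / 10 ≤ cos ψ := by
    have := one_sub_sq_div_two_le_cos (x := ψ)
    have h3 : ψ ^ 2 ≤ 0.001 ^ 2 := by gcongr
    norm_num at *; linarith
  have hqpos : ∀ m ∈ Ms ψ, 0 < qm b0 ψ p m := by
    intro m hm
    obtain ⟨a1, a2⟩ := (mem_Ms h0).1 hm
    exact (line_props hb0 h0 hp a1 a2).1
  have low : ∀ m : ℕ, ∃ C ≥ 0, m ∈ Ms ψ → ∀ ρ', 0 < ρ' → ρ' ≤ 1 → ∀ (N : ℕ) (u : ℕ → ℂ) (μ : ℝ),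
      0 ≤ μ → AdmU N u → (∑ k ∈ Finset.range (N + 2), u k).re = (N + 2) * μ →
      (N + 1) * (Ff v₂ v₃ ρ b0 b0 (cos ψ) + ρ' * (v₂ (b0 * (1 + 2 * cos ψ)) +
        (qm b0 ψ p m * μ - Am b0 ψ p m))) - C - C * ρ' ^ 2 * (N + 1) ≤ ECh v₂ v₃ ρ ρ' N u := by
    intro m
    by_cases hm : m ∈ Ms ψ
    · obtain ⟨a1, a2⟩ := (mem_Ms h0).1 hm
      obtain ⟨l1, l2, -, -⟩ := line_props hb0 h0 hp a1 a2
      obtain ⟨C, hC, hh⟩ := lower_line h h0 h1' hcψ (le_trans (by norm_num) hb)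
        (hb'.trans (by norm_num)) hcm l1.le hp.le hpe l2
      exact ⟨C, hC, fun _ => hh⟩
    · exact ⟨0, le_refl _, fun h => absurd h hm⟩
  choose Cm hCm hlow using low
  set C := ∑ m ∈ Ms ψ, Cm m with hCdef
  have hC : 0 ≤ C := Finset.sum_nonneg (fun i _ => hCm i)
  have hCle : ∀ m ∈ Ms ψ, Cm m ≤ C := fun m hm =>
    Finset.single_le_sum (f := Cm) (fun i _ => hCm i) hm
  obtain ⟨C', hC', hup⟩ := upper_psi h hb hb' h0 h1 hp hpe hne hl hm₂ ρ
  refine ⟨3 * (C + C') + 1, by positivity, ?_⟩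
  intro ρ' hρ hρ1
  refine ⟨Ff v₂ v₃ ρ b0 b0 (cos ψ) + ρ' * v₂ (b0 * (1 + 2 * cos ψ)), er b0 ψ p hne,
    (supline_strictMono hne hqpos).strictMonoOn _, supline_convex hne (convex_Icc _ _),
    supline_piecewise hne _, ?_⟩
  intro μ hμ n hn
  obtain ⟨N, rfl⟩ : ∃ N, n = N + 3 := ⟨n - 3, by omega⟩
  have main := emin_bound (v₂ := v₂) (v₃ := v₃) (ρ := ρ) (ρ' := ρ') (μ := μ) (N := N)
    (E := Ff v₂ v₃ ρ b0 b0 (cos ψ) + ρ' * (v₂ (b0 * (1 + 2 * cos ψ)) + er b0 ψ p hne μ)) hC hC'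
    (by
      intro y y1 y2
      obtain ⟨m, hm, hme⟩ := Finset.exists_mem_eq_sup' hne (fun m => qm b0 ψ p m * μ - Am b0 ψ p m)
      have hme' : er b0 ψ p hne μ = qm b0 ψ p m * μ - Am b0 ψ p m := hme
      rw [hme', Egen_adm h ρ ρ' y1]
      refine le_trans ?_ (hlow m hm ρ' hρ hρ1 N (Uc y) μ (by linarith [hμ.1]) (AdmU_of_adm y1)
        (re_sum_of_BC y2))
      have a1 := hCle m hm
      have a2 : Cm m * ρ' ^ 2 * (N + 1) ≤ C * ρ' ^ 2 * (N + 1) := by gcongr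
      linarith)
    (hup ρ' hρ hρ1 N μ (by linarith [hμ.1]) hμ.2)
  have e : Ff v₂ v₃ ρ b0 b0 (cos ψ) + ρ' * v₂ (b0 * (1 + 2 * cos ψ)) + ρ' * er b0 ψ p hne μ =
      Ff v₂ v₃ ρ b0 b0 (cos ψ) + ρ' * (v₂ (b0 * (1 + 2 * cos ψ)) + er b0 ψ p hne μ) := by ring
  rw [e]
  refine main.trans ?_
  gcongr
  linarith

lemma char_flat {v₂ v₃ : ℝ → ℝ} (h : PotentialPair v₂ v₃) {m₁ m₂ ρ b0 κ : ℝ} (hm₁ : 2 / 3 < m₁)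
    (hm₂ : m₂ ≤ 1) (hb : 0.99 ≤ b0) (hb' : b0 ≤ 1.01)
    (hcm : CellMin v₂ v₃ ρ b0 1 κ) (hl : m₂ < b0) :
    ∃ c : ℝ, 0 < c ∧ ∀ ρ' : ℝ, 0 < ρ' → ρ' ≤ 1 → ∃ egen : ℝ, ∃ erange : ℝ → ℝ,
      StrictMonoOn erange (Set.Icc m₁ m₂) ∧ ConvexOn ℝ (Set.Icc m₁ m₂) erange ∧
      PiecewiseAffOn erange (Set.Icc m₁ m₂) ∧
      ∀ μ ∈ Set.Icc m₁ m₂, ∀ n : ℕ, 3 ≤ n →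
        |egen + ρ' * erange μ - Emin v₂ v₃ ρ ρ' μ n| ≤ c * (ρ' ^ 2 + 1 / (n : ℝ)) := by
  have hb0 : 0 < b0 := lt_of_lt_of_le (by norm_num) hb
  obtain ⟨C, hC, hlow⟩ := lower_flat h (le_trans (by norm_num) hb) (hb'.trans (by norm_num)) hcm
  have hv : -1 ≤ v₂ (3 * b0) := h.v₂_lb _ (by simp only [Set.mem_Ioi]; positivity)
  refine ⟨3 * (C + 1) + 1, by positivity, ?_⟩
  intro ρ' hρ hρ1
  refine ⟨Ff v₂ v₃ ρ b0 b0 1 + ρ' * v₂ (3 * b0), fun x => ρ' * x, ?_, ⟨convex_Icc _ _, ?_⟩, ?_, ?_⟩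
  · intro x _ y _ hxy
    exact mul_lt_mul_of_pos_left hxy hρ
  · intro x _ y _ a b _ _ _
    simp only [smul_eq_mul]
    apply le_of_eq; ring
  · exact ⟨∅, fun a b _ _ _ _ => ⟨ρ', 0, fun x _ => by simp⟩⟩
  intro μ hμ n hn
  obtain ⟨N, rfl⟩ : ∃ N, n = N + 3 := ⟨n - 3, by omega⟩
  have main := emin_bound (v₂ := v₂) (v₃ := v₃) (ρ := ρ) (ρ' := ρ') (μ := μ) (N := N)
    (E := Ff v₂ v₃ ρ b0 b0 1 + ρ' * v₂ (3 * b0)) hC zero_le_one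
    (by
      intro y y1 y2
      rw [Egen_adm h ρ ρ' y1]
      exact hlow ρ' hρ hρ1 N (Uc y) (AdmU_of_adm y1))
    (by
      obtain ⟨y, y1, y2, y3⟩ := straight_chain h hb hb' N (μ := μ) (by linarith [hμ.1])
        (by linarith [hμ.2]) ρ ρ'
      refine ⟨y, y1, y2, ?_⟩
      rw [y3]
      have : ρ' * (-v₂ (3 * b0)) ≤ 1 := by
        calc ρ' * (-v₂ (3 * b0)) ≤ ρ' * 1 := by gcongr; linarith
          _ ≤ 1 := by linarith
      linarith)
  have hn0 : 0 ≤ 1 / ((N + 3 : ℕ) : ℝ) := by positivity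
  have hμ0 : |ρ' * (ρ' * μ)| ≤ ρ' ^ 2 := by
    rw [abs_of_nonneg (by have := hμ.1; have : 0 ≤ μ := by linarith
                          positivity)]
    have : ρ' ^ 2 * μ ≤ ρ' ^ 2 * 1 := by gcongr; linarith [hμ.2]
    linarith
  calc |Ff v₂ v₃ ρ b0 b0 1 + ρ' * v₂ (3 * b0) + ρ' * (ρ' * μ) - Emin v₂ v₃ ρ ρ' μ (N + 3)|
      = |(Ff v₂ v₃ ρ b0 b0 1 + ρ' * v₂ (3 * b0) - Emin v₂ v₃ ρ ρ' μ (N + 3)) + ρ' * (ρ' * μ)| := by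
        congr 1; ring
    _ ≤ _ := abs_add_le _ _
    _ ≤ 3 * (C + 1) * (ρ' ^ 2 + 1 / ((N + 3 : ℕ) : ℝ)) + ρ' ^ 2 := add_le_add main hμ0
    _ ≤ _ := by linarith

/-- characterization of the minimal energy. -/
theorem minimal_energy_characterization (v₂ v₃ : ℝ → ℝ) (hpot : PotentialPair v₂ v₃)
    (m₁ m₂ : ℝ) (hm₁ : 2 / 3 < m₁) (hm : m₁ ≤ m₂) (hm₂ : m₂ < 1) :
    ∃ ρ₀ η : ℝ, 0 < ρ₀ ∧ 0 < η ∧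
      ∀ ρ : ℝ, 0 < ρ → ρ ≤ ρ₀ →
        ∃ c : ℝ, 0 < c ∧
          ∀ ρ' : ℝ, 0 < ρ' → ρ' ≤ η * ρ →
            ∃ egen : ℝ, ∃ erange : ℝ → ℝ,
              StrictMonoOn erange (Set.Icc m₁ m₂) ∧
              ConvexOn ℝ (Set.Icc m₁ m₂) erange ∧
              PiecewiseAffOn erange (Set.Icc m₁ m₂) ∧
              ∀ μ ∈ Set.Icc m₁ m₂, ∀ n : ℕ, 3 ≤ n →
                |egen + ρ' * erange μ - Emin v₂ v₃ ρ ρ' μ n| ≤ c * (ρ' ^ 2 + 1 / (n : ℝ)) := by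
  set ε : ℝ := min 0.01 (min (1 - cos 0.001) ((1 - m₂) / 3)) with hε
  have hpi := pi_gt_three
  have hc1 : cos 0.001 < 1 := by
    have := cos_lt_cos_of_nonneg_of_le_pi (le_refl 0) (y := 0.001) (by norm_num; linarith) (by norm_num)
    rwa [cos_zero] at this
  have hε0 : 0 < ε := by
    refine lt_min (by norm_num) (lt_min (by linarith) (by linarith))
  have e1 : ε ≤ 0.01 := min_le_left _ _
  have e2 : ε ≤ 1 - cos 0.001 := (min_le_right _ _).trans (min_le_left _ _)
  have e3 : ε ≤ (1 - m₂) / 3 := (min_le_right _ _).trans (min_le_right _ _)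
  obtain ⟨ρ₀, hρ₀, hcell⟩ := cell_lemma hpot hε0
  refine ⟨min ρ₀ 1, 1, lt_min hρ₀ one_pos, one_pos, ?_⟩
  intro ρ hρ hρle
  obtain ⟨b0, c, κ, hκ, hb, hcl, hcu, hmin⟩ := hcell ρ hρ (hρle.trans (min_le_left _ _))
  have hρ1 : ρ ≤ 1 := hρle.trans (min_le_right _ _)
  obtain ⟨hb1, hb2⟩ := abs_le.1 hb
  have b1 : (0.99 : ℝ) ≤ b0 := by
    have : (0.99 : ℝ) = 1 - 0.01 := by norm_num
    linarith
  have b2 : b0 ≤ (1.01 : ℝ) := by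
    have : (1.01 : ℝ) = 1 + 0.01 := by norm_num
    linarith
  have hcm : CellMin v₂ v₃ ρ b0 c κ := ⟨hκ, hmin⟩
  have key : ∃ c : ℝ, 0 < c ∧ ∀ ρ' : ℝ, 0 < ρ' → ρ' ≤ 1 → ∃ egen : ℝ, ∃ erange : ℝ → ℝ,
      StrictMonoOn erange (Set.Icc m₁ m₂) ∧ ConvexOn ℝ (Set.Icc m₁ m₂) erange ∧
      PiecewiseAffOn erange (Set.Icc m₁ m₂) ∧
      ∀ μ ∈ Set.Icc m₁ m₂, ∀ n : ℕ, 3 ≤ n →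
        |egen + ρ' * erange μ - Emin v₂ v₃ ρ ρ' μ n| ≤ c * (ρ' ^ 2 + 1 / (n : ℝ)) := by
    rcases hcu.eq_or_lt with hc | hc
    · rw [hc] at hcm
      exact char_flat hpot hm₁ hm₂.le b1 b2 hcm (by linarith)
    · have hcn : 0 ≤ c := by norm_num at *; linarith
      have hψ0 : 0 < arccos c := arccos_pos.2 hc
      have hψ1 : arccos c ≤ 0.001 := by
        have : arccos c ≤ arccos (cos 0.001) := arccos_le_arccos (by linarith)
        rwa [arccos_cos (by norm_num) (by norm_num; linarith)] at this
      have hψ2 : arccos c ≤ 1 := hψ1.trans (by norm_num)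
      have hcos : cos (arccos c) = c := cos_arccos (by linarith) hcu
      rw [← hcos] at hcm
      refine char_curved hpot hm₁ hm₂.le b1 b2 hψ0 hψ1 hcm ?_
      rw [ell_one hψ0 hψ2]
      have h2 : cos (arccos c) ≤ cos (arccos c / 2) :=
        cos_le_cos_of_nonneg_of_le_pi (by linarith) (by linarith) (by linarith)
      rw [hcos] at h2
      have h3 : (1 - ε) * (1 - ε) ≤ b0 * cos (arccos c / 2) := by
        have : 0 ≤ 1 - ε := by norm_num at *; linarith
        apply mul_le_mul (by linarith) (by linarith) this
        norm_num at *; linarith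
      nlinarith
  obtain ⟨c', hc', hk⟩ := key
  refine ⟨c', hc', fun ρ' h1 h2 => hk ρ' h1 (by linarith)⟩

end
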